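/- arXiv:1708.03996 — 2 statements merged into one kernel-verified Lean document; each statement's English description precedes it below -/
import Mathlib

section
/- For every integer g ≥ 3 and every real ε > 0, there exists a finite cubic (3-regular) simple graph G whose girth is at least g and whose independence number satisfies α(G) < (0.454 + ε)·|V(G)|. (Equivalently, i(3,g) ≤ 0.454 for every g, so i(3,∞) = lim_{g→∞} i(3,g) ≤ 0.454.) -/
/-- A set of vertices is independent if its vertices are pairwise nonadjacent. -/
def IsIndep {V : Type*} (G : SimpleGraph V) (s : Set V) : Prop :=
  s.Pairwise fun u v => ¬ G.Adj u v

/-- The independence number of a graph: the largest size of an independent set. -/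
noncomputable def indepNum {V : Type*} (G : SimpleGraph V) : ℕ :=
  sSup {n | ∃ s : Set V, IsIndep G s ∧ s.ncard = n}

/-- A graph is cubic (3-regular) if every vertex has exactly three neighbors. -/
def IsCubic {V : Type*} (G : SimpleGraph V) : Prop :=
  ∀ v : V, (G.neighborSet v).ncard = 3

/-- `A` is an AI set (almost independent set) if the subgraph induced by `A` has maximum
degree at most 1, i.e. every vertex of `A` has at most one neighbor inside `A`. -/
def IsAI {V : Type*} (G : SimpleGraph V) (A : Set V) : Prop :=
  ∀ a ∈ A, ({b | b ∈ A ∧ G.Adj a b}).ncard ≤ 1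

/-- `A` is a MAI set (maximum almost independent set) if `A` is an AI set containing an
independent set of maximum size `α(G)`, and `A` is largest among such sets. -/
def IsMAI {V : Type*} (G : SimpleGraph V) (A : Set V) : Prop :=
  IsAI G A ∧ (∃ s ⊆ A, IsIndep G s ∧ s.ncard = indepNum G) ∧
    ∀ A' : Set V, IsAI G A' → (∃ s ⊆ A', IsIndep G s ∧ s.ncard = indepNum G) →
      A'.ncard ≤ A.ncard

open Finset

theorem sum_sum_pow_correlation_nonneg {Ω κ : Type*} (s : Finset Ω) (t : Finset κ) (p : Ω → ℝ)
    (hp : ∀ ω ∈ s, 0 ≤ p ω) (hp1 : ∑ ω ∈ s, p ω = 1) (x : κ → Ω → ℝ) (q : ℝ) (k : ℕ) :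
    0 ≤ ∑ h ∈ t, ∑ h' ∈ t, (∑ ω ∈ s, p ω * (x h ω * x h' ω)) ^ k
      - 2 * #t * ∑ h ∈ t, (q * ∑ ω ∈ s, p ω * x h ω) ^ k + (#t : ℝ) ^ 2 * (q ^ 2) ^ k := by
  classical
  set P := Fintype.piFinset fun _ : Fin k => s
  have hpair : ∀ h h', (∑ ω ∈ s, p ω * (x h ω * x h' ω)) ^ k =
      ∑ w ∈ P, (∏ i, p (w i)) * ((∏ i, x h (w i)) * ∏ i, x h' (w i)) := fun h h' => by
    rw [Finset.sum_pow']
    exact sum_congr rfl fun w _ => by simp only [prod_mul_distrib]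
  have hsingle : ∀ h, (q * ∑ ω ∈ s, p ω * x h ω) ^ k =
      ∑ w ∈ P, (∏ i, p (w i)) * (q ^ k * ∏ i, x h (w i)) := fun h => by
    rw [mul_pow, Finset.sum_pow', mul_sum]
    exact sum_congr rfl fun w _ => by simp only [prod_mul_distrib]; ring
  have hone : ∑ w ∈ P, ∏ i, p (w i) = 1 := by
    rw [← Finset.sum_pow' s p k, hp1, one_pow]
  have key : ∑ h ∈ t, ∑ h' ∈ t, (∑ ω ∈ s, p ω * (x h ω * x h' ω)) ^ k
      - 2 * #t * ∑ h ∈ t, (q * ∑ ω ∈ s, p ω * x h ω) ^ k + (#t : ℝ) ^ 2 * (q ^ 2) ^ k =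
      ∑ w ∈ P, (∏ i, p (w i)) * (∑ h ∈ t, ∏ i, x h (w i) - #t * q ^ k) ^ 2 := by
    have h1 : ∑ h ∈ t, ∑ h' ∈ t, (∑ ω ∈ s, p ω * (x h ω * x h' ω)) ^ k =
        ∑ w ∈ P, (∏ i, p (w i)) * (∑ h ∈ t, ∏ i, x h (w i)) ^ 2 := by
      simp only [hpair]
      rw [sum_congr rfl fun h _ => sum_comm, sum_comm]
      refine sum_congr rfl fun w _ => ?_
      rw [sq, sum_mul_sum, mul_sum]
      exact sum_congr rfl fun h _ => by rw [mul_sum]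
    have h2 : ∑ h ∈ t, (q * ∑ ω ∈ s, p ω * x h ω) ^ k =
        ∑ w ∈ P, (∏ i, p (w i)) * (q ^ k * ∑ h ∈ t, ∏ i, x h (w i)) := by
      simp only [hsingle]
      rw [sum_comm]
      exact sum_congr rfl fun w _ => by simp only [mul_sum]
    rw [h1, h2, ← mul_one ((#t : ℝ) ^ 2 * (q ^ 2) ^ k), ← hone, mul_sum, mul_sum,
      ← sum_sub_distrib, ← sum_add_distrib]
    exact sum_congr rfl fun w _ => by ring
  rw [key]
  refine sum_nonneg fun w hw => mul_nonneg (prod_nonneg fun i _ => hp _ ?_) (sq_nonneg _)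
  exact Fintype.mem_piFinset.1 hw i

theorem sum_sum_log_le {Ω κ : Type*} (s : Finset Ω) (t : Finset κ) (p : Ω → ℝ)
    (hp : ∀ ω ∈ s, 0 ≤ p ω) (hp1 : ∑ ω ∈ s, p ω = 1) (x : κ → Ω → ℝ)
    (hx0 : ∀ h ω, 0 ≤ x h ω) (hx1 : ∀ h ω, x h ω ≤ 1) {c q : ℝ} (hc0 : 0 ≤ c) (hc1 : c < 1)
    (hq0 : 0 ≤ q) (hq1 : q ≤ 1) :
    ∑ h ∈ t, ∑ h' ∈ t, Real.log (1 - c * ∑ ω ∈ s, p ω * (x h ω * x h' ω)) ≤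
      2 * #t * ∑ h ∈ t, Real.log (1 - c * (q * ∑ ω ∈ s, p ω * x h ω))
        - (#t : ℝ) ^ 2 * Real.log (1 - c * q ^ 2) := by
  have series : ∀ y : ℝ, 0 ≤ y → y ≤ 1 →
      HasSum (fun k : ℕ => c ^ (k + 1) / (k + 1) * y ^ (k + 1)) (-Real.log (1 - c * y)) :=
    fun y hy0 hy1 => by
      have hlt : |c * y| < 1 := by
        rw [abs_of_nonneg (by positivity)]
        nlinarith
      have := Real.hasSum_pow_div_log_of_abs_lt_one hlt
      refine this.congr_fun fun k => ?_
      rw [mul_pow]; ring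
  have mean0 : ∀ f : Ω → ℝ, (∀ ω, 0 ≤ f ω) → 0 ≤ ∑ ω ∈ s, p ω * f ω := fun f hf =>
    sum_nonneg fun ω hω => mul_nonneg (hp ω hω) (hf ω)
  have mean1 : ∀ f : Ω → ℝ, (∀ ω, f ω ≤ 1) → ∑ ω ∈ s, p ω * f ω ≤ 1 := fun f hf => by
    rw [← hp1]
    exact sum_le_sum fun ω hω => mul_le_of_le_one_right (hp ω hω) (hf ω)
  have H1 := hasSum_sum (s := t) fun h _ => hasSum_sum (s := t) fun h' _ =>
    series (∑ ω ∈ s, p ω * (x h ω * x h' ω))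
      (mean0 _ fun ω => mul_nonneg (hx0 h ω) (hx0 h' ω))
      (mean1 _ fun ω => mul_le_one₀ (hx1 h ω) (hx0 h' ω) (hx1 h' ω))
  have H2 := (hasSum_sum (s := t) fun h _ => series (q * ∑ ω ∈ s, p ω * x h ω)
    (mul_nonneg hq0 (mean0 _ (hx0 h)))
    (mul_le_one₀ hq1 (mean0 _ (hx0 h)) (mean1 _ (hx1 h)))).mul_left (2 * (#t : ℝ))
  have H3 := (series (q ^ 2) (by positivity) (pow_le_one₀ hq0 hq1)).mul_left ((#t : ℝ) ^ 2)
  have H := ((H1.sub H2).add H3).nonneg fun k => by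
    have := mul_nonneg (a := c ^ (k + 1) / (k + 1)) (by positivity)
      (sum_sum_pow_correlation_nonneg s t p hp hp1 x q (k + 1))
    refine this.trans_eq ?_
    simp only [mul_add, mul_sub, mul_sum]
    congr 1
    · congr 1
      exact sum_congr rfl fun _ _ => by ring
    · ring
  simp only [sum_neg_distrib] at H
  linarith

section Interpolation

variable {H : Type*} [DecidableEq H]

/-- A set function that drops by at most one whenever an element is inserted. -/
structure HasUnitDrops (A : Finset H → ℕ) : Prop where
  insert_le : ∀ h S, A (insert h S) ≤ A S
  le_insert_succ : ∀ h S, A S ≤ A (insert h S) + 1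

/-- The amount by which `A S` decreases when `h` is inserted into `S`. -/
def drop (A : Finset H → ℕ) (h : H) (S : Finset H) : ℝ := A S - A (insert h S)

/-- The probability that a `q`-random subset of `R` equals `S`. -/
def bernoulliWeight (q : ℝ) (R S : Finset H) : ℝ := q ^ #S * (1 - q) ^ #(R \ S)

/-- The expectation of `lam ^ A S` for a `q`-random subset `S` of `R`. -/
def partitionFn (lam q : ℝ) (A : Finset H → ℕ) (R : Finset H) : ℝ :=
  ∑ S ∈ R.powerset, bernoulliWeight q R S * lam ^ A S

/-- The average of `log (partitionFn lam q A R)` over the `b`-subsets `R` of `T`. -/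
noncomputable def meanLog (lam q : ℝ) (A : Finset H → ℕ) (T : Finset H) (b : ℕ) : ℝ :=
  (∑ R ∈ T.powersetCard b, Real.log (partitionFn lam q A R)) / (#T).choose b

theorem HasUnitDrops.drop_eq {A : Finset H → ℕ} (hA : HasUnitDrops A) (h : H) (S : Finset H) :
    (A (insert h S) = A S ∧ drop A h S = 0) ∨ (A (insert h S) + 1 = A S ∧ drop A h S = 1) := by
  have h1 := hA.insert_le h S
  have h2 := hA.le_insert_succ h S
  obtain h3 | h3 : A (insert h S) = A S ∨ A (insert h S) + 1 = A S := by omega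
  · exact Or.inl ⟨h3, by simp [drop, h3]⟩
  · exact Or.inr ⟨h3, by simp [drop, ← h3]⟩

theorem HasUnitDrops.drop_nonneg {A : Finset H → ℕ} (hA : HasUnitDrops A) (h : H)
    (S : Finset H) : 0 ≤ drop A h S := by
  rcases hA.drop_eq h S with h | h <;> simp [h.2]

theorem HasUnitDrops.drop_le_one {A : Finset H → ℕ} (hA : HasUnitDrops A) (h : H)
    (S : Finset H) : drop A h S ≤ 1 := by
  rcases hA.drop_eq h S with h | h <;> simp [h.2]

theorem HasUnitDrops.pow_insert {A : Finset H → ℕ} (hA : HasUnitDrops A) {lam : ℝ}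
    (hlam : 1 < lam) (h : H) (S : Finset H) :
    lam ^ A (insert h S) = lam ^ A S * (1 - (1 - 1 / lam) * drop A h S) := by
  have : lam ≠ 0 := by positivity
  rcases hA.drop_eq h S with ⟨h1, h2⟩ | ⟨h1, h2⟩
  · simp [h1, h2]
  · rw [h2, ← h1, pow_succ]; field_simp; ring

theorem bernoulliWeight_nonneg {q : ℝ} (hq0 : 0 ≤ q) (hq1 : q ≤ 1) (R S : Finset H) :
    0 ≤ bernoulliWeight q R S :=
  mul_nonneg (pow_nonneg hq0 _) (pow_nonneg (sub_nonneg.2 hq1) _)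

theorem sum_bernoulliWeight (q : ℝ) (R : Finset H) :
    ∑ S ∈ R.powerset, bernoulliWeight q R S = 1 := by
  have := Finset.sum_pow_mul_eq_add_pow q (1 - q) R
  rw [add_sub_cancel, one_pow] at this
  rw [← this]
  refine sum_congr rfl fun S hS => ?_
  rw [bernoulliWeight, card_sdiff_of_subset (mem_powerset.1 hS)]

theorem one_le_partitionFn {lam q : ℝ} (hlam : 1 < lam) (hq0 : 0 ≤ q) (hq1 : q ≤ 1)
    (A : Finset H → ℕ) (R : Finset H) : 1 ≤ partitionFn lam q A R := by
  rw [← sum_bernoulliWeight q R, partitionFn]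
  exact sum_le_sum fun S _ =>
    le_mul_of_one_le_right (bernoulliWeight_nonneg hq0 hq1 R S) (one_le_pow₀ hlam.le)

theorem partitionFn_mono {lam q : ℝ} (hlam : 1 < lam) (hq0 : 0 ≤ q) (hq1 : q ≤ 1)
    {A B : Finset H → ℕ} (hAB : ∀ S, A S ≤ B S) (R : Finset H) :
    partitionFn lam q A R ≤ partitionFn lam q B R :=
  sum_le_sum fun S _ => mul_le_mul_of_nonneg_left (pow_le_pow_right₀ hlam.le (hAB S))
    (bernoulliWeight_nonneg hq0 hq1 R S)

theorem bernoulliWeight_insert {q : ℝ} {R S : Finset H} {h : H} (hR : h ∉ R) (hS : S ⊆ R) :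
    bernoulliWeight q (insert h R) S = (1 - q) * bernoulliWeight q R S ∧
      bernoulliWeight q (insert h R) (insert h S) = q * bernoulliWeight q R S := by
  have hhS : h ∉ S := fun hh => hR (hS hh)
  constructor
  · rw [bernoulliWeight, bernoulliWeight, insert_sdiff_of_notMem _ hhS,
      card_insert_of_notMem (by simp [hR])]
    ring
  · rw [bernoulliWeight, bernoulliWeight, card_insert_of_notMem hhS, insert_sdiff_insert,
      sdiff_insert, erase_eq_of_notMem (by simp [hR])]
    ring

theorem HasUnitDrops.partitionFn_insert {A : Finset H → ℕ} (hA : HasUnitDrops A) {lam : ℝ}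
    (hlam : 1 < lam) (q : ℝ) {R : Finset H} {h : H} (hR : h ∉ R) :
    partitionFn lam q A (insert h R) = ∑ S ∈ R.powerset,
      bernoulliWeight q R S * lam ^ A S * (1 - (1 - 1 / lam) * (q * drop A h S)) := by
  rw [partitionFn, sum_powerset_insert hR, ← sum_add_distrib]
  refine sum_congr rfl fun S hS => ?_
  obtain ⟨h1, h2⟩ := bernoulliWeight_insert (q := q) hR (mem_powerset.1 hS)
  rw [h1, h2, hA.pow_insert hlam]
  ring

/-- The law of a `q`-random subset of `R` tilted by `lam ^ A`. -/
noncomputable def tiltedWeight (lam q : ℝ) (A : Finset H → ℕ) (R S : Finset H) : ℝ :=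
  bernoulliWeight q R S * lam ^ A S / partitionFn lam q A R

theorem tiltedWeight_nonneg {lam q : ℝ} (hlam : 1 < lam) (hq0 : 0 ≤ q) (hq1 : q ≤ 1)
    (A : Finset H → ℕ) (R S : Finset H) : 0 ≤ tiltedWeight lam q A R S :=
  div_nonneg (mul_nonneg (bernoulliWeight_nonneg hq0 hq1 R S) (by positivity))
    (zero_le_one.trans (one_le_partitionFn hlam hq0 hq1 A R))

theorem sum_tiltedWeight {lam q : ℝ} (hlam : 1 < lam) (hq0 : 0 ≤ q) (hq1 : q ≤ 1)
    (A : Finset H → ℕ) (R : Finset H) : ∑ S ∈ R.powerset, tiltedWeight lam q A R S = 1 := by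
  simp only [tiltedWeight]
  rw [← sum_div]
  exact div_self (zero_lt_one.trans_le (one_le_partitionFn hlam hq0 hq1 A R)).ne'

theorem partitionFn_mul_tilted {lam q : ℝ} (hlam : 1 < lam) (hq0 : 0 ≤ q) (hq1 : q ≤ 1)
    (A : Finset H → ℕ) (R : Finset H) (c : ℝ) (f : Finset H → ℝ) :
    ∑ S ∈ R.powerset, bernoulliWeight q R S * lam ^ A S * (1 - c * f S) =
      partitionFn lam q A R * (1 - c * ∑ S ∈ R.powerset, tiltedWeight lam q A R S * f S) := by
  have hZ := (zero_lt_one.trans_le (one_le_partitionFn hlam hq0 hq1 A R)).ne'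
  have hmean : 1 - c * ∑ S ∈ R.powerset, tiltedWeight lam q A R S * f S =
      ∑ S ∈ R.powerset, tiltedWeight lam q A R S * (1 - c * f S) := by
    simp only [mul_sub, mul_one, sum_sub_distrib, sum_tiltedWeight hlam hq0 hq1 A R]
    rw [mul_sum]
    exact congrArg _ (sum_congr rfl fun S _ => by ring)
  rw [hmean, mul_sum]
  refine sum_congr rfl fun S _ => ?_
  rw [tiltedWeight]
  field_simp

theorem inv_le_one_sub_tilted {lam q : ℝ} (hlam : 1 < lam) (hq0 : 0 ≤ q) (hq1 : q ≤ 1)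
    (A : Finset H → ℕ) (R : Finset H) {f : Finset H → ℝ} (hf : ∀ S, f S ≤ 1) :
    lam⁻¹ ≤ 1 - (1 - 1 / lam) * ∑ S ∈ R.powerset, tiltedWeight lam q A R S * f S := by
  have h1 : ∑ S ∈ R.powerset, tiltedWeight lam q A R S * f S ≤ 1 := by
    rw [← sum_tiltedWeight hlam hq0 hq1 A R]
    exact sum_le_sum fun S _ =>
      mul_le_of_le_one_right (tiltedWeight_nonneg hlam hq0 hq1 A R S) (hf S)
  have h2 : 1 / lam < 1 := (div_lt_one (by positivity)).2 hlam
  have h3 := mul_le_mul_of_nonneg_left h1 (sub_nonneg.2 h2.le)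
  rw [← one_div]
  linarith

theorem neg_log_le_log_one_sub_tilted {lam q : ℝ} (hlam : 1 < lam) (hq0 : 0 ≤ q) (hq1 : q ≤ 1)
    (A : Finset H → ℕ) (R : Finset H) {f : Finset H → ℝ} (hf : ∀ S, f S ≤ 1) :
    -Real.log lam ≤
      Real.log (1 - (1 - 1 / lam) * ∑ S ∈ R.powerset, tiltedWeight lam q A R S * f S) := by
  rw [← Real.log_inv]
  exact Real.log_le_log (by positivity) (inv_le_one_sub_tilted hlam hq0 hq1 A R hf)

theorem HasUnitDrops.log_partitionFn_insert {A : Finset H → ℕ} (hA : HasUnitDrops A)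
    {lam q : ℝ} (hlam : 1 < lam) (hq0 : 0 ≤ q) (hq1 : q ≤ 1) {R : Finset H} {h : H}
    (hR : h ∉ R) :
    Real.log (partitionFn lam q A (insert h R)) = Real.log (partitionFn lam q A R) +
      Real.log (1 - (1 - 1 / lam) *
        (q * ∑ S ∈ R.powerset, tiltedWeight lam q A R S * drop A h S)) := by
  have hsum : q * ∑ S ∈ R.powerset, tiltedWeight lam q A R S * drop A h S =
      ∑ S ∈ R.powerset, tiltedWeight lam q A R S * (q * drop A h S) := by
    rw [mul_sum]
    exact sum_congr rfl fun S _ => by ring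
  rw [hA.partitionFn_insert hlam q hR, partitionFn_mul_tilted hlam hq0 hq1, hsum,
    Real.log_mul (zero_lt_one.trans_le (one_le_partitionFn hlam hq0 hq1 A R)).ne']
  have := inv_le_one_sub_tilted hlam hq0 hq1 A R (f := fun S => q * drop A h S)
    fun S => mul_le_one₀ hq1 (hA.drop_nonneg h S) (hA.drop_le_one h S)
  exact (lt_of_lt_of_le (by positivity) this).ne'

theorem HasUnitDrops.log_partitionFn_insert_le {A : Finset H → ℕ} (hA : HasUnitDrops A)
    {lam q : ℝ} (hlam : 1 < lam) (hq0 : 0 ≤ q) (hq1 : q ≤ 1) {R : Finset H} {h : H}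
    (hR : h ∉ R) :
    Real.log (partitionFn lam q A (insert h R)) ≤ Real.log (partitionFn lam q A R) := by
  rw [hA.partitionFn_insert hlam q hR]
  refine Real.log_le_log ?_ (sum_le_sum fun S _ => mul_le_of_le_one_right ?_ ?_)
  · rw [← hA.partitionFn_insert hlam q hR]
    exact zero_lt_one.trans_le (one_le_partitionFn hlam hq0 hq1 A _)
  · exact mul_nonneg (bernoulliWeight_nonneg hq0 hq1 R S) (by positivity)
  · have h2 : 1 / lam < 1 := (div_lt_one (by positivity)).2 hlam
    have := mul_nonneg (sub_nonneg.2 h2.le) (mul_nonneg hq0 (hA.drop_nonneg h S))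
    linarith

theorem HasUnitDrops.le_log_partitionFn_insert {A : Finset H → ℕ} (hA : HasUnitDrops A)
    {lam q : ℝ} (hlam : 1 < lam) (hq0 : 0 ≤ q) (hq1 : q ≤ 1) {R : Finset H} {h : H}
    (hR : h ∉ R) :
    Real.log (partitionFn lam q A R) - Real.log lam ≤
      Real.log (partitionFn lam q A (insert h R)) := by
  rw [hA.log_partitionFn_insert hlam hq0 hq1 hR, mul_sum]
  have := neg_log_le_log_one_sub_tilted hlam hq0 hq1 A R (f := fun S => q * drop A h S)
    fun S => mul_le_one₀ hq1 (hA.drop_nonneg h S) (hA.drop_le_one h S)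
  simp only [mul_left_comm q]
  linarith

/-- Joining `h` and `h'` destroys a unit of `A` whenever both are forced. -/
theorem HasUnitDrops.log_partitionFn_le_of_joined {A B : Finset H → ℕ} (hA : HasUnitDrops A)
    {lam q : ℝ} (hlam : 1 < lam) (hq0 : 0 ≤ q) (hq1 : q ≤ 1) (R : Finset H) {h h' : H}
    (hBA : ∀ S, B S ≤ A S)
    (hB : ∀ S, A (insert h S) < A S → A (insert h' S) < A S → B S < A S) :
    Real.log (partitionFn lam q B R) ≤ Real.log (partitionFn lam q A R) +
      Real.log (1 - (1 - 1 / lam) * ∑ S ∈ R.powerset,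
        tiltedWeight lam q A R S * (drop A h S * drop A h' S)) := by
  have hpos := inv_le_one_sub_tilted hlam hq0 hq1 A R (f := fun S => drop A h S * drop A h' S)
    fun S => mul_le_one₀ (hA.drop_le_one h S) (hA.drop_nonneg h' S) (hA.drop_le_one h' S)
  rw [← Real.log_mul (zero_lt_one.trans_le (one_le_partitionFn hlam hq0 hq1 A R)).ne'
    (lt_of_lt_of_le (by positivity) hpos).ne', ← partitionFn_mul_tilted hlam hq0 hq1]
  refine Real.log_le_log (zero_lt_one.trans_le (one_le_partitionFn hlam hq0 hq1 B R))
    (sum_le_sum fun S _ => ?_)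
  rw [mul_assoc]
  refine mul_le_mul_of_nonneg_left ?_ (bernoulliWeight_nonneg hq0 hq1 R S)
  have hle := pow_le_pow_right₀ hlam.le (hBA S)
  rcases hA.drop_eq h S with ⟨h1, h2⟩ | ⟨h1, h2⟩
  · simpa [h2] using hle
  rcases hA.drop_eq h' S with ⟨h3, h4⟩ | ⟨h3, h4⟩
  · simpa [h4] using hle
  have hlt := hB S (by omega) (by omega)
  rw [h2, h4, mul_one, mul_one, sub_sub_cancel, mul_one_div, le_div_iff₀ (by positivity),
    ← pow_succ]
  exact pow_le_pow_right₀ hlam.le hlt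

theorem sum_offDiag_log_partitionFn_le {A : Finset H → ℕ} (hA : HasUnitDrops A)
    {lam q : ℝ} (hlam : 1 < lam) (hq0 : 0 ≤ q) (hq1 : q ≤ 1) {R t : Finset H}
    (hRt : ∀ h ∈ t, h ∉ R) (B : H → H → Finset H → ℕ) (bad : H → H → Prop) [DecidableRel bad]
    (hBA : ∀ h h' S, B h h' S ≤ A S)
    (hB : ∀ h ∈ t, ∀ h' ∈ t, ¬ bad h h' →
      ∀ S, A (insert h S) < A S → A (insert h' S) < A S → B h h' S < A S) :
    ∑ e ∈ t.offDiag, Real.log (partitionFn lam q (B e.1 e.2) R) ≤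
      #t * (#t - 1) * Real.log (partitionFn lam q A R)
      + 2 * #t * ∑ h ∈ t, (Real.log (partitionFn lam q A (insert h R)) -
          Real.log (partitionFn lam q A R))
      - (#t : ℝ) ^ 2 * Real.log (1 - (1 - 1 / lam) * q ^ 2) + #t * Real.log lam
      + Real.log lam * #{e ∈ t.offDiag | bad e.1 e.2} := by
  have hlam0 : 0 < lam := by positivity
  have hinv : 1 / lam < 1 := (div_lt_one hlam0).2 hlam
  have hinv0 : 0 < 1 / lam := by positivity
  set F : H → H → ℝ := fun h h' => Real.log (1 - (1 - 1 / lam) * ∑ S ∈ R.powerset,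
    tiltedWeight lam q A R S * (drop A h S * drop A h' S)) with hF
  have hFlow : ∀ h h', -Real.log lam ≤ F h h' := fun h h' =>
    neg_log_le_log_one_sub_tilted hlam hq0 hq1 A R fun S =>
      mul_le_one₀ (hA.drop_le_one h S) (hA.drop_nonneg h' S) (hA.drop_le_one h' S)
  have hmain := sum_sum_log_le R.powerset t (tiltedWeight lam q A R)
    (fun S _ => tiltedWeight_nonneg hlam hq0 hq1 A R S) (sum_tiltedWeight hlam hq0 hq1 A R)
    (drop A) hA.drop_nonneg hA.drop_le_one (c := 1 - 1 / lam) (by linarith) (by linarith)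
    hq0 hq1
  have hsplit : ∑ h ∈ t, ∑ h' ∈ t, F h h' = ∑ e ∈ t.offDiag, F e.1 e.2 + ∑ h ∈ t, F h h := by
    rw [← sum_product', ← diag_union_offDiag, sum_union (disjoint_diag_offDiag t), add_comm]
    congr 1
    exact sum_diag t fun e => F e.1 e.2
  have hdiag : -(#t * Real.log lam) ≤ ∑ h ∈ t, F h h := by
    have := sum_le_sum fun h (_ : h ∈ t) => hFlow h h
    simpa using this
  have hins : ∑ h ∈ t, Real.log (1 - (1 - 1 / lam) *
        (q * ∑ S ∈ R.powerset, tiltedWeight lam q A R S * drop A h S)) =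
      ∑ h ∈ t, (Real.log (partitionFn lam q A (insert h R)) -
          Real.log (partitionFn lam q A R)) :=
    sum_congr rfl fun h hh => by
      rw [hA.log_partitionFn_insert hlam hq0 hq1 (hRt h hh), add_sub_cancel_left]
  have hpair : ∀ e ∈ t.offDiag, Real.log (partitionFn lam q (B e.1 e.2) R) ≤
      Real.log (partitionFn lam q A R) + F e.1 e.2 +
        if bad e.1 e.2 then Real.log lam else 0 := fun e he => by
    obtain ⟨he1, he2, -⟩ := mem_offDiag.1 he
    split_ifs with hbad
    · have := Real.log_le_log
        (zero_lt_one.trans_le (one_le_partitionFn hlam hq0 hq1 (B e.1 e.2) R))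
        (partitionFn_mono hlam hq0 hq1 (hBA e.1 e.2) R)
      linarith [hFlow e.1 e.2]
    · rw [add_zero]
      exact hA.log_partitionFn_le_of_joined hlam hq0 hq1 R (hBA _ _)
        (hB _ he1 _ he2 hbad)
  have htotal := sum_le_sum hpair
  rw [sum_add_distrib, sum_add_distrib, sum_const, offDiag_card, nsmul_eq_mul,
    Nat.cast_sub (Nat.le_mul_self _), ← sum_filter, sum_const, nsmul_eq_mul] at htotal
  push_cast at htotal
  rw [hins] at hmain
  have : ∑ h ∈ t, ∑ h' ∈ t, F h h' ≤ _ := hmain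
  linarith

theorem sum_powersetCard_sum_insert (T : Finset H) (b : ℕ) (φ : Finset H → ℝ) :
    ∑ R ∈ T.powersetCard b, ∑ h ∈ T \ R, φ (insert h R) =
      (b + 1) * ∑ R ∈ T.powersetCard (b + 1), φ R := by
  have h1 : (b + 1) * ∑ R ∈ T.powersetCard (b + 1), φ R =
      ∑ R ∈ T.powersetCard (b + 1), ∑ _h ∈ R, φ R := by
    rw [mul_sum]
    refine sum_congr rfl fun R hR => ?_
    rw [sum_const, (mem_powersetCard.1 hR).2, nsmul_eq_mul]
    push_cast
    rfl
  rw [h1, sum_sigma', sum_sigma']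
  refine sum_bij' (fun x _ => ⟨insert x.2 x.1, x.2⟩) (fun x _ => ⟨x.1.erase x.2, x.2⟩)
    ?_ ?_ ?_ ?_ ?_
  · rintro ⟨R, h⟩ hx
    simp only [mem_sigma, mem_powersetCard, mem_sdiff] at hx ⊢
    refine ⟨⟨insert_subset hx.2.1 hx.1.1, ?_⟩, mem_insert_self _ _⟩
    rw [card_insert_of_notMem hx.2.2, hx.1.2]
  · rintro ⟨R, h⟩ hx
    simp only [mem_sigma, mem_powersetCard, mem_sdiff] at hx ⊢
    refine ⟨⟨(erase_subset _ _).trans hx.1.1, ?_⟩, hx.1.1 hx.2, notMem_erase _ _⟩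
    rw [card_erase_of_mem hx.2, hx.1.2, Nat.add_sub_cancel]
  · rintro ⟨R, h⟩ hx
    simp only [mem_sigma, mem_sdiff] at hx
    simp [erase_insert hx.2.2]
  · rintro ⟨R, h⟩ hx
    simp only [mem_sigma] at hx
    simp [insert_erase hx.2]
  · rintro ⟨R, h⟩ _
    rfl

theorem sum_powersetCard_sum_offDiag (T : Finset H) (b : ℕ) (φ : H × H → Finset H → ℝ) :
    ∑ R ∈ T.powersetCard b, ∑ e ∈ (T \ R).offDiag, φ e R =
      ∑ e ∈ T.offDiag, ∑ R ∈ (T \ {e.1, e.2}).powersetCard b, φ e R := by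
  refine sum_comm' fun R e => ?_
  simp only [mem_powersetCard, mem_offDiag, mem_sdiff, subset_sdiff, disjoint_insert_right,
    disjoint_singleton_right]
  tauto

theorem card_sdiff_pair {T : Finset H} {e : H × H} (he : e ∈ T.offDiag) :
    #(T \ {e.1, e.2}) + 2 = #T := by
  obtain ⟨h1, h2, h3⟩ := mem_offDiag.1 he
  have hsub : ({e.1, e.2} : Finset H) ⊆ T := insert_subset h1 (singleton_subset_iff.2 h2)
  rw [card_sdiff_of_subset hsub, card_pair h3]
  have := card_le_card hsub
  rw [card_pair h3] at this
  omega

theorem choose_mul_meanLog (lam q : ℝ) (A : Finset H → ℕ) {T : Finset H} {b : ℕ}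
    (hb : b ≤ #T) :
    (#T).choose b * meanLog lam q A T b =
      ∑ R ∈ T.powersetCard b, Real.log (partitionFn lam q A R) :=
  mul_div_cancel₀ _ (Nat.cast_ne_zero.2 (Nat.choose_pos hb).ne')

theorem sum_sum_log_insert_sub (lam q : ℝ) (A : Finset H → ℕ) {T : Finset H} {b : ℕ}
    (hb : b < #T) :
    ∑ R ∈ T.powersetCard b, ∑ h ∈ T \ R, (Real.log (partitionFn lam q A (insert h R)) -
        Real.log (partitionFn lam q A R)) =
      (#T).choose b * (#T - b) * (meanLog lam q A T (b + 1) - meanLog lam q A T b) := by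
  have hchoose : ((#T).choose (b + 1) * (b + 1) : ℝ) = (#T).choose b * (#T - b) := by
    have := congrArg (Nat.cast (R := ℝ)) (Nat.choose_succ_right_eq #T b)
    push_cast [Nat.cast_sub hb.le] at this
    exact this
  simp only [sum_sub_distrib]
  rw [sum_powersetCard_sum_insert T b fun R => Real.log (partitionFn lam q A R),
    ← choose_mul_meanLog lam q A hb, mul_sub, ← hchoose]
  have : ∑ R ∈ T.powersetCard b, ∑ h ∈ T \ R, Real.log (partitionFn lam q A R) =
      (#T - b) * ∑ R ∈ T.powersetCard b, Real.log (partitionFn lam q A R) := by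
    rw [mul_sum]
    refine sum_congr rfl fun R hR => ?_
    obtain ⟨h1, h2⟩ := mem_powersetCard.1 hR
    rw [sum_const, card_sdiff_of_subset h1, h2, nsmul_eq_mul, Nat.cast_sub hb.le]
  rw [this, ← choose_mul_meanLog lam q A hb.le, hchoose]
  linear_combination meanLog lam q A T (b + 1) * hchoose

theorem HasUnitDrops.meanLog_succ_le {A : Finset H → ℕ} (hA : HasUnitDrops A)
    {lam q : ℝ} (hlam : 1 < lam) (hq0 : 0 ≤ q) (hq1 : q ≤ 1) {T : Finset H} {b : ℕ}
    (hb : b < #T) : meanLog lam q A T (b + 1) ≤ meanLog lam q A T b := by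
  have hpos : (0 : ℝ) < (#T).choose b * (#T - b) :=
    mul_pos (Nat.cast_pos.2 (Nat.choose_pos hb.le)) (sub_pos.2 (Nat.cast_lt.2 hb))
  have h1 := sum_sum_log_insert_sub lam q A hb
  have h2 : ∑ R ∈ T.powersetCard b, ∑ h ∈ T \ R,
      (Real.log (partitionFn lam q A (insert h R)) - Real.log (partitionFn lam q A R)) ≤ 0 :=
    sum_nonpos fun R _ => sum_nonpos fun h hh => sub_nonpos.2 <|
      hA.log_partitionFn_insert_le hlam hq0 hq1 (mem_sdiff.1 hh).2
  rw [h1] at h2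
  exact sub_nonpos.1 (nonpos_of_mul_nonpos_right h2 hpos)

theorem HasUnitDrops.le_meanLog_succ {A : Finset H → ℕ} (hA : HasUnitDrops A)
    {lam q : ℝ} (hlam : 1 < lam) (hq0 : 0 ≤ q) (hq1 : q ≤ 1) {T : Finset H} {b : ℕ}
    (hb : b < #T) :
    meanLog lam q A T b - Real.log lam ≤ meanLog lam q A T (b + 1) := by
  have hpos : (0 : ℝ) < (#T).choose b * (#T - b) :=
    mul_pos (Nat.cast_pos.2 (Nat.choose_pos hb.le)) (sub_pos.2 (Nat.cast_lt.2 hb))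
  have h1 := sum_sum_log_insert_sub lam q A hb
  have h2 : ∑ R ∈ T.powersetCard b, ∑ _h ∈ T \ R, -Real.log lam ≤
      ∑ R ∈ T.powersetCard b, ∑ h ∈ T \ R,
        (Real.log (partitionFn lam q A (insert h R)) - Real.log (partitionFn lam q A R)) :=
    sum_le_sum fun R _ => sum_le_sum fun h hh => by
      linarith [hA.le_log_partitionFn_insert hlam hq0 hq1 (mem_sdiff.1 hh).2]
  have h3 : ∑ R ∈ T.powersetCard b, ∑ _h ∈ T \ R, -Real.log lam =
      (#T).choose b * (#T - b) * -Real.log lam := by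
    rw [← card_powersetCard, mul_assoc, ← nsmul_eq_mul, ← sum_const]
    refine sum_congr rfl fun R hR => ?_
    obtain ⟨h1, h2⟩ := mem_powersetCard.1 hR
    rw [sum_const, card_sdiff_of_subset h1, h2, nsmul_eq_mul, Nat.cast_sub hb.le]
  rw [h1, h3] at h2
  linarith [le_of_mul_le_mul_left h2 hpos]

theorem sum_offDiag_meanLog_le {A : Finset H → ℕ} (hA : HasUnitDrops A)
    {lam q : ℝ} (hlam : 1 < lam) (hq0 : 0 ≤ q) (hq1 : q ≤ 1) {T : Finset H} {b : ℕ}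
    (hb : b + 2 ≤ #T) (B : H → H → Finset H → ℕ) (bad : H → H → Prop) [DecidableRel bad]
    (hBA : ∀ h h' S, B h h' S ≤ A S)
    (hB : ∀ h ∈ T, ∀ h' ∈ T, ¬ bad h h' →
      ∀ S, A (insert h S) < A S → A (insert h' S) < A S → B h h' S < A S) :
    ∑ e ∈ T.offDiag, meanLog lam q (B e.1 e.2) (T \ {e.1, e.2}) b ≤
      #T * (#T - 1) * (2 * meanLog lam q A T (b + 1) - meanLog lam q A T b
        - Real.log (1 - (1 - 1 / lam) * q ^ 2) + 2 * Real.log lam / (#T - b - 1))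
      + Real.log lam * #{e ∈ T.offDiag | bad e.1 e.2} := by
  obtain ⟨s, hs⟩ : ∃ s, #T = s + 2 := ⟨#T - 2, by omega⟩
  have hbs : b ≤ s := by omega
  set L := Real.log lam with hL
  set ℓ := Real.log (1 - (1 - 1 / lam) * q ^ 2) with hℓ
  set v := meanLog lam q A T b with hv
  set v' := meanLog lam q A T (b + 1) with hv'
  have hL0 : 0 < L := Real.log_pos hlam
  have hℓL : -L ≤ ℓ := by
    rw [hL, hℓ, ← Real.log_inv]
    refine Real.log_le_log (by positivity) ?_
    have h2 : 1 / lam < 1 := (div_lt_one (by positivity)).2 hlam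
    have h3 := mul_le_mul_of_nonneg_left (pow_le_one₀ hq0 hq1 (n := 2)) (sub_nonneg.2 h2.le)
    rw [← one_div]
    linarith
  have hvv : v' ≤ v := hA.meanLog_succ_le hlam hq0 hq1 (by omega)
  have hcount : ((s.choose b : ℕ) : ℝ) * (#T * (#T - 1)) =
      (#T).choose b * ((#T - b) * (#T - b - 1)) := by
    have h1 := congrArg (Nat.cast (R := ℝ)) (Nat.choose_mul_succ_eq s b)
    have h2 := congrArg (Nat.cast (R := ℝ)) (Nat.choose_mul_succ_eq (s + 1) b)
    push_cast [Nat.cast_sub (show b ≤ s + 1 by omega),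
      Nat.cast_sub (show b ≤ s + 1 + 1 by omega)] at h1 h2
    rw [hs]
    push_cast
    linear_combination (s + 2 : ℝ) * h1 + (s + 1 - b : ℝ) * h2
  have hsb : (0 : ℝ) < s.choose b := Nat.cast_pos.2 (Nat.choose_pos hbs)
  have hTb : ((#T).choose b : ℝ) > 0 := Nat.cast_pos.2 (Nat.choose_pos (by omega))
  set m : ℝ := #T - b with hm
  have hm2 : 2 ≤ m := by
    rw [hm, le_sub_iff_add_le, add_comm]
    exact_mod_cast hb
  have hcard : ∀ R ∈ T.powersetCard b, (#(T \ R) : ℝ) = m := fun R hR => by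
    obtain ⟨h1, h2⟩ := mem_powersetCard.1 hR
    rw [card_sdiff_of_subset h1, h2, Nat.cast_sub (by omega)]
  have hR : ∀ R ∈ T.powersetCard b,
      ∑ e ∈ (T \ R).offDiag, Real.log (partitionFn lam q (B e.1 e.2) R) ≤
      m * (m - 1) * Real.log (partitionFn lam q A R)
      + 2 * m * ∑ h ∈ T \ R, (Real.log (partitionFn lam q A (insert h R)) -
          Real.log (partitionFn lam q A R))
      - m ^ 2 * ℓ + m * L
      + L * ∑ e ∈ (T \ R).offDiag, if bad e.1 e.2 then (1 : ℝ) else 0 := fun R hR => by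
    have := sum_offDiag_log_partitionFn_le hA hlam hq0 hq1 (R := R) (t := T \ R)
      (fun h hh => (mem_sdiff.1 hh).2) B bad hBA
      fun h hh h' hh' => hB h (mem_sdiff.1 hh).1 h' (mem_sdiff.1 hh').1
    rw [hcard R hR, ← sum_boole] at this
    exact this
  have hsum := sum_le_sum hR
  rw [sum_powersetCard_sum_offDiag T b fun e R => Real.log (partitionFn lam q (B e.1 e.2) R)]
    at hsum
  have hcomp : ∀ e ∈ T.offDiag, ∑ R ∈ (T \ {e.1, e.2}).powersetCard b,
      Real.log (partitionFn lam q (B e.1 e.2) R) =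
      s.choose b * meanLog lam q (B e.1 e.2) (T \ {e.1, e.2}) b := fun e he => by
    have h1 : #(T \ {e.1, e.2}) = s := by
      have := card_sdiff_pair he
      omega
    rw [← choose_mul_meanLog lam q _ (by omega), h1]
  have hbad : ∑ R ∈ T.powersetCard b, ∑ e ∈ (T \ R).offDiag,
      (if bad e.1 e.2 then (1 : ℝ) else 0) =
      s.choose b * #{e ∈ T.offDiag | bad e.1 e.2} := by
    rw [sum_powersetCard_sum_offDiag T b fun e _ => if bad e.1 e.2 then (1 : ℝ) else 0,
      ← sum_boole, mul_sum]
    refine sum_congr rfl fun e he => ?_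
    have h1 : #(T \ {e.1, e.2}) = s := by
      have := card_sdiff_pair he
      omega
    rw [sum_const, card_powersetCard, h1, nsmul_eq_mul]
  rw [sum_congr rfl hcomp, ← mul_sum] at hsum
  rw [sum_add_distrib, sum_add_distrib, sum_sub_distrib, sum_add_distrib, sum_const, sum_const,
    ← mul_sum, ← mul_sum, ← mul_sum, card_powersetCard, nsmul_eq_mul, nsmul_eq_mul] at hsum
  rw [sum_sum_log_insert_sub lam q A (by omega), ← choose_mul_meanLog lam q A (by omega), hbad]
    at hsum
  rw [← hm, ← hv, ← hv'] at hsum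
  refine le_of_mul_le_mul_left (hsum.trans ?_) hsb
  have hfin : m * (m - 1) * v + 2 * m * (m * (v' - v)) - m ^ 2 * ℓ + m * L ≤
      m * (m - 1) * (2 * v' - v - ℓ + 2 * L / (m - 1)) := by
    have h1 : m * (m - 1) * (2 * v' - v - ℓ + 2 * L / (m - 1)) =
        m * (m - 1) * (2 * v' - v - ℓ) + m * (2 * L) := by
      have : m - 1 ≠ 0 := by linarith
      field_simp
    rw [h1]
    nlinarith
  have hfin' := mul_le_mul_of_nonneg_left hfin hTb.le
  rw [mul_add, ← mul_assoc (s.choose b : ℝ) (#T * (#T - 1) : ℝ), hcount]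
  linarith

theorem exists_offDiag_sum_meanLog_le {A : Finset H → ℕ} (hA : HasUnitDrops A)
    {lam q : ℝ} (hlam : 1 < lam) (hq0 : 0 ≤ q) (hq1 : q ≤ 1) {T : Finset H} {b K M D : ℕ}
    (hK : 0 < K) (hM : 0 < M) (hb : b + K + M ≤ #T) (B : H → H → Finset H → ℕ)
    (bad : H → H → Prop) [DecidableRel bad] (hBA : ∀ h h' S, B h h' S ≤ A S)
    (hB : ∀ h ∈ T, ∀ h' ∈ T, ¬ bad h h' →
      ∀ S, A (insert h S) < A S → A (insert h' S) < A S → B h h' S < A S)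
    (hD : ∀ h ∈ T, #{h' ∈ T | bad h h'} ≤ D) :
    ∃ e ∈ T.offDiag,
      ∑ j ∈ range K, meanLog lam q (B e.1 e.2) (T \ {e.1, e.2}) (b + j) ≤
        ∑ j ∈ range K, meanLog lam q A T (b + 2 + j) + Real.log lam
        + K * (Real.log lam * (D + 2) / M - Real.log (1 - (1 - 1 / lam) * q ^ 2)) := by
  set L := Real.log lam with hL
  set ℓ := Real.log (1 - (1 - 1 / lam) * q ^ 2) with hℓ
  have hL0 : 0 < L := Real.log_pos hlam
  have hM0 : (0 : ℝ) < M := Nat.cast_pos.2 hM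
  have hT : (M : ℝ) ≤ #T - 1 := by
    rw [le_sub_iff_add_le]
    exact_mod_cast (by omega : M + 1 ≤ #T)
  have hT0 : (0 : ℝ) < #T * (#T - 1) := mul_pos (by linarith) (by linarith)
  have hoff : (#T.offDiag : ℝ) = #T * (#T - 1) := by
    rw [offDiag_card, Nat.cast_sub (Nat.le_mul_self _)]
    push_cast
    ring
  have hne : T.offDiag.Nonempty := by
    rw [← card_pos]
    exact_mod_cast hoff ▸ hT0
  have hbad : (#{e ∈ T.offDiag | bad e.1 e.2} : ℝ) ≤ #T * (#T - 1) * (D / M) := by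
    have h1 : #{e ∈ T.offDiag | bad e.1 e.2} ≤ #T * D := by
      calc #{e ∈ T.offDiag | bad e.1 e.2} ≤ #(T.sigma fun h => {h' ∈ T | bad h h'}) := by
            refine card_le_card_of_injOn (fun e => ⟨e.1, e.2⟩) (fun e he => ?_)
              fun e _ e' _ h => ?_
            · simp only [coe_filter, mem_offDiag, Set.mem_ofPred_eq] at he
              simp [he.1.1, he.1.2.1, he.2]
            · simp only [Sigma.mk.injEq, heq_eq_eq] at h
              exact Prod.ext h.1 h.2
        _ ≤ #T * D := by
            rw [card_sigma, ← smul_eq_mul]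
            exact sum_le_card_nsmul _ _ _ hD
    have h2 : (#{e ∈ T.offDiag | bad e.1 e.2} : ℝ) ≤ #T * D := by exact_mod_cast h1
    refine h2.trans ?_
    rw [mul_assoc]
    refine mul_le_mul_of_nonneg_left ?_ (Nat.cast_nonneg _)
    rw [mul_div_assoc', le_div_iff₀ hM0, mul_comm]
    exact mul_le_mul_of_nonneg_right hT (Nat.cast_nonneg _)
  set v := meanLog lam q A T with hv
  have hstep : ∀ j ∈ range K,
      ∑ e ∈ T.offDiag, meanLog lam q (B e.1 e.2) (T \ {e.1, e.2}) (b + j) ≤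
      #T * (#T - 1) * (2 * v (b + j + 1) - v (b + j) - ℓ + L * (D + 2) / M) := fun j hj => by
    have hj := mem_range.1 hj
    refine (sum_offDiag_meanLog_le hA hlam hq0 hq1 (b := b + j) (by omega) B bad hBA hB).trans ?_
    have h1 : (M : ℝ) ≤ #T - (b + j : ℕ) - 1 := by
      rw [le_sub_iff_add_le, le_sub_iff_add_le]
      exact_mod_cast (by omega : M + 1 + (b + j) ≤ #T)
    have h2 : 2 * L / (#T - (b + j : ℕ) - 1) ≤ 2 * L / M :=
      div_le_div_of_nonneg_left (by positivity) hM0 h1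
    have h3 := mul_le_mul_of_nonneg_left h2 hT0.le
    have h4 := mul_le_mul_of_nonneg_left hbad hL0.le
    have h5 : L * (D + 2) / M = 2 * L / M + L * (D / M) := by ring
    rw [h5]
    linarith
  have htele : ∑ j ∈ range K, (2 * v (b + j + 1) - v (b + j) - v (b + 2 + j)) ≤ L := by
    have h1 := sum_range_sub' (fun j => v (b + j + 1) - v (b + j)) K
    have h2 : v (b + 1) ≤ v b := hA.meanLog_succ_le hlam hq0 hq1 (by omega)
    have h3 : v (b + K) - L ≤ v (b + K + 1) := hA.le_meanLog_succ hlam hq0 hq1 (by omega)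
    calc _ = ∑ j ∈ range K, (v (b + j + 1) - v (b + j) -
          (v (b + (j + 1) + 1) - v (b + (j + 1)))) := by
          refine sum_congr rfl fun j _ => ?_
          rw [show b + 2 + j = b + (j + 1) + 1 by ring, ← add_assoc]
          ring
      _ ≤ L := by
          rw [h1, add_zero]
          linarith
  refine exists_le_of_sum_le hne (?_ : _ ≤ ∑ _e ∈ T.offDiag, _)
  rw [sum_comm, sum_const, nsmul_eq_mul, hoff]
  refine (sum_le_sum hstep).trans ?_
  rw [← mul_sum]
  refine mul_le_mul_of_nonneg_left ?_ hT0.le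
  simp only [sum_add_distrib, sum_sub_distrib, sum_const, card_range, nsmul_eq_mul] at htele ⊢
  linarith

theorem HasUnitDrops.le_meanLog_add {A : Finset H → ℕ} (hA : HasUnitDrops A)
    {lam q : ℝ} (hlam : 1 < lam) (hq0 : 0 ≤ q) (hq1 : q ≤ 1) {T : Finset H} {b : ℕ} (j : ℕ)
    (hj : b + j ≤ #T) :
    meanLog lam q A T b - j * Real.log lam ≤ meanLog lam q A T (b + j) := by
  induction j with
  | zero => simp
  | succ j ih =>
    have h1 := ih (by omega)
    have h2 := hA.le_meanLog_succ hlam hq0 hq1 (T := T) (b := b + j) (by omega)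
    rw [← add_assoc]
    push_cast
    linarith

theorem HasUnitDrops.meanLog_add_le {A : Finset H → ℕ} (hA : HasUnitDrops A)
    {lam q : ℝ} (hlam : 1 < lam) (hq0 : 0 ≤ q) (hq1 : q ≤ 1) {T : Finset H} {b : ℕ} (j : ℕ)
    (hj : b + j ≤ #T) : meanLog lam q A T (b + j) ≤ meanLog lam q A T b := by
  induction j with
  | zero => simp
  | succ j ih =>
    have h1 := ih (by omega)
    have h2 := hA.meanLog_succ_le hlam hq0 hq1 (T := T) (b := b + j) (by omega)
    rw [← add_assoc]
    linarith

theorem meanLog_zero (lam q : ℝ) (A : Finset H → ℕ) (T : Finset H) :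
    meanLog lam q A T 0 = A ∅ * Real.log lam := by
  simp [meanLog, partitionFn, bernoulliWeight]

theorem meanLog_card (lam q : ℝ) (A : Finset H → ℕ) (T : Finset H) :
    meanLog lam q A T #T = Real.log (partitionFn lam q A T) := by
  simp [meanLog]

end Interpolation

section IndependentSets

variable {V : Type*} [Fintype V]

open Classical in
/-- The largest size of an independent set of `G` that avoids the vertices of the half-edges
in `S`. -/
noncomputable def avoidingIndepNum (G : SimpleGraph V) (S : Finset (V × Fin 3)) : ℕ :=
  ({I : Finset V | IsIndep G I ∧ ∀ h ∈ S, h.1 ∉ I} : Finset (Finset V)).sup card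

theorem card_le_avoidingIndepNum {G : SimpleGraph V} {S : Finset (V × Fin 3)} {I : Finset V}
    (hI : IsIndep G I) (hS : ∀ h ∈ S, h.1 ∉ I) : #I ≤ avoidingIndepNum G S := by
  classical
  exact le_sup (f := card) (mem_filter.2 ⟨mem_univ _, hI, hS⟩)

theorem exists_card_eq_avoidingIndepNum (G : SimpleGraph V) (S : Finset (V × Fin 3)) :
    ∃ I : Finset V, IsIndep G I ∧ (∀ h ∈ S, h.1 ∉ I) ∧ #I = avoidingIndepNum G S := by
  classical
  obtain ⟨I, hI, hcard⟩ := exists_mem_eq_sup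
    ({I : Finset V | IsIndep G I ∧ ∀ h ∈ S, h.1 ∉ I} : Finset (Finset V))
    ⟨∅, mem_filter.2 ⟨mem_univ _, by simp [IsIndep], by simp⟩⟩ card
  obtain ⟨-, h1, h2⟩ := mem_filter.1 hI
  exact ⟨I, h1, h2, hcard.symm⟩

theorem hasUnitDrops_avoidingIndepNum [DecidableEq V] (G : SimpleGraph V) :
    HasUnitDrops (avoidingIndepNum G) where
  insert_le h S := by
    obtain ⟨I, h1, h2, h3⟩ := exists_card_eq_avoidingIndepNum G (insert h S)
    rw [← h3]
    exact card_le_avoidingIndepNum h1 fun x hx => h2 x (mem_insert_of_mem hx)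
  le_insert_succ h S := by
    obtain ⟨I, h1, h2, h3⟩ := exists_card_eq_avoidingIndepNum G S
    rw [← h3]
    have hle : #(I.erase h.1) ≤ avoidingIndepNum G (insert h S) := by
      refine card_le_avoidingIndepNum (h1.mono ?_) fun x hx hxI => ?_
      · exact coe_subset.2 (erase_subset _ _)
      · obtain ⟨h4, h5⟩ := mem_erase.1 hxI
        rcases mem_insert.1 hx with rfl | hx
        · exact h4 rfl
        · exact h2 x hx h5
    have := pred_card_le_card_erase (s := I) (a := h.1)
    omega

theorem avoidingIndepNum_anti {G G' : SimpleGraph V} (h : G ≤ G') (S : Finset (V × Fin 3)) :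
    avoidingIndepNum G' S ≤ avoidingIndepNum G S := by
  obtain ⟨I, h1, h2, h3⟩ := exists_card_eq_avoidingIndepNum G' S
  rw [← h3]
  exact card_le_avoidingIndepNum (fun x hx y hy hxy hadj => h1 hx hy hxy (h hadj)) h2

theorem avoidingIndepNum_sup_edge_lt [DecidableEq V] (G : SimpleGraph V) {h h' : V × Fin 3}
    (hne : h.1 ≠ h'.1) (S : Finset (V × Fin 3))
    (h1 : avoidingIndepNum G (insert h S) < avoidingIndepNum G S)
    (h2 : avoidingIndepNum G (insert h' S) < avoidingIndepNum G S) :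
    avoidingIndepNum (G ⊔ SimpleGraph.edge h.1 h'.1) S < avoidingIndepNum G S := by
  obtain ⟨I, hI, hS, hcard⟩ :=
    exists_card_eq_avoidingIndepNum (G ⊔ SimpleGraph.edge h.1 h'.1) S
  have hIG : IsIndep G I := fun x hx y hy hxy hadj => hI hx hy hxy (Or.inl hadj)
  rw [← hcard]
  by_cases hh : h.1 ∈ I
  · have hh' : h'.1 ∉ I := fun hh' => hI hh hh' hne <| by
      simp [SimpleGraph.edge_adj, hne]
    refine (card_le_avoidingIndepNum hIG fun x hx => ?_).trans_lt h2
    rcases mem_insert.1 hx with rfl | hx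
    exacts [hh', hS x hx]
  · refine (card_le_avoidingIndepNum hIG fun x hx => ?_).trans_lt h1
    rcases mem_insert.1 hx with rfl | hx
    exacts [hh, hS x hx]

theorem le_indepNum {V : Type*} [Finite V] {G : SimpleGraph V} {s : Set V} (hs : IsIndep G s) :
    s.ncard ≤ indepNum G :=
  le_csSup ⟨Nat.card V, by rintro _ ⟨s, -, rfl⟩; exact Set.ncard_le_card s⟩ ⟨s, hs, rfl⟩

theorem exists_ncard_eq_indepNum {V : Type*} [Finite V] (G : SimpleGraph V) :
    ∃ s : Set V, IsIndep G s ∧ s.ncard = indepNum G :=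
  Nat.sSup_mem (s := {n | ∃ s : Set V, IsIndep G s ∧ s.ncard = n})
    ⟨0, ∅, Set.pairwise_empty _, Set.ncard_empty _⟩
    ⟨Nat.card V, by rintro _ ⟨s, -, rfl⟩; exact Set.ncard_le_card s⟩

theorem indepNum_le_avoidingIndepNum_empty (G : SimpleGraph V) :
    indepNum G ≤ avoidingIndepNum G ∅ := by
  classical
  obtain ⟨s, hs, hcard⟩ := exists_ncard_eq_indepNum G
  rw [← hcard, Set.ncard_eq_toFinset_card']
  exact card_le_avoidingIndepNum (by simpa using hs) (by simp)

theorem avoidingIndepNum_bot [DecidableEq V] (S : Finset (V × Fin 3)) :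
    avoidingIndepNum (⊥ : SimpleGraph V) S = #{v : V | ∀ i, (v, i) ∉ S} := by
  refine le_antisymm ?_ (card_le_avoidingIndepNum (fun x _ y _ _ h => h) fun h hh hhI => ?_)
  · obtain ⟨I, -, h2, h3⟩ := exists_card_eq_avoidingIndepNum (⊥ : SimpleGraph V) S
    rw [← h3]
    exact card_le_card fun v hv => mem_filter.2 ⟨mem_univ _, fun i hi => h2 _ hi hv⟩
  · exact (mem_filter.1 hhI).2 h.2 hh

/-- The finsets of half-edges, seen as families of finsets of `Fin 3`. -/
def finsetProdEquiv (V : Type*) [Fintype V] [DecidableEq V] :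
    Finset (V × Fin 3) ≃ (V → Finset (Fin 3)) where
  toFun S v := {i | (v, i) ∈ S}
  invFun p := {h | h.2 ∈ p h.1}
  left_inv S := by ext; simp
  right_inv p := by ext; simp

theorem partitionFn_avoidingIndepNum_bot [DecidableEq V] (lam q : ℝ) :
    partitionFn lam q (avoidingIndepNum (⊥ : SimpleGraph V)) univ =
      (1 + (lam - 1) * (1 - q) ^ 3) ^ Fintype.card V := by
  have hlocal : ∑ t : Finset (Fin 3),
      q ^ #t * (1 - q) ^ #tᶜ * (if t = ∅ then lam else 1) = 1 + (lam - 1) * (1 - q) ^ 3 := by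
    have huniv : (univ : Finset (Finset (Fin 3))) =
        {∅, {0}, {1}, {2}, {0, 1}, {0, 2}, {1, 2}, {0, 1, 2}} := by decide
    have h0 : ∑ t : Finset (Fin 3), q ^ #t * (1 - q) ^ #tᶜ = 1 := by
      have := sum_bernoulliWeight q (univ : Finset (Fin 3))
      rw [powerset_univ] at this
      exact this
    have h1 : ∀ t : Finset (Fin 3), q ^ #t * (1 - q) ^ #tᶜ * (if t = ∅ then lam else 1) =
        q ^ #t * (1 - q) ^ #tᶜ + if t = ∅ then (lam - 1) * (1 - q) ^ 3 else 0 := fun t => by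
      split_ifs with ht
      · subst ht
        simp
        ring
      · ring
    rw [sum_congr rfl fun t _ => h1 t, sum_add_distrib, h0]
    simp
  rw [← hlocal, ← card_univ, ← prod_const, prod_univ_sum, partitionFn, powerset_univ,
    Fintype.piFinset_univ]
  refine Fintype.sum_equiv (finsetProdEquiv V) _ _ fun S => ?_
  have hcard : ∀ S : Finset (V × Fin 3), #S = ∑ v, #(finsetProdEquiv V S v) := fun S => by
    rw [card_eq_sum_card_fiberwise (f := Prod.fst) (t := univ) fun _ _ => mem_univ _]
    refine sum_congr rfl fun v _ => ?_
    refine card_nbij' Prod.snd (fun i => (v, i)) ?_ ?_ ?_ ?_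
    · rintro ⟨w, i⟩ h
      simp only [coe_filter, Set.mem_ofPred_eq] at h
      obtain ⟨h, rfl⟩ := h
      simpa [finsetProdEquiv] using h
    · intro i hi
      simpa [finsetProdEquiv] using hi
    · rintro ⟨w, i⟩ h
      simp only [coe_filter, Set.mem_ofPred_eq] at h
      simp [h.2]
    · intro i _
      rfl
  have hcompl : ∀ v, finsetProdEquiv V Sᶜ v = (finsetProdEquiv V S v)ᶜ := fun v => by
    ext; simp [finsetProdEquiv]
  rw [prod_mul_distrib, prod_mul_distrib, prod_pow_eq_pow_sum, prod_pow_eq_pow_sum, ← hcard,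
    bernoulliWeight, ← compl_eq_univ_sdiff, hcard Sᶜ]
  simp only [hcompl]
  congr 1
  rw [prod_ite, prod_const_one, mul_one, prod_const, avoidingIndepNum_bot]
  congr 2
  ext v
  simp [finsetProdEquiv, filter_eq_empty_iff]

end IndependentSets

section Construction

variable {V : Type*} [Fintype V] [DecidableEq V]

open Classical in
/-- The vertices reachable from `u` by a walk of length at most `r`. -/
noncomputable def walkBall (G : SimpleGraph V) : ℕ → V → Finset V
  | 0, u => {u}
  | r + 1, u => insert u (({w | G.Adj u w} : Finset V).biUnion (walkBall G r))

theorem mem_walkBall {G : SimpleGraph V} {r : ℕ} {u v : V} (p : G.Walk u v)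
    (hp : p.length ≤ r) : v ∈ walkBall G r u := by
  induction r generalizing u with
  | zero =>
    obtain rfl := p.eq_of_length_eq_zero (Nat.le_zero.1 hp)
    simp [walkBall]
  | succ r ih =>
    cases p with
    | nil => simp [walkBall]
    | cons h p =>
      rw [SimpleGraph.Walk.length_cons] at hp
      exact mem_insert_of_mem (mem_biUnion.2 ⟨_, by simpa using h, ih p (by omega)⟩)

theorem card_walkBall_le {G : SimpleGraph V} (hG : ∀ v, (G.neighborSet v).ncard ≤ 3) (r : ℕ)
    (u : V) : #(walkBall G r u) ≤ 4 ^ r := by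
  classical
  induction r generalizing u with
  | zero => simp [walkBall]
  | succ r ih =>
    have h1 : #({w | G.Adj u w} : Finset V) ≤ 3 := by
      rw [← Set.ncard_coe_finset]
      simpa [SimpleGraph.neighborSet] using hG u
    have h2 := card_biUnion_le_card_mul ({w | G.Adj u w} : Finset V) (walkBall G r) (4 ^ r)
      fun w _ => ih w
    have h3 := Nat.mul_le_mul_right (4 ^ r) h1
    have h4 := card_insert_le u (({w | G.Adj u w} : Finset V).biUnion (walkBall G r))
    have h5 := Nat.one_le_pow r 4 (by norm_num)
    rw [walkBall, pow_succ]
    convert h4.trans (by omega : _ ≤ 4 ^ r * 4) using 1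

theorem exists_isPath_of_mem_edges_isCycle {V : Type*} {G : SimpleGraph V} {a u v : V}
    {c : G.Walk a a} (hc : c.IsCycle) (he : s(u, v) ∈ c.edges) :
    ∃ p : G.Walk v u, p.IsPath ∧ p.length + 1 = c.length ∧ s(u, v) ∉ p.edges ∧
      p.edges ⊆ c.edges := by
  classical
  have key : ∀ d : G.Walk u u, d.IsCycle → v = d.snd →
      ∃ p : G.Walk v u, p.IsPath ∧ p.length + 1 = d.length ∧ s(u, v) ∉ p.edges ∧
        p.edges ⊆ d.edges := by
    intro d hd hv
    cases d with
    | nil => exact absurd hd SimpleGraph.Walk.not_isCycle_nil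
    | cons h p =>
      rw [SimpleGraph.Walk.cons_isCycle_iff] at hd
      rw [SimpleGraph.Walk.snd_cons] at hv
      subst hv
      exact ⟨p, hd.1, rfl, hd.2, List.subset_cons_self _ _⟩
  have hu := c.fst_mem_support_of_mem_edges he
  have hrot := hc.rotate hu
  have hmem : s(u, v) ∈ (c.rotate u hu).edges := (c.rotate_edges u hu).mem_iff.2 he
  have hlen : (c.rotate u hu).length = c.length := by simp
  have hsub : (c.rotate u hu).edges ⊆ c.edges := fun e h => (c.rotate_edges u hu).mem_iff.1 h
  rw [← hlen]
  suffices h : ∃ p : G.Walk v u, p.IsPath ∧ p.length + 1 = (c.rotate u hu).length ∧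
      s(u, v) ∉ p.edges ∧ p.edges ⊆ (c.rotate u hu).edges from
    let ⟨p, h1, h2, h3, h4⟩ := h; ⟨p, h1, h2, h3, fun e he => hsub (h4 he)⟩
  clear hsub
  generalize c.rotate u hu = d at hrot hmem
  by_cases hv : v = d.snd
  · exact key d hrot hv
  · obtain ⟨p, h1, h2, h3, h4⟩ := key d.reverse hrot.reverse <| by
      cases d with
      | nil => exact absurd hrot SimpleGraph.Walk.not_isCycle_nil
      | cons h p =>
        rw [SimpleGraph.Walk.cons_isCycle_iff] at hrot
        have hv' : v ≠ (SimpleGraph.Walk.cons h p).snd := hv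
        rw [SimpleGraph.Walk.snd_cons] at hv'
        rw [SimpleGraph.Walk.edges_cons, List.mem_cons] at hmem
        have hp : s(u, v) ∈ p.edges := hmem.resolve_left fun h' => hv' <| by
          rcases Sym2.eq_iff.1 h' with h' | h'
          exacts [h'.2, h'.2.trans h'.1]
        have hpn : ¬ p.Nil := fun hn => by
          rw [SimpleGraph.Walk.edges_eq_nil.2 hn] at hp
          simp at hp
        rw [hrot.1.eq_penultimate_of_mem_edges hp, SimpleGraph.Walk.snd_reverse,
          SimpleGraph.Walk.penultimate_cons_of_not_nil _ _ hpn]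
    exact ⟨p, h1, by simpa using h2, h3, fun e he => by simpa using h4 he⟩

theorem le_egirth_sup_edge {V : Type*} {G : SimpleGraph V} {g : ℕ} (hG : (g : ℕ∞) ≤ G.egirth) {u v : V}
    (huv : ∀ p : G.Walk u v, g ≤ p.length) : (g : ℕ∞) ≤ (G ⊔ SimpleGraph.edge u v).egirth := by
  rw [SimpleGraph.le_egirth]
  intro a c hc
  have htransfer : ∀ {x y : V} (p : (G ⊔ SimpleGraph.edge u v).Walk x y),
      s(u, v) ∉ p.edges → ∀ e ∈ p.edges, e ∈ G.edgeSet := fun p hp e he => by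
    have h1 := p.edges_subset_edgeSet he
    rw [SimpleGraph.edgeSet_sup] at h1
    rcases h1 with h1 | h1
    · exact h1
    · have h2 : e = s(u, v) := by
        induction e with | _ x y => ?_
        rw [SimpleGraph.mem_edgeSet, SimpleGraph.edge_adj] at h1
        rcases h1.1 with ⟨rfl, rfl⟩ | ⟨rfl, rfl⟩
        · rfl
        · exact Sym2.eq_swap
      exact absurd (h2 ▸ he) hp
  by_cases he : s(u, v) ∈ c.edges
  · obtain ⟨p, -, hlen, hp, -⟩ := exists_isPath_of_mem_edges_isCycle hc he
    have := huv (p.transfer G (htransfer p hp)).reverse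
    rw [SimpleGraph.Walk.length_reverse, SimpleGraph.Walk.length_transfer] at this
    exact_mod_cast (by omega : g ≤ c.length)
  · have := (SimpleGraph.le_egirth.1 hG) a _ (hc.transfer (htransfer c he))
    simpa using this

end Construction

section Iteration

variable {V : Type*} [Fintype V] [DecidableEq V]

/-- A graph of girth at least `g` with a set `T` of free half-edges such that joining free
half-edges never creates a vertex of degree larger than three. -/
structure IsPartialCubic (g : ℕ) (G : SimpleGraph V) (T : Finset (V × Fin 3)) : Prop where
  ncard_add_card_le : ∀ v, (G.neighborSet v).ncard + #{h ∈ T | h.1 = v} ≤ 3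
  le_egirth : (g : ℕ∞) ≤ G.egirth

namespace IsPartialCubic

variable {g : ℕ} {G : SimpleGraph V} {T : Finset (V × Fin 3)}

omit [Fintype V] in
theorem ncard_neighborSet_le (hG : IsPartialCubic g G T) (v : V) :
    (G.neighborSet v).ncard ≤ 3 :=
  (Nat.le_add_right _ _).trans (hG.ncard_add_card_le v)

theorem bot_univ (g : ℕ) : IsPartialCubic g (⊥ : SimpleGraph V) univ where
  ncard_add_card_le v := by
    have h1 : ((⊥ : SimpleGraph V).neighborSet v) = ∅ := by ext; simp
    have h2 : ({h ∈ univ | h.1 = v} : Finset (V × Fin 3)) = {v} ×ˢ univ := by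
      ext ⟨w, i⟩; simp [eq_comm]
    rw [h1, h2]
    simp
  le_egirth := by
    rw [SimpleGraph.egirth_bot]
    exact le_top

omit [Fintype V] in
theorem sdiff (hG : IsPartialCubic g G T) (S : Finset (V × Fin 3)) :
    IsPartialCubic g G (T \ S) where
  ncard_add_card_le v := (Nat.add_le_add_left
    (card_le_card (filter_subset_filter _ sdiff_subset)) _).trans (hG.ncard_add_card_le v)
  le_egirth := hG.le_egirth

theorem sup_edge (hG : IsPartialCubic g G T) {h h' : V × Fin 3} (hh : h ∈ T) (hh' : h' ∈ T)
    (hball : h'.1 ∉ walkBall G g h.1) :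
    IsPartialCubic g (G ⊔ SimpleGraph.edge h.1 h'.1) (T \ {h, h'}) where
  ncard_add_card_le v := by
    have hv : h.1 ≠ h'.1 := fun heq => hball (mem_walkBall (SimpleGraph.Walk.nil.copy rfl heq)
      (by simp))
    have hold := hG.ncard_add_card_le v
    have key : ∀ x y : V × Fin 3, x ∈ T → x.1 = v → x ∈ ({h, h'} : Finset (V × Fin 3)) →
        (∀ w, (SimpleGraph.edge h.1 h'.1).Adj v w → w = y.1) →
        ((G ⊔ SimpleGraph.edge h.1 h'.1).neighborSet v).ncard +
          #{z ∈ T \ {h, h'} | z.1 = v} ≤ 3 := fun x y hx hxv hmem hw => by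
      have h1 : (G ⊔ SimpleGraph.edge h.1 h'.1).neighborSet v ⊆
          insert y.1 (G.neighborSet v) := fun w hadj => by
        rcases hadj with hadj | hadj
        exacts [Or.inr hadj, Or.inl (hw w hadj)]
      have h2 := (Set.ncard_le_ncard h1 (Set.toFinite _)).trans (Set.ncard_insert_le _ _)
      have h3 : #{z ∈ T \ {h, h'} | z.1 = v} < #{z ∈ T | z.1 = v} := by
        refine card_lt_card ⟨filter_subset_filter _ sdiff_subset, fun hsub => ?_⟩
        have := hsub (mem_filter.2 ⟨hx, hxv⟩)
        exact (mem_sdiff.1 (mem_filter.1 this).1).2 hmem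
      omega
    by_cases h1 : h.1 = v
    · refine key h h' hh h1 (by simp) fun w hw => ?_
      rw [SimpleGraph.edge_adj] at hw
      rcases hw.1 with h2 | h2
      exacts [h2.2, absurd (h1.trans h2.1) hv]
    by_cases h2 : h'.1 = v
    · refine key h' h hh' h2 (by simp) fun w hw => ?_
      rw [SimpleGraph.edge_adj] at hw
      rcases hw.1 with h3 | h3
      exacts [absurd h3.1.symm h1, h3.2]
    have h3 : (G ⊔ SimpleGraph.edge h.1 h'.1).neighborSet v ⊆ G.neighborSet v := by
      rintro w (hadj | hadj)
      · exact hadj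
      · rw [SimpleGraph.edge_adj] at hadj
        rcases hadj.1 with h4 | h4
        exacts [absurd h4.1.symm h1, absurd h4.1.symm h2]
    exact (Nat.add_le_add (Set.ncard_le_ncard h3 (Set.toFinite _))
      (card_le_card (filter_subset_filter _ sdiff_subset))).trans hold
  le_egirth := le_egirth_sup_edge hG.le_egirth fun p => by
    by_contra hp
    exact hball (mem_walkBall p (by omega))

theorem card_filter_mem_walkBall_le (hG : IsPartialCubic g G T) (h : V × Fin 3) :
    #{h' ∈ T | h'.1 ∈ walkBall G g h.1} ≤ 3 * 4 ^ g := by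
  have h1 : ({h' ∈ T | h'.1 ∈ walkBall G g h.1} : Finset (V × Fin 3)) ⊆
      walkBall G g h.1 ×ˢ univ := fun x hx => by simpa using (mem_filter.1 hx).2
  have h2 := card_le_card h1
  have h3 := card_walkBall_le hG.ncard_neighborSet_le g h.1
  rw [card_product, card_univ, Fintype.card_fin] at h2
  omega

end IsPartialCubic

theorem exists_isPartialCubic_sum_meanLog_le {lam q : ℝ} (hlam : 1 < lam) (hq0 : 0 ≤ q)
    (hq1 : q ≤ 1) (g : ℕ) {K M : ℕ} (hK : 0 < K) (hM : 0 < M) (N b : ℕ)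
    (hb : b + 2 * N + K + M ≤ 3 * Fintype.card V) :
    ∃ (G : SimpleGraph V) (T : Finset (V × Fin 3)),
      #T + 2 * N = 3 * Fintype.card V ∧ IsPartialCubic g G T ∧
      ∑ j ∈ range K, meanLog lam q (avoidingIndepNum G) T (b + j) ≤
        ∑ j ∈ range K, meanLog lam q (avoidingIndepNum (⊥ : SimpleGraph V)) univ
          (b + 2 * N + j) +
        N * (Real.log lam + K * (Real.log lam * (3 * 4 ^ g + 2) / M -
          Real.log (1 - (1 - 1 / lam) * q ^ 2))) := by
  classical
  induction N generalizing b with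
  | zero => exact ⟨⊥, univ, by simp [mul_comm], .bot_univ g, by simp⟩
  | succ N ih =>
    obtain ⟨G, T, hcard, hG, hsum⟩ := ih (b + 2) (by omega)
    obtain ⟨e, he, hle⟩ := exists_offDiag_sum_meanLog_le (hasUnitDrops_avoidingIndepNum G)
      hlam hq0 hq1 (T := T) (b := b) (D := 3 * 4 ^ g) hK hM (by omega)
      (fun h h' => avoidingIndepNum
        (if h'.1 ∈ walkBall G g h.1 then G else G ⊔ SimpleGraph.edge h.1 h'.1))
      (fun h h' => h'.1 ∈ walkBall G g h.1)
      (fun h h' S => by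
        split_ifs
        · rfl
        · exact avoidingIndepNum_anti le_sup_left S)
      (fun h _ h' _ hbad S h1 h2 => by
        simp only [if_neg hbad]
        exact avoidingIndepNum_sup_edge_lt G
          (fun heq => hbad (mem_walkBall (SimpleGraph.Walk.nil.copy rfl heq) (by simp))) S h1 h2)
      (fun h _ => hG.card_filter_mem_walkBall_le h)
    refine ⟨_, T \ {e.1, e.2}, ?_, ?_, hle.trans ?_⟩
    · have := card_sdiff_pair he
      omega
    · obtain ⟨h1, h2, -⟩ := mem_offDiag.1 he
      split_ifs with hbad
      exacts [hG.sdiff _, hG.sup_edge h1 h2 hbad]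
    · have hidx : ∀ j, b + 2 + 2 * N + j = b + 2 * (N + 1) + j := fun j => by ring
      simp only [hidx] at hsum
      push_cast
      linarith

end Iteration

section SmallIndependenceNumber

theorem two_mul_log_sub_three_mul_log_le :
    2 * Real.log (1 + (3 - 1) * (1 - 1 / 2) ^ 3) -
      3 * Real.log (1 - (1 - 1 / 3) * (1 / 2) ^ 2) ≤ 0.905 * Real.log 3 := by
  have h1 : (1 + (3 - 1) * (1 - 1 / 2) ^ 3 : ℝ) = 5 / 4 := by norm_num
  have h2 : (1 - (1 - 1 / 3) * (1 / 2) ^ 2 : ℝ) = 5 / 6 := by norm_num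
  have h3 : 2 * Real.log (5 / 4) - 3 * Real.log (5 / 6) = Real.log (27 / 10) := by
    have h4 := Real.log_pow (5 / 4) 2
    have h5 := Real.log_pow (5 / 6) 3
    push_cast at h4 h5
    rw [← h4, ← h5, ← Real.log_div (by norm_num) (by norm_num)]
    norm_num
  have h4 : 200 * Real.log (27 / 10) ≤ 181 * Real.log 3 := by
    have h4 := Real.log_pow (27 / 10) 200
    have h5 := Real.log_pow 3 181
    push_cast at h4 h5
    rw [← h4, ← h5]
    exact Real.log_le_log (by positivity) (by norm_num)
  rw [h1, h2, h3]
  linarith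

theorem exists_ncard_neighborSet_le_three_indepNum_le (g : ℕ) :
    ∃ (n : ℕ) (G : SimpleGraph (Fin n)), 0 < n ∧ (∀ v, (G.neighborSet v).ncard ≤ 3) ∧
      (g : ℕ∞) ≤ G.egirth ∧ (indepNum G : ℝ) ≤ 0.454 * n := by
  set k := 2000 * (3 * 4 ^ g + 3) with hk
  have hk0 : 0 < k := by positivity
  clear_value k
  obtain ⟨G, T, hT, hG, hsum⟩ := exists_isPartialCubic_sum_meanLog_le (V := Fin (4000 * k))
    (lam := 3) (q := 1 / 2) (by norm_num) (by norm_num) (by norm_num) g hk0 hk0 (5999 * k) 0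
    (by rw [Fintype.card_fin]; omega)
  refine ⟨4000 * k, G, by omega, hG.ncard_neighborSet_le, hG.le_egirth, ?_⟩
  rw [Fintype.card_fin] at hT
  set L := Real.log 3 with hL
  have hL0 : 0 < L := Real.log_pos (by norm_num)
  set ψ := Real.log (1 + (3 - 1) * (1 - 1 / 2) ^ 3) with hψ
  set ℓ := Real.log (1 - (1 - 1 / 3) * (1 / 2) ^ 2) with hℓ
  have hℓ0 : ℓ ≤ 0 := Real.log_nonpos (by norm_num) (by norm_num)
  have hnum : 2 * ψ - 3 * ℓ ≤ 0.905 * L := two_mul_log_sub_three_mul_log_le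
  have hlow : k * (indepNum G * L - k * L) ≤
      ∑ j ∈ range k, meanLog 3 (1 / 2) (avoidingIndepNum G) T (0 + j) := by
    rw [← nsmul_eq_mul]
    refine (card_nsmul_le_sum _ _ _ fun j hj => ?_).trans' (by rw [card_range])
    have hj := mem_range.1 hj
    have h1 := (hasUnitDrops_avoidingIndepNum G).le_meanLog_add (lam := 3) (q := 1 / 2)
      (by norm_num) (by norm_num) (by norm_num) (T := T) (b := 0) j (by omega)
    rw [meanLog_zero] at h1
    have h2 : (indepNum G : ℝ) ≤ avoidingIndepNum G ∅ :=
      mod_cast indepNum_le_avoidingIndepNum_empty G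
    have h3 : (j : ℝ) ≤ k := mod_cast hj.le
    have h4 := mul_le_mul_of_nonneg_right h2 hL0.le
    have h5 := mul_le_mul_of_nonneg_right h3 hL0.le
    linarith
  have hupp : ∑ j ∈ range k, meanLog 3 (1 / 2)
      (avoidingIndepNum (⊥ : SimpleGraph (Fin (4000 * k)))) univ (0 + 2 * (5999 * k) + j) ≤
      k * (4000 * k * ψ + 2 * k * L) := by
    rw [← nsmul_eq_mul]
    refine (sum_le_card_nsmul _ _ _ fun j hj => ?_).trans (by rw [card_range])
    have hj := mem_range.1 hj
    have hA := hasUnitDrops_avoidingIndepNum (⊥ : SimpleGraph (Fin (4000 * k)))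
    have hcard : #(univ : Finset (Fin (4000 * k) × Fin 3)) = 0 + 2 * (5999 * k) + 2 * k := by
      simp
      ring
    have h1 := hA.meanLog_add_le (lam := 3) (q := 1 / 2)
      (by norm_num) (by norm_num) (by norm_num) (T := univ) (b := 0 + 2 * (5999 * k)) j
      (by omega)
    have h2 := hA.le_meanLog_add (lam := 3) (q := 1 / 2)
      (by norm_num) (by norm_num) (by norm_num) (T := univ) (b := 0 + 2 * (5999 * k)) (2 * k)
      (by omega)
    rw [← hcard, meanLog_card, partitionFn_avoidingIndepNum_bot, Real.log_pow,
      Fintype.card_fin] at h2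
    push_cast at h2
    rw [← hψ, ← hL] at h2
    linarith
  have hkR : (0 : ℝ) < k := Nat.cast_pos.2 hk0
  have hkD : (k : ℝ) = 2000 * (3 * 4 ^ g + 3) := by rw [hk]; push_cast; ring
  have hmain : (k : ℝ) * (indepNum G * L - k * L) ≤
      k * (4000 * k * ψ + 2 * k * L + 5999 * (L + L * (3 * 4 ^ g + 2) - k * ℓ)) := by
    refine (hlow.trans (hsum.trans (add_le_add_left hupp _))).trans_eq ?_
    push_cast
    field_simp
    ring
  have h1 := le_of_mul_le_mul_left hmain hkR
  have h2 : (indepNum G : ℝ) * L ≤ 1816 * k * L := by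
    have h3 : (k : ℝ) * (2 * ψ - 3 * ℓ) ≤ k * (0.905 * L) :=
      mul_le_mul_of_nonneg_left hnum hkR.le
    have h4 : (k : ℝ) * ℓ ≤ 0 := mul_nonpos_of_nonneg_of_nonpos hkR.le hℓ0
    have h5 : (k : ℝ) * L = 2000 * (L + L * (3 * 4 ^ g + 2)) := by rw [hkD]; ring
    have h6 : 0 ≤ k * L := by positivity
    nlinarith
  have := le_of_mul_le_mul_right h2 hL0
  push_cast
  linarith

end SmallIndependenceNumber

section CubicCompletion

variable {ι Γ V : Type*} [Group Γ]

/-- The `τ i` are involutions, and nonempty reduced words of length at most `g` in them are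
nontrivial. -/
structure IsGenericInvolutions (g : ℕ) (τ : ι → Γ) : Prop where
  mul_self : ∀ i, τ i * τ i = 1
  prod_ne_one : ∀ l : List ι, l ≠ [] → l.IsChain (· ≠ ·) → l.length ≤ g → (l.map τ).prod ≠ 1

namespace IsGenericInvolutions

variable {g : ℕ} {τ : ι → Γ}

theorem ne_one (hτ : IsGenericInvolutions g τ) (hg : 2 ≤ g) (i : ι) : τ i ≠ 1 := by
  simpa using hτ.prod_ne_one [i] (by simp) (by simp) (by simp; omega)

theorem injective (hτ : IsGenericInvolutions g τ) (hg : 2 ≤ g) : Function.Injective τ := by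
  intro i j hij
  by_contra hne
  refine hτ.prod_ne_one [i, j] (by simp) (by simpa using hne) (by simpa using hg) ?_
  simp [hij, hτ.mul_self]

end IsGenericInvolutions

/-- Left multiplication by the letter `i` on reduced words of length at most `g`; words that
would become too long are fixed. -/
def mulLetter [DecidableEq ι] (g : ℕ) (i : ι) (l : List ι) : List ι :=
  if l.head? = some i then l.tail else if l.length < g then i :: l else l

theorem isChain_mulLetter [DecidableEq ι] {g : ℕ} {i : ι} {l : List ι}
    (hl : l.IsChain (· ≠ ·) ∧ l.length ≤ g) :
    (mulLetter g i l).IsChain (· ≠ ·) ∧ (mulLetter g i l).length ≤ g := by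
  unfold mulLetter
  split_ifs with h1 h2
  · exact ⟨hl.1.tail, by simp; omega⟩
  · refine ⟨List.isChain_cons.2 ⟨fun j hj hij => h1 ?_, hl.1⟩, by simpa using h2⟩
    rw [hij]
    exact hj
  · exact hl

theorem mulLetter_mulLetter [DecidableEq ι] {g : ℕ} {i : ι} {l : List ι}
    (hl : l.IsChain (· ≠ ·) ∧ l.length ≤ g) : mulLetter g i (mulLetter g i l) = l := by
  by_cases h1 : l.head? = some i
  · obtain ⟨t, rfl⟩ : ∃ t, l = i :: t := by
      cases l with
      | nil => simp at h1
      | cons j t => exact ⟨t, by simpa using h1⟩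
    have h2 : t.head? ≠ some i := fun h => (List.isChain_cons.1 hl.1).1 i h rfl
    have h3 : t.length < g := by simpa using hl.2
    simp [mulLetter, h2, h3]
  · by_cases h2 : l.length < g <;> simp [mulLetter, h1, h2]

theorem exists_isGenericInvolutions (ι : Type) [Finite ι] (g : ℕ) :
    ∃ (Γ : Type) (_ : Group Γ) (_ : Finite Γ) (τ : ι → Γ), IsGenericInvolutions g τ := by
  classical
  let X := {l : List ι // l.IsChain (· ≠ ·) ∧ l.length ≤ g}
  have : Finite X := (List.finite_length_le ι g).subset fun l hl => hl.2
  let f : ι → X → X := fun i l => ⟨mulLetter g i l, isChain_mulLetter l.2⟩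
  have hf : ∀ i, Function.Involutive (f i) := fun i l => Subtype.ext (mulLetter_mulLetter l.2)
  let τ : ι → Equiv.Perm X := fun i => (hf i).toPerm
  refine ⟨Equiv.Perm X, inferInstance, inferInstance, τ, fun i => ?_, fun l hne hl hlen h => ?_⟩
  · exact Equiv.ext fun x => hf i x
  · have key : ∀ l : List ι, l.IsChain (· ≠ ·) → l.length ≤ g →
        ((l.map τ).prod ⟨[], by simp⟩ : X).1 = l := fun l => by
      induction l with
      | nil => simp
      | cons i t ih =>
        intro h1 h2
        rw [List.isChain_cons] at h1
        rw [List.length_cons] at h2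
        have h3 : t.head? ≠ some i := fun h => h1.1 i h rfl
        have h4 := ih h1.2 (by omega)
        have h5 : t.length < g := h2
        rw [List.map_cons, List.prod_cons, Equiv.Perm.mul_apply]
        change mulLetter g i _ = _
        rw [h4]
        simp [mulLetter, h3, h5]
    have := key l hl hlen
    rw [h] at this
    exact hne this.symm

/-- Copies of `G` indexed by a group, where each `i` stands for a missing edge at the vertex
`s i` and joins the copies `σ` and `σ * τ i` there. -/
def copiesGraph (G : SimpleGraph V) (s : ι → V) {τ : ι → Γ} (h1 : ∀ i, τ i * τ i = 1)
    (h2 : ∀ i, τ i ≠ 1) : SimpleGraph (Γ × V) where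
  Adj x y := (x.1 = y.1 ∧ G.Adj x.2 y.2) ∨ ∃ i, s i = x.2 ∧ s i = y.2 ∧ y.1 = x.1 * τ i
  symm := ⟨by
    rintro x y (h | ⟨i, h3, h4, h5⟩)
    · exact Or.inl ⟨h.1.symm, h.2.symm⟩
    · exact Or.inr ⟨i, h4, h3, by rw [h5, mul_assoc, h1, mul_one]⟩⟩
  loopless := ⟨by
    rintro x (h | ⟨i, -, -, h5⟩)
    · exact G.loopless.irrefl _ h.2
    · exact h2 i (by simpa using h5)⟩

variable {G : SimpleGraph V} {s : ι → V} {τ : ι → Γ}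

theorem isCubic_copiesGraph [Finite V] [Finite ι] (h1 : ∀ i, τ i * τ i = 1)
    (h2 : ∀ i, τ i ≠ 1) (hinj : Function.Injective τ)
    (hs : ∀ v, (G.neighborSet v).ncard + {i | s i = v}.ncard = 3) :
    IsCubic (copiesGraph G s h1 h2) := by
  rintro ⟨σ, u⟩
  have hset : (copiesGraph G s h1 h2).neighborSet (σ, u) =
      (fun w => (σ, w)) '' G.neighborSet u ∪ (fun i => (σ * τ i, u)) '' {i | s i = u} := by
    ext ⟨ρ, w⟩
    constructor
    · rintro (⟨rfl, h⟩ | ⟨i, rfl, h4, h5⟩)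
      · exact Or.inl ⟨w, h, rfl⟩
      · exact Or.inr ⟨i, rfl, Prod.ext h5.symm h4⟩
    · rintro (⟨w', h, h'⟩ | ⟨i, h, h'⟩)
      · obtain ⟨rfl, rfl⟩ := Prod.mk.inj h'
        exact Or.inl ⟨rfl, h⟩
      · obtain ⟨rfl, rfl⟩ := Prod.mk.inj h'
        exact Or.inr ⟨i, h, h, rfl⟩
  rw [hset, Set.ncard_union_eq ?_ (Set.toFinite _) (Set.toFinite _),
    Set.ncard_image_of_injective _ (Prod.mk_right_injective σ),
    Set.ncard_image_of_injective _ fun i j hij =>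
      hinj (mul_left_cancel (Prod.mk.inj hij).1), hs]
  rw [Set.disjoint_left]
  rintro _ ⟨w, -, rfl⟩ ⟨i, -, h⟩
  exact h2 i (by simpa using (Prod.mk.inj h).1)

theorem indepNum_copiesGraph_le [Finite V] [Finite Γ] (h1 : ∀ i, τ i * τ i = 1)
    (h2 : ∀ i, τ i ≠ 1) :
    indepNum (copiesGraph G s h1 h2) ≤ Nat.card Γ * indepNum G := by
  classical
  have := Fintype.ofFinite Γ
  have := Fintype.ofFinite V
  obtain ⟨I, hI, hcard⟩ := exists_ncard_eq_indepNum (copiesGraph G s h1 h2)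
  have hfib : ∀ σ : Γ, #{x ∈ I.toFinset | x.1 = σ} ≤ indepNum G := fun σ => by
    have hind : IsIndep G {u | (σ, u) ∈ I} := fun u hu w hw hne hadj =>
      hI hu hw (fun h => hne (Prod.mk.inj h).2) (Or.inl ⟨rfl, hadj⟩)
    refine le_trans ?_ (le_indepNum hind)
    rw [Set.ncard_eq_toFinset_card']
    refine card_le_card_of_injOn Prod.snd ?_ ?_
    · rintro ⟨ρ, u⟩ h
      obtain ⟨h3, rfl⟩ := mem_filter.1 h
      simpa using h3
    · rintro ⟨ρ, u⟩ h ⟨ρ', u'⟩ h' heq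
      obtain ⟨-, rfl⟩ := mem_filter.1 h
      obtain ⟨-, h4⟩ := mem_filter.1 h'
      exact Prod.ext h4.symm heq
  rw [← hcard, Set.ncard_eq_toFinset_card', Nat.card_eq_fintype_card,
    card_eq_sum_card_fiberwise (f := Prod.fst) (t := univ) fun _ _ => mem_univ _]
  exact (sum_le_card_nsmul _ _ _ fun σ _ => hfib σ).trans_eq (by simp)

theorem exists_isChain_of_isPath_copiesGraph {h1 : ∀ i, τ i * τ i = 1} {h2 : ∀ i, τ i ≠ 1}
    {x y : Γ × V} (p : (copiesGraph G s h1 h2).Walk x y) (hp : p.IsPath) :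
    ∃ l : List ι, l.IsChain (· ≠ ·) ∧ l.length ≤ p.length ∧ y.1 = x.1 * (l.map τ).prod ∧
      ∀ i ∈ l.head?, (x.1, s i) ∈ p.support ∧ (x.1 * τ i, s i) ∈ p.support := by
  induction p with
  | nil => exact ⟨[], by simp⟩
  | @cons x z y h p ih =>
    rw [SimpleGraph.Walk.cons_isPath_iff] at hp
    obtain ⟨l, h3, h4, h5, h6⟩ := ih hp.1
    have hadj := h
    rcases hadj with ⟨h7, -⟩ | ⟨j, h7, h8, h9⟩
    · refine ⟨l, h3, by simp; omega, by rw [h5, h7], fun i hi => ?_⟩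
      rw [h7]
      exact ⟨List.mem_cons_of_mem _ (h6 i hi).1, List.mem_cons_of_mem _ (h6 i hi).2⟩
    · have hx : x = (z.1 * τ j, s j) := Prod.ext (by rw [h9, mul_assoc, h1, mul_one]) h7.symm
      refine ⟨j :: l, List.isChain_cons.2 ⟨fun i hi hij => ?_, h3⟩, by simpa using h4,
        by simp [h5, h9, mul_assoc], fun i hi => ?_⟩
      · subst hij
        exact hp.2 (hx ▸ (h6 j hi).2)
      · obtain rfl : j = i := by simpa using hi
        have hz : (x.1 * τ j, s j) = z := Prod.ext h9.symm h8
        have hx' : (x.1, s j) = x := Prod.ext rfl h7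
        rw [hz, hx']
        exact ⟨List.mem_cons_self, List.mem_cons_of_mem _ p.start_mem_support⟩

theorem exists_walk_of_walk_copiesGraph {h1 : ∀ i, τ i * τ i = 1} {h2 : ∀ i, τ i ≠ 1}
    {x y : Γ × V} (p : (copiesGraph G s h1 h2).Walk x y)
    (hp : ∀ a b, s(a, b) ∈ p.edges → a.1 = b.1) :
    ∃ q : G.Walk x.2 y.2, q.length = p.length ∧
      ∀ u v, s(u, v) ∈ q.edges → s((x.1, u), (x.1, v)) ∈ p.edges := by
  induction p with
  | nil => exact ⟨.nil, by simp⟩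
  | @cons x z y h p ih =>
    obtain ⟨q, h3, h4⟩ := ih fun a b hab => hp a b (List.mem_cons_of_mem _ hab)
    have h5 : x.1 = z.1 := hp x z List.mem_cons_self
    have h6 : G.Adj x.2 z.2 := by
      have hadj := h
      rcases hadj with h | ⟨i, -, -, h7⟩
      · exact h.2
      · exact absurd (by simpa [← h5] using h7) (h2 i)
    refine ⟨.cons h6 q, by simp [h3], fun u v huv => ?_⟩
    rw [SimpleGraph.Walk.edges_cons, List.mem_cons] at huv ⊢
    rcases huv with huv | huv
    · left
      have h7 : z = (x.1, z.2) := Prod.ext h5.symm rfl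
      rw [h7]
      exact congrArg (Sym2.map fun w => (x.1, w)) huv
    · rw [h5]
      exact Or.inr (h4 u v huv)

theorem le_length_add_one_of_le_egirth {g : ℕ} (hG : (g : ℕ∞) ≤ G.egirth) {u v : V}
    (h : G.Adj u v) (p : G.Walk v u) (hp : s(u, v) ∉ p.edges) : g ≤ p.length + 1 := by
  classical
  have hcycle : (SimpleGraph.Walk.cons h p.bypass).IsCycle :=
    (SimpleGraph.Walk.cons_isCycle_iff _ _).2
      ⟨p.bypass_isPath, fun he => hp (p.edges_bypass_subset_edges he)⟩
  have h1 := SimpleGraph.le_egirth.1 hG _ _ hcycle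
  rw [SimpleGraph.Walk.length_cons] at h1
  have h2 : g ≤ p.bypass.length + 1 := mod_cast h1
  have h3 := p.length_bypass_le_length
  omega

theorem le_egirth_copiesGraph {g : ℕ} (hτ : IsGenericInvolutions g τ) (h2 : ∀ i, τ i ≠ 1)
    (hG : (g : ℕ∞) ≤ G.egirth) : (g : ℕ∞) ≤ (copiesGraph G s hτ.mul_self h2).egirth := by
  rw [SimpleGraph.le_egirth]
  intro a c hc
  by_cases hcopy : ∀ x y, s(x, y) ∈ c.edges → x.1 = y.1
  · cases c with
    | nil => exact absurd hc SimpleGraph.Walk.not_isCycle_nil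
    | @cons _ y _ h c =>
      obtain ⟨p, -, hlen, hpe, hsub⟩ :=
        exists_isPath_of_mem_edges_isCycle hc (u := a) (v := y) List.mem_cons_self
      obtain ⟨q, h3, h4⟩ := exists_walk_of_walk_copiesGraph p fun x y hxy => hcopy x y (hsub hxy)
      have h5 : a.1 = y.1 := hcopy a y List.mem_cons_self
      have h6 : G.Adj a.2 y.2 := by
        have hadj := h
        rcases hadj with h | ⟨i, -, -, h7⟩
        · exact h.2
        · exact absurd (by simpa [← h5] using h7) (h2 i)
      have h7 := le_length_add_one_of_le_egirth hG h6 q fun hmem => hpe <| by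
        have := h4 _ _ hmem
        rwa [← h5, Prod.mk.eta, h5, Prod.mk.eta] at this
      rw [← hlen, ← h3]
      exact_mod_cast h7
  push Not at hcopy
  obtain ⟨x, y, hxy, hne⟩ := hcopy
  obtain ⟨p, hp, hlen, hpe, -⟩ := exists_isPath_of_mem_edges_isCycle hc hxy
  by_contra hlt
  have hlt : c.length < g := by simpa using hlt
  rcases c.adj_of_mem_edges hxy with h | ⟨j, h3, h4, h5⟩
  · exact hne h.1
  have hword : ∀ l : List ι, (j :: l).IsChain (· ≠ ·) → l.length ≤ p.length →
      x.1 ≠ y.1 * (l.map τ).prod := fun l hl hl' heq => by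
    refine hτ.prod_ne_one (j :: l) (by simp) hl (by simp; omega) ?_
    rw [h5, mul_assoc] at heq
    simpa using heq
  cases p with
  | nil => exact hne rfl
  | @cons _ z _ h p =>
    rw [SimpleGraph.Walk.cons_isPath_iff] at hp
    obtain ⟨l, h6, h7, h8, h9⟩ := exists_isChain_of_isPath_copiesGraph p hp.1
    have hadj := h
    rcases hadj with ⟨h10, -⟩ | ⟨k, h10, h11, h12⟩
    · refine hword l (List.isChain_cons.2 ⟨fun i hi hij => hp.2 ?_, h6⟩)
        (by rw [SimpleGraph.Walk.length_cons]; omega) (by rw [h10, h8])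
      subst hij
      have := (h9 j hi).1
      rwa [← h10, h4] at this
    · by_cases hkj : j = k
      · subst hkj
        have hz : z = x := Prod.ext (by rw [h12, h5, mul_assoc, hτ.mul_self, mul_one])
          (h11.symm.trans h3)
        refine hpe ?_
        rw [SimpleGraph.Walk.edges_cons, List.mem_cons]
        exact Or.inl (hz ▸ Sym2.eq_swap)
      · refine hword (k :: l) (List.isChain_cons_cons.2
          ⟨hkj, List.isChain_cons.2 ⟨fun i hi hij => hp.2 ?_, h6⟩⟩) (by simpa using h7)
          (by rw [List.map_cons, List.prod_cons, ← mul_assoc, ← h12, h8])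
        subst hij
        have := (h9 k hi).2
        rwa [h12, mul_assoc, hτ.mul_self, mul_one, h10] at this

theorem exists_isCubic_of_ncard_neighborSet_le_three {g : ℕ} (hg : 2 ≤ g) {V : Type} [Finite V]
    {G : SimpleGraph V} (hdeg : ∀ v, (G.neighborSet v).ncard ≤ 3) (hG : (g : ℕ∞) ≤ G.egirth) :
    ∃ (Γ : Type) (_ : Finite Γ) (G' : SimpleGraph (Γ × V)), Nonempty Γ ∧ IsCubic G' ∧
      (g : ℕ∞) ≤ G'.egirth ∧ indepNum G' ≤ Nat.card Γ * indepNum G := by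
  obtain ⟨Γ, _, _, τ, hτ⟩ :=
    exists_isGenericInvolutions (Σ v : V, Fin (3 - (G.neighborSet v).ncard)) g
  refine ⟨Γ, inferInstance, copiesGraph G Sigma.fst hτ.mul_self (hτ.ne_one hg), ⟨1⟩,
    isCubic_copiesGraph _ _ (hτ.injective hg) fun v => ?_, le_egirth_copiesGraph hτ _ hG,
    indepNum_copiesGraph_le _ _⟩
  have h : {i : Σ v : V, Fin (3 - (G.neighborSet v).ncard) | i.1 = v} =
      Set.range (Sigma.mk v) := by
    ext ⟨w, i⟩
    constructor
    · rintro rfl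
      exact ⟨i, rfl⟩
    · rintro ⟨j, hj⟩
      exact (congrArg Sigma.fst hj).symm
  rw [h, ← Set.image_univ, Set.ncard_image_of_injective _ sigma_mk_injective, Set.ncard_univ,
    Nat.card_fin]
  have := hdeg v
  omega

end CubicCompletion

/-- for every `g ≥ 3` and every `ε > 0` there is a finite cubic simple graph of
girth at least `g` whose independence number is less than `(0.454 + ε)` times the number of
vertices; hence `i(3,∞) ≤ 0.454`. -/
theorem exists_cubic_high_girth_small_independence_ratio
    (g : ℕ) (hg : 3 ≤ g) (ε : ℝ) (hε : 0 < ε) :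
    ∃ (V : Type) (_ : Finite V) (G : SimpleGraph V),
      IsCubic G ∧ (g : ℕ∞) ≤ G.egirth ∧
        (indepNum G : ℝ) < (0.454 + ε) * (Nat.card V : ℝ) := by
  obtain ⟨n, G, hn, hdeg, hG, hind⟩ := exists_ncard_neighborSet_le_three_indepNum_le g
  obtain ⟨Γ, _, G', _, hcubic, hgirth, hind'⟩ :=
    exists_isCubic_of_ncard_neighborSet_le_three (by omega) hdeg hG
  refine ⟨Γ × Fin n, inferInstance, G', hcubic, hgirth, ?_⟩
  have hΓ : (0 : ℝ) < Nat.card Γ := Nat.cast_pos.2 Nat.card_pos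
  have hn' : (0 : ℝ) < n := Nat.cast_pos.2 hn
  rw [Nat.card_prod, Nat.card_fin]
  push_cast
  calc (indepNum G' : ℝ) ≤ Nat.card Γ * indepNum G := mod_cast hind'
    _ ≤ Nat.card Γ * (0.454 * n) := mul_le_mul_of_nonneg_left hind hΓ.le
    _ < (0.454 + ε) * (Nat.card Γ * n) := by
      have := mul_pos hε (mul_pos hΓ hn')
      linarith
end

section
/- For every real ε > 0 there exists N > 0 such that for every even integer n > N, the number of pairings F ∈ G'_16(n) with α(π(F)) > 0.454·n is less than ε·(3n−1)!!. -/
/-- A pairing (configuration) on the point set `W_n = Fin n × Fin 3` is a perfect matching of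
the `3n` points, encoded as a fixed-point-free involution `σ`; there are `(3n−1)!!` of them. -/
def IsPairing {n : ℕ} (σ : Fin n × Fin 3 → Fin n × Fin 3) : Prop :=
  (∀ p, σ (σ p) = p) ∧ ∀ p, σ p ≠ p

/-- The projection `π(F)` of a pairing: distinct vertices `u, v` are adjacent iff some point
of `u` is matched with some point of `v`. -/
def projGraph {n : ℕ} (σ : Fin n × Fin 3 → Fin n × Fin 3) : SimpleGraph (Fin n) :=
  SimpleGraph.fromRel fun u v => ∃ j k : Fin 3, σ (u, j) = (v, k)

/-- The projected multigraph of `σ` is a simple graph: no loops (no point is matched to a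
point of the same vertex) and no multiple edges (distinct points of a vertex are matched to
points of distinct vertices). -/
def ProjIsSimple {n : ℕ} (σ : Fin n × Fin 3 → Fin n × Fin 3) : Prop :=
  (∀ p : Fin n × Fin 3, (σ p).1 ≠ p.1) ∧
    ∀ (v : Fin n) (j k : Fin 3), (σ (v, j)).1 = (σ (v, k)).1 → j = k

/-- `F ∈ G'_16(n)`: `F` is a pairing whose projection is a simple graph of girth at least 16
(such a projection is automatically a cubic graph). -/
def MemGSixteen {n : ℕ} (σ : Fin n × Fin 3 → Fin n × Fin 3) : Prop :=
  IsPairing σ ∧ ProjIsSimple σ ∧ 16 ≤ (projGraph σ).egirth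


open Finset

section IndependentSets

variable {V : Type*} {G : SimpleGraph V}

lemma not_triangle_of_le_egirth (hG : 16 ≤ G.egirth) {a b c : V} (hab : G.Adj a b)
    (hbc : G.Adj b c) (hca : G.Adj c a) : False := by
  let w : G.Walk a a := .cons hab (.cons hbc (.cons hca .nil))
  have hw : w.IsCycle := by
    have := hab.ne; have := hbc.ne; have := hca.ne
    simp [w, SimpleGraph.Walk.isCycle_def, SimpleGraph.Walk.isTrail_def]
    grind
  have := SimpleGraph.le_egirth.1 hG a w hw
  norm_num [w] at this

lemma not_pentagon_of_le_egirth (hG : 16 ≤ G.egirth) {a b c d e : V} (hab : G.Adj a b)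
    (hbc : G.Adj b c) (hcd : G.Adj c d) (hde : G.Adj d e) (hea : G.Adj e a)
    (hac : a ≠ c) (had : a ≠ d) (hbd : b ≠ d) (hbe : b ≠ e) (hce : c ≠ e) : False := by
  let w : G.Walk a a := .cons hab (.cons hbc (.cons hcd (.cons hde (.cons hea .nil))))
  have hw : w.IsCycle := by
    have := hab.ne; have := hbc.ne; have := hcd.ne; have := hde.ne; have := hea.ne
    simp [w, SimpleGraph.Walk.isCycle_def, SimpleGraph.Walk.isTrail_def]
    grind
  have := SimpleGraph.le_egirth.1 hG a w hw
  norm_num [w] at this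

/-- `I` is a maximum independent set which, among all those, minimizes the sum of a weight. -/
structure IsExtremal (G : SimpleGraph V) (f : V → ℕ) (I : Finset V) : Prop where
  indep : IsIndep G I
  card_le : ∀ J : Finset V, IsIndep G J → #J ≤ #I
  sum_le : ∀ J : Finset V, IsIndep G J → #J = #I → ∑ v ∈ I, f v ≤ ∑ v ∈ J, f v

lemma exists_isExtremal [Fintype V] (G : SimpleGraph V) (f : V → ℕ) :
    ∃ I, IsExtremal G f I ∧ #I = indepNum G := by
  classical
  obtain ⟨I₀, hI₀, hmax⟩ := exists_max_image ({J | IsIndep G J} : Finset (Finset V)) card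
    ⟨∅, by simp only [mem_filter, mem_univ, true_and]; simp [IsIndep]⟩
  obtain ⟨I, hI, hmin⟩ := exists_min_image
    ({J | IsIndep G J ∧ #J = #I₀} : Finset (Finset V)) (fun J => ∑ v ∈ J, f v)
    ⟨I₀, by simpa using hI₀⟩
  simp only [mem_filter, mem_univ, true_and] at hI₀ hmax hI hmin
  refine ⟨I, ⟨hI.1, fun J hJ => hI.2 ▸ hmax J hJ, fun J hJ h => hmin J ⟨hJ, h.trans hI.2⟩⟩, ?_⟩
  refine le_antisymm (le_csSup ⟨#I, ?_⟩ ⟨I, hI.1, Set.ncard_coe_finset I⟩)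
    (csSup_le' ?_)
  all_goals
    rintro _ ⟨s, hs, rfl⟩
    have := hmax s.toFinset (by simpa using hs)
    rwa [← Set.ncard_eq_toFinset_card', ← hI.2] at this

namespace IsExtremal

variable [DecidableEq V] {f : V → ℕ} {I : Finset V}

lemma isIndep_exchange (hI : IsExtremal G f I) {X Y : Finset V}
    (hY : IsIndep G Y) (hYX : ∀ y ∈ Y, ∀ u ∈ I, G.Adj y u → u ∈ X) :
    IsIndep G ((I \ X ∪ Y : Finset V) : Set V) := by
  intro a ha b hb hab h
  simp only [coe_union, coe_sdiff, Set.mem_union, Set.mem_sdiff, mem_coe] at ha hb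
  rcases ha with ha | ha <;> rcases hb with hb | hb
  · exact hI.indep ha.1 hb.1 hab h
  · exact ha.2 (hYX b hb a ha.1 h.symm)
  · exact hb.2 (hYX a ha b hb.1 h)
  · exact hY ha hb hab h

lemma card_exchange {X Y : Finset V} (hX : X ⊆ I) (hYI : Disjoint Y I) :
    #(I \ X ∪ Y) + #X = #I + #Y := by
  rw [card_union_of_disjoint (hYI.symm.mono_left sdiff_subset), add_right_comm,
    card_sdiff_add_card_eq_card hX]

lemma card_le_of_exchange (hI : IsExtremal G f I) {X Y : Finset V} (hX : X ⊆ I)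
    (hYI : Disjoint Y I)
    (hY : IsIndep G Y) (hYX : ∀ y ∈ Y, ∀ u ∈ I, G.Adj y u → u ∈ X) : #Y ≤ #X := by
  have h := hI.card_le _ (hI.isIndep_exchange hY hYX)
  have := card_exchange hX hYI
  omega

lemma sum_le_of_exchange (hI : IsExtremal G f I) {X Y : Finset V} (hX : X ⊆ I)
    (hYI : Disjoint Y I) (hXY : #Y = #X)
    (hY : IsIndep G Y) (hYX : ∀ y ∈ Y, ∀ u ∈ I, G.Adj y u → u ∈ X) :
    ∑ v ∈ X, f v ≤ ∑ v ∈ Y, f v := by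
  have hc := card_exchange hX hYI
  have h := hI.sum_le _ (hI.isIndep_exchange hY hYX) (by omega)
  rw [sum_union (hYI.symm.mono_left sdiff_subset), ← sum_sdiff hX] at h
  omega

lemma exists_adj (hI : IsExtremal G f I) {v : V} (hv : v ∉ I) : ∃ u ∈ I, G.Adj v u := by
  by_contra! h
  have := hI.card_le_of_exchange (X := ∅) (Y := {v}) (empty_subset _) (by simpa using hv)
    (by simp [IsIndep]) (by simpa using h)
  simp at this

lemma eq_of_private (hI : IsExtremal G f I) (hG : 16 ≤ G.egirth) {u v w : V} (hu : u ∈ I)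
    (hv : v ∉ I) (hw : w ∉ I) (hvu : G.Adj v u) (hwu : G.Adj w u)
    (hv' : ∀ x ∈ I, G.Adj v x → x = u) (hw' : ∀ x ∈ I, G.Adj w x → x = u) : v = w := by
  by_contra hne
  have hvw : ¬ G.Adj v w := fun h => not_triangle_of_le_egirth hG h hwu hvu.symm
  have := hI.card_le_of_exchange (X := {u}) (Y := {v, w}) (by simpa using hu)
    (by simp [hv, hw]) (by
      rw [IsIndep, coe_pair, Set.pairwise_pair]
      exact fun _ => ⟨hvw, fun h => hvw h.symm⟩) (by simpa using ⟨hv', hw'⟩)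
  simp [card_pair hne] at this

lemma le_of_private (hI : IsExtremal G f I) {u v : V} (hu : u ∈ I) (hv : v ∉ I)
    (hv' : ∀ x ∈ I, G.Adj v x → x = u) : f u ≤ f v := by
  simpa using hI.sum_le_of_exchange (X := {u}) (Y := {v}) (by simpa using hu)
    (by simpa using hv) (by simp) (by simp [IsIndep]) (by simpa using hv')

lemma not_two_paired (hI : IsExtremal G f I) (hG : 16 ≤ G.egirth) {u₁ u₂ v₁ v₂ w : V}
    (hu : u₁ ≠ u₂) (hu₁ : u₁ ∈ I) (hu₂ : u₂ ∈ I) (hv₁ : v₁ ∉ I) (hv₂ : v₂ ∉ I) (hw : w ∉ I)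
    (h₁ : G.Adj v₁ u₁) (h₂ : G.Adj v₂ u₂) (hw₁ : G.Adj w u₁) (hw₂ : G.Adj w u₂)
    (hv₁' : ∀ x ∈ I, G.Adj v₁ x → x = u₁) (hv₂' : ∀ x ∈ I, G.Adj v₂ x → x = u₂)
    (hw' : ∀ x ∈ I, G.Adj w x → x = u₁ ∨ x = u₂) : False := by
  have n₁ : w ≠ v₁ := by rintro rfl; exact hu (hv₁' _ hu₂ hw₂).symm
  have n₂ : w ≠ v₂ := by rintro rfl; exact hu (hv₂' _ hu₁ hw₁)
  have n₃ : v₁ ≠ v₂ := by rintro rfl; exact hu (hv₂' _ hu₁ h₁)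
  have a₁ : ¬ G.Adj w v₁ := fun h => not_triangle_of_le_egirth hG h h₁ hw₁.symm
  have a₂ : ¬ G.Adj w v₂ := fun h => not_triangle_of_le_egirth hG h h₂ hw₂.symm
  have a₃ : ¬ G.Adj v₁ v₂ := fun h => not_pentagon_of_le_egirth hG hw₁ h₁.symm h h₂ hw₂.symm
    n₁ n₂ (fun e => hv₂ (e ▸ hu₁)) hu (fun e => hv₁ (e ▸ hu₂))
  have := hI.card_le_of_exchange (X := {u₁, u₂}) (Y := {w, v₁, v₂})
    (by simp [insert_subset_iff, hu₁, hu₂]) (by simp [hv₁, hv₂, hw]) (by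
      rintro a ha b hb - h
      simp only [coe_insert, coe_singleton, Set.mem_insert_iff, Set.mem_singleton_iff] at ha hb
      rcases ha with rfl | rfl | rfl <;> rcases hb with rfl | rfl | rfl <;>
        (have := G.ne_of_adj h; have := h.symm; tauto))
    (by
      simp only [mem_insert, mem_singleton, forall_eq_or_imp, forall_eq]
      exact ⟨hw', fun x hx h => .inl (hv₁' x hx h), fun x hx h => .inr (hv₂' x hx h)⟩)
  rw [card_pair hu, card_eq_three.2 ⟨w, v₁, v₂, n₁, n₂, n₃, rfl⟩] at this
  omega

end IsExtremal

end IndependentSets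

section Labels

open scoped Classical

/-- Labels of the points of a pairing with a distinguished independent set `I`. A vertex outside
`I` with a single neighbor in `I` is called private, and it is paired with that neighbor. -/
inductive Label
  | solo | link | wing | toSolo | toPaired | idle
  deriving DecidableEq

instance : Fintype Label :=
  ⟨{.solo, .link, .wing, .toSolo, .toPaired, .idle}, fun x => by cases x <;> decide⟩

/-- The label triples that can occur at a vertex. -/
def IsAdmissible (a : Fin 3 → Label) : Prop :=
  (∀ j, a j = .solo) ∨ (∃ j, a j = .link ∧ ∀ i, i ≠ j → a i = .wing) ∨
    ((∃ j, a j = .idle ∧ ∀ i, i ≠ j → a i = .toSolo ∨ a i = .toPaired) ∧ ∃ i, a i = .toSolo) ∨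
    ∀ j, a j = .toSolo ∨ a j = .toPaired

variable {n : ℕ}

/-- The number of points with a given label. -/
def labelCount (c : Fin n → Fin 3 → Label) (l : Label) : ℕ :=
  #{p : Fin n × Fin 3 | c p.1 p.2 = l}

/-- The wings at those paired vertices that precede their partner. -/
noncomputable def ownWings (c : Fin n → Fin 3 → Label) (σ : Fin n × Fin 3 → Fin n × Fin 3) :
    Finset (Fin n × Fin 3) :=
  {p | c p.1 p.2 = .wing ∧ ∃ j, c p.1 j = .link ∧ p.1 < (σ (p.1, j)).1}

/-- The links at those paired vertices that precede their partner. -/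
noncomputable def lowerLinks (c : Fin n → Fin 3 → Label) (σ : Fin n × Fin 3 → Fin n × Fin 3) :
    Finset (Fin n × Fin 3) :=
  {p | c p.1 p.2 = .link ∧ p.1 < (σ p).1}

/-- The labelling `c` is consistent with the pairing `σ`. -/
structure IsCompatible (c : Fin n → Fin 3 → Label) (σ : Fin n × Fin 3 → Fin n × Fin 3) :
    Prop where
  invol : ∀ p, σ (σ p) = p
  fst_ne : ∀ p, (σ p).1 ≠ p.1
  link : ∀ p, c p.1 p.2 = .link → c (σ p).1 (σ p).2 = .link
  solo : ∀ p, c p.1 p.2 = .solo ↔ c (σ p).1 (σ p).2 = .toSolo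
  toPaired : ∀ p, c p.1 p.2 = .toPaired ↔ σ p ∈ ownWings c σ

/-- `v` is outside `I` and exactly one of its points is matched to a point over `I`. -/
def IsPrivate (σ : Fin n × Fin 3 → Fin n × Fin 3) (I : Finset (Fin n)) (v : Fin n) : Prop :=
  v ∉ I ∧ ∃ j, (σ (v, j)).1 ∈ I ∧ ∀ i, (σ (v, i)).1 ∈ I → i = j

/-- Some point of `u` is matched to a point of a private vertex. -/
def IsPaired (σ : Fin n × Fin 3 → Fin n × Fin 3) (I : Finset (Fin n)) (u : Fin n) : Prop :=
  ∃ j, IsPrivate σ I (σ (u, j)).1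

/-- The labelling determined by a set `I` of vertices. -/
noncomputable def labelling (σ : Fin n × Fin 3 → Fin n × Fin 3) (I : Finset (Fin n)) (v : Fin n)
    (j : Fin 3) : Label :=
  if v ∈ I then
    if IsPaired σ I v then if IsPrivate σ I (σ (v, j)).1 then .link else .wing else .solo
  else if IsPrivate σ I v then if (σ (v, j)).1 ∈ I then .link else .wing
  else if (σ (v, j)).1 ∈ I then if IsPaired σ I (σ (v, j)).1 then .toPaired else .toSolo
  else .idle

lemma projGraph_adj {σ : Fin n × Fin 3 → Fin n × Fin 3} (h : IsPairing σ) (h' : ProjIsSimple σ)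
    {u v : Fin n} : (projGraph σ).Adj u v ↔ ∃ j, (σ (u, j)).1 = v := by
  simp only [projGraph, SimpleGraph.fromRel_adj]
  constructor
  · rintro ⟨-, ⟨j, k, e⟩ | ⟨j, k, e⟩⟩
    · exact ⟨j, by rw [e]⟩
    · exact ⟨k, by rw [← e, h.1]⟩
  · rintro ⟨j, rfl⟩
    exact ⟨(h'.1 (u, j)).symm, .inl ⟨j, _, rfl⟩⟩

lemma card_filter_prod {α β : Type*} [Fintype α] [Fintype β] (P : α × β → Prop)
    [DecidablePred P] :
    #{p : α × β | P p} = ∑ a, #{b | P (a, b)} := by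
  simp only [card_filter, Fintype.sum_prod_type]

namespace IsExtremal

variable {σ : Fin n × Fin 3 → Fin n × Fin 3} {I : Finset (Fin n)}

lemma fst_notMem (hσ : MemGSixteen σ) (hI : IsExtremal (projGraph σ) Fin.val I)
    {v : Fin n} (hv : v ∈ I) (j : Fin 3) : (σ (v, j)).1 ∉ I := fun h =>
  hI.indep hv h (hσ.2.1.1 (v, j)).symm ((projGraph_adj hσ.1 hσ.2.1).2 ⟨j, rfl⟩)

lemma eq_of_isPrivate (hσ : MemGSixteen σ) {u v : Fin n} {j : Fin 3} (hu : u ∈ I)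
    (hv : IsPrivate σ I v) (e : (σ (v, j)).1 = u) :
    (projGraph σ).Adj v u ∧ ∀ x ∈ I, (projGraph σ).Adj v x → x = u := by
  refine ⟨(projGraph_adj hσ.1 hσ.2.1).2 ⟨j, e⟩, fun x hx h => ?_⟩
  obtain ⟨i, rfl⟩ := (projGraph_adj hσ.1 hσ.2.1).1 h
  obtain ⟨-, k, -, hk⟩ := hv
  rw [hk i hx, ← hk j (e ▸ hu), e]

lemma isPrivate_unique (hσ : MemGSixteen σ) (hI : IsExtremal (projGraph σ) Fin.val I)
    {u : Fin n} {i j : Fin 3} (hu : u ∈ I) (hi : IsPrivate σ I (σ (u, i)).1)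
    (hj : IsPrivate σ I (σ (u, j)).1) : i = j := by
  refine hσ.2.1.2 u i j ?_
  have h₁ := eq_of_isPrivate hσ (j := (σ (u, i)).2) hu hi (by rw [Prod.mk.eta, hσ.1.1])
  have h₂ := eq_of_isPrivate hσ (j := (σ (u, j)).2) hu hj (by rw [Prod.mk.eta, hσ.1.1])
  exact hI.eq_of_private hσ.2.2 hu hi.1 hj.1 h₁.1 h₂.1 h₁.2 h₂.2

lemma lt_of_isPrivate (hσ : MemGSixteen σ) (hI : IsExtremal (projGraph σ) Fin.val I)
    {v : Fin n} {j : Fin 3} (hu : (σ (v, j)).1 ∈ I) (hv : IsPrivate σ I v) :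
    (σ (v, j)).1 < v := by
  have h := eq_of_isPrivate hσ hu hv rfl
  exact lt_of_le_of_ne (hI.le_of_private hu hv.1 h.2) (hσ.2.1.1 _)

lemma lt_fst_of_isPrivate (hσ : MemGSixteen σ) (hI : IsExtremal (projGraph σ) Fin.val I)
    {u : Fin n} {j : Fin 3} (hu : u ∈ I) (hv : IsPrivate σ I (σ (u, j)).1) :
    u < (σ (u, j)).1 := by
  have := hI.lt_of_isPrivate hσ (j := (σ (u, j)).2) (v := (σ (u, j)).1)
    (by rwa [Prod.mk.eta, hσ.1.1]) hv
  rwa [Prod.mk.eta, hσ.1.1] at this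

lemma exists_two_of_not_isPrivate (hσ : MemGSixteen σ)
    (hI : IsExtremal (projGraph σ) Fin.val I) {w : Fin n} (hw : w ∉ I)
    (hw' : ¬ IsPrivate σ I w) : ∃ i j, i ≠ j ∧ (σ (w, i)).1 ∈ I ∧ (σ (w, j)).1 ∈ I := by
  obtain ⟨u, hu, h⟩ := hI.exists_adj hw
  obtain ⟨i, rfl⟩ := (projGraph_adj hσ.1 hσ.2.1).1 h
  by_contra! H
  exact hw' ⟨hw, i, hu, fun j hj => by_contra fun hne => H j i hne hj hu⟩

lemma not_isPaired_both (hσ : MemGSixteen σ) (hI : IsExtremal (projGraph σ) Fin.val I)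
    {w : Fin n} {i j : Fin 3} (hw : w ∉ I) (hij : i ≠ j)
    (hi : (σ (w, i)).1 ∈ I) (hj : (σ (w, j)).1 ∈ I)
    (hk : ∀ k, (σ (w, k)).1 ∈ I → k = i ∨ k = j) (hpi : IsPaired σ I (σ (w, i)).1)
    (hpj : IsPaired σ I (σ (w, j)).1) : False := by
  obtain ⟨a, ha⟩ := hpi
  obtain ⟨b, hb⟩ := hpj
  have h₁ := eq_of_isPrivate hσ (j := (σ ((σ (w, i)).1, a)).2) hi ha
    (by rw [Prod.mk.eta, hσ.1.1])
  have h₂ := eq_of_isPrivate hσ (j := (σ ((σ (w, j)).1, b)).2) hj hb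
    (by rw [Prod.mk.eta, hσ.1.1])
  refine hI.not_two_paired hσ.2.2 (fun e => hij (hσ.2.1.2 w i j e)) hi hj ha.1 hb.1 hw h₁.1 h₂.1
    ((projGraph_adj hσ.1 hσ.2.1).2 ⟨i, rfl⟩) ((projGraph_adj hσ.1 hσ.2.1).2 ⟨j, rfl⟩)
    h₁.2 h₂.2 fun x hx h => ?_
  obtain ⟨k, rfl⟩ := (projGraph_adj hσ.1 hσ.2.1).1 h
  rcases hk k hx with rfl | rfl <;> simp

lemma labelling_of_mem (hσ : MemGSixteen σ) (hI : IsExtremal (projGraph σ) Fin.val I)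
    {v : Fin n} (hv : v ∈ I) : (∀ j, labelling σ I v j = .solo) ∨
      ∃ j, v < (σ (v, j)).1 ∧ labelling σ I v j = .link ∧
        ∀ i, i ≠ j → labelling σ I v i = .wing := by
  by_cases hp : IsPaired σ I v
  · obtain ⟨j, hj⟩ := id hp
    refine .inr ⟨j, hI.lt_fst_of_isPrivate hσ hv hj, by simp [labelling, hv, hp, hj],
      fun i hi => ?_⟩
    have : ¬ IsPrivate σ I (σ (v, i)).1 := fun h => hi (hI.isPrivate_unique hσ hv h hj)
    simp [labelling, hv, hp, this]
  · exact .inl fun j => by simp [labelling, hv, hp]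

lemma labelling_of_isPrivate {v : Fin n} (hv : IsPrivate σ I v) :
    ∃ j, (σ (v, j)).1 ∈ I ∧ labelling σ I v j = .link ∧
        ∀ i, i ≠ j → labelling σ I v i = .wing := by
  obtain ⟨j, hj, h⟩ := hv.2
  refine ⟨j, hj, by simp [labelling, hv.1, hv, hj], fun i hi => ?_⟩
  have : (σ (v, i)).1 ∉ I := fun h' => hi (h i h')
  simp [labelling, hv.1, hv, this]

lemma isAdmissible_labelling (hσ : MemGSixteen σ) (hI : IsExtremal (projGraph σ) Fin.val I)
    (v : Fin n) : IsAdmissible (labelling σ I v) := by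
  by_cases hv : v ∈ I
  · exact (hI.labelling_of_mem hσ hv).imp_right fun ⟨j, h⟩ => .inl ⟨j, h.2⟩
  by_cases hp : IsPrivate σ I v
  · obtain ⟨j, -, h⟩ := labelling_of_isPrivate hp
    exact .inr (.inl ⟨j, h⟩)
  have key : ∀ j, (σ (v, j)).1 ∈ I →
      labelling σ I v j = .toSolo ∨ labelling σ I v j = .toPaired := fun j hj => by
    by_cases h : IsPaired σ I (σ (v, j)).1 <;> simp [labelling, hv, hp, hj, h]
  refine .inr (.inr ?_)
  by_cases hall : ∀ j, (σ (v, j)).1 ∈ I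
  · exact .inr fun j => key j (hall j)
  push Not at hall
  obtain ⟨k, hk⟩ := hall
  obtain ⟨i, j, hij, hi, hj⟩ := hI.exists_two_of_not_isPrivate hσ hv hp
  have hki : k ≠ i := fun e => hk (e ▸ hi)
  have hkj : k ≠ j := fun e => hk (e ▸ hj)
  have h3 : ∀ l, l = i ∨ l = j ∨ l = k := by
    clear hi hj hk
    revert i j k
    decide
  refine .inl ⟨⟨k, by simp [labelling, hv, hp, hk], fun l hl => ?_⟩, ?_⟩
  · rcases h3 l with rfl | rfl | rfl
    · exact key _ hi
    · exact key _ hj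
    · exact absurd rfl hl
  · by_contra! H
    have hs : ∀ l, (σ (v, l)).1 ∈ I → IsPaired σ I (σ (v, l)).1 := fun l hl => by
      by_contra hn
      exact H l (by simp [labelling, hv, hp, hl, hn])
    refine hI.not_isPaired_both hσ hv hij hi hj (fun l hl => ?_) (hs _ hi) (hs _ hj)
    rcases h3 l with h | h | rfl
    · exact .inl h
    · exact .inr h
    · exact absurd hl hk

lemma isCompatible_labelling (hσ : MemGSixteen σ) (hI : IsExtremal (projGraph σ) Fin.val I) :
    IsCompatible (labelling σ I) σ := by
  have hnot : ∀ p : Fin n × Fin 3, p.1 ∈ I → (σ p).1 ∉ I := fun p hp => hI.fst_notMem hσ hp p.2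
  have hpair : ∀ p : Fin n × Fin 3, IsPrivate σ I (σ p).1 → IsPaired σ I p.1 :=
    fun p hp => ⟨p.2, hp⟩
  have solo_iff : ∀ p : Fin n × Fin 3, labelling σ I p.1 p.2 = .solo ↔
      p.1 ∈ I ∧ ¬ IsPaired σ I p.1 := fun p => by
    unfold labelling; split_ifs <;> simp_all
  have link_iff : ∀ p : Fin n × Fin 3, labelling σ I p.1 p.2 = .link ↔
      p.1 ∈ I ∧ IsPrivate σ I (σ p).1 ∨ IsPrivate σ I p.1 ∧ (σ p).1 ∈ I := fun p => by
    have h₁ := hpair p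
    have h₂ : p.1 ∈ I → ¬ IsPrivate σ I p.1 := fun h h' => h'.1 h
    unfold labelling
    simp only [Prod.mk.eta]
    split_ifs <;> simp_all
  have wing_iff : ∀ p : Fin n × Fin 3, labelling σ I p.1 p.2 = .wing ↔
      p.1 ∈ I ∧ IsPaired σ I p.1 ∧ ¬ IsPrivate σ I (σ p).1 ∨
        IsPrivate σ I p.1 ∧ (σ p).1 ∉ I := fun p => by
    have h₂ : p.1 ∈ I → ¬ IsPrivate σ I p.1 := fun h h' => h'.1 h
    unfold labelling
    simp only [Prod.mk.eta]
    split_ifs <;> simp_all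
  have toSolo_iff : ∀ p : Fin n × Fin 3, labelling σ I p.1 p.2 = .toSolo ↔
      p.1 ∉ I ∧ ¬ IsPrivate σ I p.1 ∧ (σ p).1 ∈ I ∧ ¬ IsPaired σ I (σ p).1 := fun p => by
    unfold labelling
    simp only [Prod.mk.eta]
    split_ifs <;> simp_all
  have toPaired_iff : ∀ p : Fin n × Fin 3, labelling σ I p.1 p.2 = .toPaired ↔
      p.1 ∉ I ∧ ¬ IsPrivate σ I p.1 ∧ (σ p).1 ∈ I ∧ IsPaired σ I (σ p).1 := fun p => by
    unfold labelling
    simp only [Prod.mk.eta]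
    split_ifs <;> simp_all
  refine ⟨hσ.1.1, hσ.2.1.1, fun p hp => ?_, fun p => ?_, fun p => ?_⟩
  · rw [link_iff] at hp ⊢
    rw [hσ.1.1]
    tauto
  · rw [solo_iff, toSolo_iff, hσ.1.1]
    have := hnot p
    have := hpair p
    tauto
  · have h₁ := hnot (σ p)
    have h₂ := hpair (σ p)
    rw [hσ.1.1] at h₁ h₂
    rw [toPaired_iff, ownWings, mem_filter, wing_iff, hσ.1.1]
    constructor
    · rintro ⟨hpI, hpP, hqI, j, hj⟩
      refine ⟨mem_univ _, .inl ⟨hqI, ⟨j, hj⟩, hpP⟩, j, ?_, hI.lt_fst_of_isPrivate hσ hqI hj⟩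
      exact (link_iff (_, j)).2 (.inl ⟨hqI, hj⟩)
    · rintro ⟨-, ⟨hqI, hq, hp⟩ | ⟨hq, hpI⟩, j, hj, hlt⟩
      · exact ⟨h₁ hqI, hp, hqI, hq⟩
      · rcases (link_iff (_, j)).1 hj with h | h
        · exact absurd h.1 hq.1
        · exact absurd (hI.lt_of_isPrivate hσ h.2 hq) hlt.asymm

lemma three_mul_card (hσ : MemGSixteen σ) (hI : IsExtremal (projGraph σ) Fin.val I) :
    3 * #I = labelCount (labelling σ I) .solo + 3 * #(lowerLinks (labelling σ I) σ) := by
  rw [labelCount, lowerLinks, card_filter_prod, card_filter_prod, mul_sum, ← sum_add_distrib,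
    mul_comm, ← sum_const_nat (s := I) (f := fun _ => 3) (fun _ _ => rfl),
    ← sum_subset (subset_univ I)]
  · refine sum_congr rfl fun v hv => ?_
    rcases hI.labelling_of_mem hσ hv with h | ⟨j, hlt, h⟩
    · simp [h]
    · have h₁ : ({i | labelling σ I v i = .link ∧ v < (σ (v, i)).1} : Finset (Fin 3)) = {j} := by
        ext i
        by_cases e : i = j
        · simp [e, hlt, h.1]
        · simp [e, h.2 i e]
      have h₂ : ({i | labelling σ I v i = .solo} : Finset (Fin 3)) = ∅ := by
        ext i
        by_cases e : i = j
        · simp [e, h.1]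
        · simp [h.2 i e]
      simp [h₁, h₂]
  · rintro v - hv
    have h₁ : ({i | labelling σ I v i = .solo} : Finset (Fin 3)) = ∅ := by
      refine filter_eq_empty_iff.2 fun j _ => ?_
      unfold labelling
      split_ifs <;> simp
    have h₂ : ({i | labelling σ I v i = .link ∧ v < (σ (v, i)).1} : Finset (Fin 3)) = ∅ := by
      refine filter_eq_empty_iff.2 fun j _ h => ?_
      by_cases hp : IsPrivate σ I v
      · by_cases hj : (σ (v, j)).1 ∈ I
        · exact h.2.asymm (hI.lt_of_isPrivate hσ hj hp)
        · simp [labelling, hv, hp, hj] at h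
      · have := h.1
        unfold labelling at this
        split_ifs at this
    simp [h₁, h₂]

end IsExtremal

end Labels

open scoped Nat

section Matchings

open scoped Classical

variable {α : Type*} [DecidableEq α]

/-- `σ` is a fixed-point-free involution of `S`, extended by the identity. -/
def IsMatchingOn (S : Finset α) (σ : α → α) : Prop :=
  (∀ p ∈ S, σ p ∈ S ∧ σ p ≠ p ∧ σ (σ p) = p) ∧ ∀ p ∉ S, σ p = p

/-- The function agreeing with `σ` on `S` and with the identity elsewhere. -/
noncomputable def restrictTo (S : Finset α) (σ : α → α) (p : α) : α := if p ∈ S then σ p else p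

lemma isMatchingOn_restrictTo {S : Finset α} {σ : α → α}
    (h : ∀ p ∈ S, σ p ∈ S ∧ σ p ≠ p ∧ σ (σ p) = p) : IsMatchingOn S (restrictTo S σ) := by
  refine ⟨fun p hp => ?_, fun p hp => by simp [restrictTo, hp]⟩
  simpa [restrictTo, hp, (h p hp).1] using h p hp

variable [Fintype α]

lemma card_isMatchingOn_le (S : Finset α) :
    #{σ : α → α | IsMatchingOn S σ} ≤ (#S - 1)‼ := by
  induction hm : #S using Nat.strong_induction_on generalizing S with
  | _ m ih =>
    rcases S.eq_empty_or_nonempty with rfl | ⟨a, ha⟩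
    · have : ({σ : α → α | IsMatchingOn ∅ σ} : Finset (α → α)) ⊆ {id} := by
        intro σ hσ
        exact mem_singleton.2 (funext fun p => (mem_filter.1 hσ).2.2 p (notMem_empty p))
      refine (card_le_card this).trans ?_
      rw [card_singleton]
      exact Nat.doubleFactorial_pos _
    have hS : 0 < #S := card_pos.2 ⟨a, ha⟩
    have key : #{σ : α → α | IsMatchingOn S σ} ≤ (m - 2 - 1)‼ * #(S.erase a) := by
      refine card_le_mul_card_image_of_maps_to (f := fun σ => σ a) (fun σ hσ => ?_) _
        (fun b hb => ?_)
      · simp only [mem_filter] at hσ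
        exact mem_erase.2 ⟨(hσ.2.1 a ha).2.1, (hσ.2.1 a ha).1⟩
      · obtain ⟨hba, hb⟩ := mem_erase.1 hb
        have hc : #((S.erase a).erase b) = m - 2 := by
          rw [card_erase_of_mem (mem_erase.2 ⟨hba, hb⟩), card_erase_of_mem ha, hm]
          omega
        refine le_trans ?_ (ih (m - 2) (by omega) _ hc)
        refine card_le_card_of_injOn (restrictTo ((S.erase a).erase b)) ?_ ?_
        · intro σ hσ
          simp only [coe_filter, mem_filter, mem_univ, true_and, Set.mem_ofPred_eq] at hσ ⊢
          obtain ⟨⟨h, -⟩, rfl⟩ := hσ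
          refine isMatchingOn_restrictTo fun p hp => ?_
          simp only [mem_erase] at hp ⊢
          obtain ⟨hpb, hpa, hp⟩ := hp
          have hpp := h p hp
          refine ⟨⟨fun e => hpa ?_, fun e => hpb ?_, hpp.1⟩, hpp.2⟩
          · rw [← hpp.2.2, e, (h a ha).2.2]
          · rw [← hpp.2.2, e]
        · intro σ hσ τ hτ e
          simp only [coe_filter, mem_filter, mem_univ, true_and, Set.mem_ofPred_eq] at hσ hτ
          funext p
          by_cases hp : p ∈ S
          · by_cases hpa : p = a
            · rw [hpa, hσ.2, hτ.2]
            by_cases hpb : p = b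
            · have h1 := (hσ.1.1 a ha).2.2
              have h2 := (hτ.1.1 a ha).2.2
              rw [hσ.2] at h1
              rw [hτ.2] at h2
              rw [hpb, h1, h2]
            have := congrFun e p
            simpa [restrictTo, hpa, hpb, hp] using this
          · rw [hσ.1.2 p hp, hτ.1.2 p hp]
    refine key.trans ?_
    rw [card_erase_of_mem ha, hm]
    rcases m with _ | _ | _ | m
    · omega
    · simp
    · simp
    · simp only [Nat.add_sub_cancel, show m + 1 + 1 + 1 - 2 - 1 = m by omega,
        Nat.doubleFactorial_add_two]
      rw [mul_comm]

/-- Count the matchings of `α` that restrict to a matching of `L`, send `S₁` into `T₁` and send a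
set `S₂` determined by the restriction to `L` into `T₂`. -/
lemma card_matchings_le {P : (α → α) → Prop} {L S₁ T₁ T₂ : Finset α} {S₂ : (α → α) → Finset α}
    {a m r : ℕ}
    (hP : ∀ σ, P σ → ∀ p, σ (σ p) = p ∧ σ p ≠ p)
    (hL : ∀ σ, P σ → ∀ p ∈ L, σ p ∈ L)
    (hS₁ : ∀ σ, P σ → ∀ p ∈ S₁, σ p ∈ T₁)
    (hT₁ : ∀ σ, P σ → ∀ p ∈ T₁, σ p ∈ S₁)
    (hS₂ : ∀ σ, P σ → ∀ p ∈ S₂ (restrictTo L σ), σ p ∈ T₂)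
    (hT₂ : ∀ σ, P σ → ∀ p ∈ T₂, σ p ∈ S₂ (restrictTo L σ))
    (hS₁a : #S₁ = a) (hT₁a : #T₁ = a) (hS₂m : ∀ σ, P σ → #(S₂ (restrictTo L σ)) = m)
    (hT₂m : #T₂ = m)
    (hr : ∀ σ, P σ → #(univ \ (L ∪ (S₁ ∪ T₁) ∪ (S₂ (restrictTo L σ) ∪ T₂))) = r) :
    #{σ : α → α | P σ} ≤ (#L - 1)‼ * (a ! * m ! * (r - 1)‼) := by
  have step : #{σ : α → α | P σ} ≤ (a ! * m ! * (r - 1)‼) * #{τ : α → α | IsMatchingOn L τ} := by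
    refine card_le_mul_card_image_of_maps_to (f := restrictTo L) (fun σ hσ => ?_) _
      (fun τ hτ => ?_)
    · simp only [mem_filter, mem_univ, true_and] at hσ ⊢
      exact isMatchingOn_restrictTo fun p hp => ⟨hL σ hσ p hp, (hP σ hσ p).2, (hP σ hσ p).1⟩
    · rcases Finset.eq_empty_or_nonempty {σ ∈ ({σ : α → α | P σ} : Finset (α → α)) |
        restrictTo L σ = τ} with h0 | ⟨σ₀, hσ₀⟩
      · rw [h0]; simp
      simp only [mem_filter, mem_univ, true_and] at hσ₀
      obtain ⟨hσ₀, rfl⟩ := hσ₀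
      set W := S₂ (restrictTo L σ₀)
      set R := univ \ (L ∪ (S₁ ∪ T₁) ∪ (W ∪ T₂)) with hR
      have inj : ∀ σ, P σ → Function.Injective σ := fun σ hσ p q e => by
        rw [← (hP σ hσ p).1, e, (hP σ hσ q).1]
      let X := {σ : α → α // P σ ∧ restrictTo L σ = restrictTo L σ₀}
      let F : X → (S₁ ↪ T₁) × (W ↪ T₂) × {ρ : α → α // IsMatchingOn R ρ} := fun σ =>
        ⟨⟨fun p => ⟨σ.1 p, hS₁ σ.1 σ.2.1 p p.2⟩, fun p q e =>
            Subtype.ext (inj _ σ.2.1 (congrArg Subtype.val e))⟩,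
          ⟨fun p => ⟨σ.1 p, hS₂ σ.1 σ.2.1 p (by rw [σ.2.2]; exact p.2)⟩, fun p q e =>
            Subtype.ext (inj _ σ.2.1 (congrArg Subtype.val e))⟩,
          ⟨restrictTo R σ.1, isMatchingOn_restrictTo fun p hp =>
            ⟨by
              have h1 := hL _ σ.2.1 (σ.1 p)
              have h2 := hS₁ _ σ.2.1 (σ.1 p)
              have h3 := hT₁ _ σ.2.1 (σ.1 p)
              have h4 := hS₂ _ σ.2.1 (σ.1 p)
              have h5 := hT₂ _ σ.2.1 (σ.1 p)
              rw [(hP _ σ.2.1 p).1] at h1 h2 h3 h4 h5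
              rw [σ.2.2] at h4 h5
              simp only [hR, mem_sdiff, mem_univ, true_and, mem_union, not_or] at hp ⊢
              tauto, (hP _ σ.2.1 p).2, (hP _ σ.2.1 p).1⟩⟩⟩
      have hF : Function.Injective F := by
        rintro ⟨σ, hσ, hσ'⟩ ⟨τ, hτ, hτ'⟩ e
        simp only [F, Prod.mk.injEq, Subtype.mk.injEq] at e
        obtain ⟨e1, e2, e3⟩ := e
        have f1 : ∀ p ∈ S₁, σ p = τ p := fun p hp => congrArg Subtype.val (DFunLike.congr_fun e1 ⟨p, hp⟩)
        have f2 : ∀ p ∈ W, σ p = τ p := fun p hp => congrArg Subtype.val (DFunLike.congr_fun e2 ⟨p, hp⟩)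
        have back : ∀ p, σ (σ p) = τ (σ p) → σ p = τ p := fun p h => by
          rw [(hP σ hσ p).1] at h
          exact inj τ hτ (by rw [← h, (hP τ hτ p).1])
        refine Subtype.ext (funext fun p => ?_)
        by_cases hpL : p ∈ L
        · simpa [restrictTo, hpL] using congrFun (hσ'.trans hτ'.symm) p
        by_cases hpR : p ∈ R
        · simpa [restrictTo, hpR] using congrFun e3 p
        have hp : p ∈ S₁ ∨ p ∈ T₁ ∨ p ∈ W ∨ p ∈ T₂ := by
          simp only [hR, mem_sdiff, mem_univ, true_and, mem_union] at hpR
          tauto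
        rcases hp with hp | hp | hp | hp
        · exact f1 p hp
        · exact back p (f1 _ (hT₁ σ hσ p hp))
        · exact f2 p hp
        · refine back p (f2 _ ?_)
          have := hT₂ σ hσ p hp
          rwa [hσ'] at this
      have hc := Fintype.card_le_of_injective F hF
      rw [filter_filter, ← Fintype.card_subtype]
      refine hc.trans ?_
      rw [Fintype.card_prod, Fintype.card_prod, Fintype.card_embedding_eq,
        Fintype.card_embedding_eq, Fintype.card_coe, Fintype.card_coe, Fintype.card_coe,
        Fintype.card_coe, hS₁a, hT₁a, hS₂m σ₀ hσ₀, hT₂m, Nat.descFactorial_self,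
        Nat.descFactorial_self, mul_assoc, Fintype.card_subtype]
      gcongr
      rw [← hr σ₀ hσ₀]
      exact card_isMatchingOn_le R
  refine step.trans ?_
  rw [mul_comm]
  gcongr
  exact card_isMatchingOn_le L

end Matchings

section CompatibleCount

open scoped Classical

namespace IsCompatible

variable {n : ℕ} {c : Fin n → Fin 3 → Label} {σ : Fin n × Fin 3 → Fin n × Fin 3}

lemma injective (h : IsCompatible c σ) : Function.Injective σ :=
  Function.LeftInverse.injective h.invol

lemma labelCount_toSolo (h : IsCompatible c σ) :
    labelCount c .toSolo = labelCount c .solo := by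
  refine card_bij' (fun p _ => σ p) (fun p _ => σ p) ?_ ?_ (fun p _ => h.invol p)
    (fun p _ => h.invol p)
  · intro p hp
    simp only [mem_filter, mem_univ, true_and] at hp ⊢
    rwa [h.solo, h.invol]
  · intro p hp
    simp only [mem_filter, mem_univ, true_and] at hp ⊢
    rwa [← h.solo]

lemma labelCount_toPaired (h : IsCompatible c σ) :
    labelCount c .toPaired = #(ownWings c σ) := by
  refine card_bij' (fun p _ => σ p) (fun p _ => σ p) ?_ ?_ (fun p _ => h.invol p)
    (fun p _ => h.invol p)
  · intro p hp
    exact (h.toPaired p).1 (mem_filter.1 hp).2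
  · intro p hp
    refine mem_filter.2 ⟨mem_univ _, (h.toPaired _).2 ?_⟩
    rwa [h.invol]

lemma labelCount_link (h : IsCompatible c σ) :
    labelCount c .link = 2 * #(lowerLinks c σ) := by
  have hu : ({p : Fin n × Fin 3 | c p.1 p.2 = .link} : Finset _) =
      lowerLinks c σ ∪ (lowerLinks c σ).image σ := by
    ext p
    have h₁ := h.link p
    have h₂ := h.link (σ p)
    rw [h.invol] at h₂
    have h₃ := h.fst_ne p
    have h₄ : p ∈ (lowerLinks c σ).image σ ↔ σ p ∈ lowerLinks c σ :=
      ⟨fun hp => by obtain ⟨q, hq, rfl⟩ := mem_image.1 hp; rwa [h.invol],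
        fun hp => mem_image.2 ⟨_, hp, h.invol p⟩⟩
    rw [mem_union, h₄]
    simp only [lowerLinks, mem_filter, mem_univ, true_and, h.invol]
    rcases lt_or_gt_of_ne h₃ <;> tauto
  rw [labelCount, hu, card_union_of_disjoint, card_image_of_injective _ h.injective, two_mul]
  rw [disjoint_left]
  intro p hp hp'
  obtain ⟨q, hq, rfl⟩ := mem_image.1 hp'
  simp only [lowerLinks, mem_filter, h.invol] at hp hq
  exact hp.2.2.asymm hq.2.2

lemma card_ownWings (hc : ∀ v, IsAdmissible (c v)) :
    #(ownWings c σ) = 2 * #(lowerLinks c σ) := by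
  rw [ownWings, lowerLinks, card_filter_prod, card_filter_prod, mul_sum]
  refine sum_congr rfl fun v _ => ?_
  have key : (∀ j, c v j ≠ .link) ∨ ∃ j, c v j = .link ∧ ∀ i, i ≠ j → c v i = .wing := by
    rcases hc v with h | h | ⟨⟨j, h, h'⟩, -⟩ | h
    · exact .inl fun j => by simp [h j]
    · exact .inr h
    · refine .inl fun i e => ?_
      by_cases hi : i = j
      · simp [hi, h] at e
      · rcases h' i hi with h' | h' <;> simp [h'] at e
    · refine .inl fun j e => ?_
      rcases h j with h' | h' <;> simp [h'] at e
  rcases key with h | ⟨j, hj, h⟩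
  · simp [h]
  · have h₁ : ∀ i, c v i = .link ↔ i = j := fun i =>
      ⟨fun e => by_contra fun hi => by simp [h i hi] at e, fun e => e ▸ hj⟩
    have h₂ : ∀ i, c v i = .wing ↔ i ≠ j := fun i =>
      ⟨fun e hi => by simp [hi, hj] at e, h i⟩
    simp only [h₁, h₂, exists_eq_left]
    by_cases hlt : v < (σ (v, j)).1
    · have e₁ : ({i | i ≠ j ∧ v < (σ (v, j)).1} : Finset (Fin 3)) = univ.erase j := by
        ext i; simp [hlt]
      have e₂ : ({i | i = j ∧ v < (σ (v, i)).1} : Finset (Fin 3)) = {j} := by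
        ext i
        simp only [mem_filter, mem_univ, true_and, mem_singleton, and_iff_left_iff_imp]
        rintro rfl
        exact hlt
      rw [e₁, e₂, card_erase_of_mem (mem_univ j)]
      simp
    · have e₂ : ({i | i = j ∧ v < (σ (v, i)).1} : Finset (Fin 3)) = ∅ := by
        refine filter_eq_empty_iff.2 ?_
        rintro i - ⟨rfl, h'⟩
        exact hlt h'
      simp [hlt, e₂]

lemma labelCount_wing (hc : ∀ v, IsAdmissible (c v)) :
    labelCount c .wing = 2 * labelCount c .link := by
  rw [labelCount, labelCount, card_filter_prod, card_filter_prod, mul_sum]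
  refine sum_congr rfl fun v _ => ?_
  have : ∀ a : Fin 3 → Label, IsAdmissible a →
      #{j | a j = .wing} = 2 * #{j | a j = .link} := by
    unfold IsAdmissible
    decide +kernel
  exact this _ (hc v)

end IsCompatible

lemma sum_labelCount {n : ℕ} (c : Fin n → Fin 3 → Label) : ∑ l, labelCount c l = 3 * n := by
  have := card_eq_sum_card_fiberwise (f := fun p : Fin n × Fin 3 => c p.1 p.2) (s := univ)
    (t := univ) (fun _ _ => mem_univ _)
  rw [card_univ, Fintype.card_prod, Fintype.card_fin, Fintype.card_fin] at this
  rw [mul_comm, this]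
  rfl

/-- The labellings with prescribed label counts. -/
noncomputable def labellings (n a m : ℕ) : Finset (Fin n → Fin 3 → Label) :=
  {c | (∀ v, IsAdmissible (c v)) ∧ labelCount c .solo = a ∧ labelCount c .toSolo = a ∧
    labelCount c .link = m ∧ labelCount c .toPaired = m ∧ labelCount c .wing = 2 * m}

lemma labelCount_idle {n a m : ℕ} {c : Fin n → Fin 3 → Label} (hc : c ∈ labellings n a m) :
    2 * a + 4 * m + labelCount c .idle = 3 * n := by
  obtain ⟨-, h₁, h₂, h₃, h₄, h₅⟩ := (mem_filter.1 hc).2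
  have := sum_labelCount c
  have hu : (univ : Finset Label) = {.solo, .link, .wing, .toSolo, .toPaired, .idle} := rfl
  simp [hu, h₁, h₂, h₃, h₄, h₅] at this
  omega

lemma card_isCompatible_le {n a m : ℕ} {c : Fin n → Fin 3 → Label} (hc : c ∈ labellings n a m) :
    #{σ | IsCompatible c σ} ≤ (m - 1)‼ * (a ! * m ! * (3 * n - 2 * a - 3 * m - 1)‼) := by
  obtain ⟨hadm, h₁, h₂, h₃, h₄, h₅⟩ := (mem_filter.1 hc).2
  have hW : ∀ σ, ownWings c (restrictTo {p | c p.1 p.2 = .link} σ) = ownWings c σ := fun σ => by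
    refine filter_congr fun p _ => and_congr_right fun _ => exists_congr fun j =>
      and_congr_right fun hj => ?_
    rw [restrictTo, if_pos (mem_filter.2 ⟨mem_univ (p.1, j), hj⟩)]
  have hWm : ∀ σ, IsCompatible c σ → #(ownWings c σ) = m := fun σ hσ => by
    rw [← hσ.labelCount_toPaired, h₄]
  subst h₃
  refine card_matchings_le (P := IsCompatible c) (L := {p | c p.1 p.2 = .link})
    (S₁ := {p | c p.1 p.2 = .solo}) (T₁ := {p | c p.1 p.2 = .toSolo}) (S₂ := ownWings c)
    (T₂ := {p | c p.1 p.2 = .toPaired})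
    (fun σ hσ p => ⟨hσ.invol p, fun e => hσ.fst_ne p (congrArg Prod.fst e)⟩) ?_ ?_ ?_ ?_ ?_
    h₁ h₂ ?_ h₄ ?_
  · intro σ hσ p hp
    exact mem_filter.2 ⟨mem_univ _, hσ.link p (mem_filter.1 hp).2⟩
  · intro σ hσ p hp
    exact mem_filter.2 ⟨mem_univ _, (hσ.solo p).1 (mem_filter.1 hp).2⟩
  · intro σ hσ p hp
    refine mem_filter.2 ⟨mem_univ _, (hσ.solo _).2 ?_⟩
    rw [hσ.invol]
    exact (mem_filter.1 hp).2
  · intro σ hσ p hp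
    refine mem_filter.2 ⟨mem_univ _, (hσ.toPaired _).2 ?_⟩
    rwa [hσ.invol, ← hW]
  · intro σ hσ p hp
    rw [hW]
    exact (hσ.toPaired p).1 (mem_filter.1 hp).2
  · intro σ hσ
    rw [hW, hWm σ hσ]
  · intro σ hσ
    have hd : ∀ {l l' : Label}, l ≠ l' →
        Disjoint ({p | c p.1 p.2 = l} : Finset (Fin n × Fin 3))
          ({p | c p.1 p.2 = l'} : Finset (Fin n × Fin 3)) := by
      intro l l' hl
      exact disjoint_filter.2 fun p _ h h' => hl (h.symm.trans h')
    have hWw : ownWings c σ ⊆ ({p | c p.1 p.2 = .wing} : Finset (Fin n × Fin 3)) := fun p hp =>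
      mem_filter.2 ⟨mem_univ _, (mem_filter.1 hp).2.1⟩
    have hdW : ∀ {l : Label}, l ≠ .wing →
        Disjoint ({p | c p.1 p.2 = l} : Finset (Fin n × Fin 3)) (ownWings c σ) := fun hl =>
      (hd hl).mono_right hWw
    rw [hW, card_sdiff_of_subset (subset_univ _), card_union_of_disjoint, card_union_of_disjoint,
      card_union_of_disjoint, card_union_of_disjoint, hWm σ hσ, card_univ, Fintype.card_prod,
      Fintype.card_fin, Fintype.card_fin]
    · change n * 3 - (labelCount c .link + (labelCount c .solo + labelCount c .toSolo) +
        (labelCount c .link + labelCount c .toPaired)) = 3 * n - 2 * a - 3 * labelCount c .link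
      omega
    · exact (hdW (by decide)).symm
    · exact hd (by decide)
    · exact disjoint_union_right.2 ⟨hd (by decide), hd (by decide)⟩
    · refine disjoint_union_left.2 ⟨disjoint_union_right.2 ⟨hdW (by decide), hd (by decide)⟩,
        disjoint_union_left.2 ⟨?_, ?_⟩⟩ <;>
      exact disjoint_union_right.2 ⟨hdW (by decide), hd (by decide)⟩

/-- Every pairing counted in the theorem is compatible with a labelling that determines the
independence number of its projection. -/
lemma exists_labelling {n : ℕ} {σ : Fin n × Fin 3 → Fin n × Fin 3} (hσ : MemGSixteen σ) :
    ∃ a m, ∃ c ∈ labellings n a m, IsCompatible c σ ∧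
      6 * indepNum (projGraph σ) = 2 * a + 3 * m := by
  obtain ⟨I, hI, hcard⟩ := exists_isExtremal (projGraph σ) Fin.val
  have hadm := hI.isAdmissible_labelling hσ
  have hcomp := hI.isCompatible_labelling hσ
  have h₁ := hcomp.labelCount_toSolo
  have h₂ := hcomp.labelCount_toPaired
  have h₃ := hcomp.labelCount_link
  have h₄ := IsCompatible.card_ownWings (σ := σ) hadm
  have h₅ := IsCompatible.labelCount_wing hadm
  have h₆ := hI.three_mul_card hσ
  exact ⟨_, _, labelling σ I, mem_filter.2 ⟨mem_univ _, hadm, rfl, h₁, rfl, by omega, h₅⟩, hcomp,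
    by omega⟩

end CompatibleCount

section WeightedCount

open scoped Classical

lemma sum_isAdmissible (g : Label → ℝ) :
    ∑ a : Fin 3 → Label with IsAdmissible a, ∏ j, g (a j) =
      g .solo ^ 3 + 3 * (g .link * g .wing ^ 2)
        + 3 * (g .idle * (g .toSolo ^ 2 + 2 * (g .toSolo * g .toPaired)))
        + (g .toSolo + g .toPaired) ^ 3 := by
  have h : ({a | IsAdmissible a} : Finset (Fin 3 → Label)) =
      {![.solo, .solo, .solo],
        ![.link, .wing, .wing], ![.wing, .link, .wing], ![.wing, .wing, .link],
        ![.idle, .toSolo, .toSolo], ![.idle, .toSolo, .toPaired], ![.idle, .toPaired, .toSolo],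
        ![.toSolo, .idle, .toSolo], ![.toSolo, .idle, .toPaired], ![.toPaired, .idle, .toSolo],
        ![.toSolo, .toSolo, .idle], ![.toSolo, .toPaired, .idle], ![.toPaired, .toSolo, .idle],
        ![.toSolo, .toSolo, .toSolo], ![.toPaired, .toSolo, .toSolo],
        ![.toSolo, .toPaired, .toSolo], ![.toSolo, .toSolo, .toPaired],
        ![.toPaired, .toPaired, .toSolo], ![.toPaired, .toSolo, .toPaired],
        ![.toSolo, .toPaired, .toPaired], ![.toPaired, .toPaired, .toPaired]} := by
    ext a
    simp only [mem_filter, mem_univ, true_and]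
    revert a
    unfold IsAdmissible
    decide +kernel
  rw [h]
  repeat rw [sum_insert (by decide +kernel)]
  simp only [sum_singleton, Fin.prod_univ_three, Matrix.cons_val]
  ring

/-- The exponential moment bound for the number of labellings. -/
lemma card_labellings_mul_le (n a m : ℕ) {g : Label → ℝ} (hg : ∀ l, 0 ≤ g l) :
    (#(labellings n a m) : ℝ) * (g .solo ^ a * g .toSolo ^ a * g .link ^ m * g .toPaired ^ m *
        g .wing ^ (2 * m) * g .idle ^ (3 * n - 2 * a - 4 * m)) ≤
      (∑ a : Fin 3 → Label with IsAdmissible a, ∏ j, g (a j)) ^ n := by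
  have hprod : ∀ c ∈ labellings n a m, ∏ v, ∏ j, g (c v j) =
      g .solo ^ a * g .toSolo ^ a * g .link ^ m * g .toPaired ^ m *
        g .wing ^ (2 * m) * g .idle ^ (3 * n - 2 * a - 4 * m) := by
    intro c hc
    have hi := labelCount_idle hc
    obtain ⟨-, h₁, h₂, h₃, h₄, h₅⟩ := (mem_filter.1 hc).2
    have e : ∏ v, ∏ j, g (c v j) = ∏ l, g l ^ labelCount c l := by
      rw [← Fintype.prod_prod_type (f := fun p : Fin n × Fin 3 => g (c p.1 p.2)),
        ← prod_fiberwise (s := univ) (g := fun p : Fin n × Fin 3 => c p.1 p.2)]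
      refine prod_congr rfl fun l _ => ?_
      rw [prod_congr rfl (g := fun _ => g l) (fun p hp => by rw [(mem_filter.1 hp).2]), prod_const]
      rfl
    have hu : (univ : Finset Label) = {.solo, .link, .wing, .toSolo, .toPaired, .idle} := rfl
    rw [e, hu]
    repeat rw [prod_insert (by decide)]
    rw [prod_singleton, h₁, h₂, h₃, h₄, h₅,
      show labelCount c .idle = 3 * n - 2 * a - 4 * m by omega]
    ring
  have hpow : (∑ a : Fin 3 → Label with IsAdmissible a, ∏ j, g (a j)) ^ n =
      ∑ c ∈ Fintype.piFinset fun _ : Fin n => ({a | IsAdmissible a} : Finset (Fin 3 → Label)),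
        ∏ v, ∏ j, g (c v j) := by
    have := prod_univ_sum (fun _ : Fin n => ({a | IsAdmissible a} : Finset (Fin 3 → Label)))
      (fun _ a => ∏ j, g (a j))
    rwa [prod_const, card_univ, Fintype.card_fin] at this
  rw [hpow, ← nsmul_eq_mul, ← sum_const, ← sum_congr rfl hprod]
  refine sum_le_sum_of_subset_of_nonneg (fun c hc => ?_)
    fun c _ _ => prod_nonneg fun v _ => prod_nonneg fun j _ => hg _
  exact Fintype.mem_piFinset.2 fun v => mem_filter.2 ⟨mem_univ _, (mem_filter.1 hc).2.1 v⟩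

end WeightedCount

section Factorials

open Real

lemma log_factorial_le (m : ℕ) : log (m ! : ℝ) ≤ m * log m - m + log (m + 1) + 1 := by
  rcases m with _ | m
  · simp
  have h := Stirling.stirlingSeq'_antitone (Nat.zero_le m)
  simp only [Function.comp_apply, Nat.succ_eq_add_one, zero_add, Stirling.stirlingSeq_one] at h
  have hm : (0 : ℝ) < ((m + 1 : ℕ) : ℝ) := by positivity
  have hpos : 0 < Stirling.stirlingSeq (m + 1) := Stirling.stirlingSeq'_pos m
  have h' := log_le_log hpos h
  rw [Stirling.log_stirlingSeq_formula, log_div (exp_pos _).ne' (by positivity), log_exp,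
    log_sqrt (by norm_num), log_mul (by norm_num) hm.ne', log_div hm.ne' (exp_pos _).ne',
    log_exp] at h'
  have h₁ : log ((m + 1 : ℕ) : ℝ) ≤ log ((m + 1 : ℕ) + 1) := log_le_log hm (by linarith)
  have h₂ : 0 ≤ log ((m + 1 : ℕ) : ℝ) := log_natCast_nonneg _
  linarith

lemma le_log_factorial {m : ℕ} (hm : 0 < m) : m * log m - m ≤ log (m ! : ℝ) := by
  have hm' : (0 : ℝ) < m := by exact_mod_cast hm
  have h := pow_div_factorial_le_exp _ hm'.le m
  have h' := log_le_log (by positivity) h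
  rw [log_div (by positivity) (by positivity), log_pow, log_exp] at h'
  linarith

lemma doubleFactorial_le_succ (m : ℕ) : m ‼ ≤ (m + 1)‼ := by
  induction m using Nat.strong_induction_on with
  | _ m ih =>
    rcases m with _ | _ | m
    · simp
    · simp [Nat.doubleFactorial]
    · rw [Nat.doubleFactorial_add_two, show m + 2 + 1 = m + 1 + 2 from rfl,
        Nat.doubleFactorial_add_two]
      exact Nat.mul_le_mul (by omega) (ih m (by omega))

lemma log_doubleFactorial_le (m : ℕ) : log ((m - 1)‼ : ℝ) ≤ log (m ! : ℝ) / 2 := by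
  rcases m with _ | m
  · simp
  have h : (m ‼ : ℝ) ^ 2 ≤ ((m + 1)! : ℝ) := by
    rw [Nat.factorial_eq_mul_doubleFactorial, sq]
    exact_mod_cast Nat.mul_le_mul_right _ (doubleFactorial_le_succ m)
  have hpos : (0 : ℝ) < (m ‼ : ℝ) := by exact_mod_cast Nat.doubleFactorial_pos m
  have := log_le_log (by positivity) h
  rw [log_pow] at this
  push_cast at this
  rw [Nat.add_sub_cancel]
  linarith

lemma le_log_doubleFactorial {m : ℕ} (hm : 0 < m) :
    (log (m ! : ℝ) - log m) / 2 ≤ log ((m - 1)‼ : ℝ) := by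
  obtain ⟨m, rfl⟩ : ∃ k, m = k + 1 := ⟨m - 1, by omega⟩
  have h : ((m + 1)! : ℝ) ≤ (m + 1 : ℕ) * (m ‼ : ℝ) ^ 2 := by
    rw [Nat.factorial_eq_mul_doubleFactorial, sq, ← mul_assoc]
    have : (m + 1)‼ ≤ (m + 1) * m ‼ := by
      rcases m with _ | m
      · simp
      · rw [Nat.doubleFactorial_add_two]
        exact Nat.mul_le_mul_left _ (doubleFactorial_le_succ m)
    exact_mod_cast Nat.mul_le_mul_right _ this
  have hpos : (0 : ℝ) < (m ‼ : ℝ) := by exact_mod_cast Nat.doubleFactorial_pos m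
  have := log_le_log (by positivity) h
  rw [log_mul (by positivity) (by positivity), log_pow] at this
  rw [Nat.add_sub_cancel]
  push_cast at this ⊢
  linarith

end Factorials

section GrowthRate

open Real

lemma mul_log_le_tangent {x z c : ℝ} (hx : 0 ≤ x) (hz : 0 < z) (hc : 0 < c) :
    x * log z ≤ x * (log c + z / c - 1) := by
  have h := log_le_sub_one_of_pos (div_pos hz hc)
  rw [log_div hz.ne' hc.ne'] at h
  exact mul_le_mul_of_nonneg_left (by linarith) hx

lemma mul_log_ratio_le_tangent {x z c : ℝ} (hx : 0 ≤ x) (hxz : x ≤ z) (hc : 0 < c) :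
    x * (log z - log x) ≤ x * log c + z / c - x := by
  rcases hx.eq_or_lt with rfl | hx
  · simpa using div_nonneg hxz hc.le
  · have hz := hx.trans_le hxz
    have h := mul_log_le_tangent hx.le (div_pos hz hx) hc
    rw [log_div hz.ne' hx.ne'] at h
    have e : x * (log c + z / x / c - 1) = x * log c + z / c - x := by
      field_simp
    linarith

lemma neg_mul_log_le_tangent {x c : ℝ} (hx : 0 ≤ x) (hc : 0 < c) :
    -(x * log x) ≤ -(x * log c) - x + c := by
  rcases hx.eq_or_lt with rfl | hx
  · simpa using hc.le
  · have h := mul_log_le_tangent hx.le (inv_pos.2 hx) (inv_pos.2 hc)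
    rw [log_inv, log_inv] at h
    have e : x * (-log c + x⁻¹ / c⁻¹ - 1) = -(x * log c) - x + c := by
      field_simp
      ring
    linarith

/-- The exponential growth rate of the expected number of certificates, as a function of the
densities `y` of unpaired vertices of the independent set and `k` of pairs. -/
noncomputable def growthRate (y k : ℝ) : ℝ :=
  -(y * log y) - k * log k - (3 - 6 * y - 8 * k) * log (3 - 6 * y - 8 * k)
    - (5 * y + 6 * k - 2) * log (5 * y + 6 * k - 2)
    + k * log (9 / 2) + (3 - 6 * y - 8 * k) * log 3
    + (3 * y + 2 * k) * log (3 * y + 2 * k)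
    + (3 - 6 * y - 8 * k) * log (1 - (2 * k / (3 * y + 2 * k)) ^ 2)
    + (3 - 6 * y - 6 * k) * log (3 - 6 * y - 6 * k) / 2 - 3 / 2 * log 3

/-- Replacing every logarithm in `growthRate` by a tangent line. -/
lemma growthRate_le_tangents {y k c₁ c₂ c₃ c₄ c₅ c₆ : ℝ} (hy : 0 < y) (hk : 0 ≤ k)
    (h₂ : 0 ≤ 3 - 6 * y - 8 * k) (h₃ : 0 < 5 * y + 6 * k - 2)
    (hc₁ : 0 < c₁) (hc₂ : 0 < c₂) (hc₃ : 0 < c₃) (hc₄ : 0 < c₄) (hc₅ : 0 < c₅) (hc₆ : 0 < c₆) :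
    growthRate y k ≤ (y * log c₁ + (3 * y + 2 * k) / c₁ - y)
      + 2 * (y + k) * (log c₂ + (3 * y + 2 * k) / c₂ - 1)
      + ((3 - 6 * y - 8 * k) * log c₃ + (3 - 6 * y - 6 * k) / c₃ - (3 - 6 * y - 8 * k)) / 2
      + (k * log c₄ + (3 - 6 * y - 6 * k) / c₄ - k)
      + (-((3 - 6 * y - 8 * k) * log c₅) - (3 - 6 * y - 8 * k) + c₅) / 2
      + (-((5 * y + 6 * k - 2) * log c₆) - (5 * y + 6 * k - 2) + c₆)
      + k * (2 * log 3 - log 2) + (3 - 6 * y - 8 * k) * log 3 - 3 / 2 * log 3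
      - (3 - 6 * y - 8 * k) * (2 * k / (3 * y + 2 * k)) ^ 2 := by
  have t₁ := mul_log_ratio_le_tangent (x := y) (z := 3 * y + 2 * k) hy.le (by linarith) hc₁
  have t₂ := mul_log_le_tangent (x := 2 * (y + k)) (z := 3 * y + 2 * k) (by linarith)
    (by linarith) hc₂
  have t₃ := mul_log_ratio_le_tangent (x := 3 - 6 * y - 8 * k) (z := 3 - 6 * y - 6 * k) h₂
    (by linarith) hc₃
  have t₄ := mul_log_ratio_le_tangent (x := k) (z := 3 - 6 * y - 6 * k) hk (by linarith) hc₄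
  have t₅ := neg_mul_log_le_tangent h₂ hc₅
  have t₆ := neg_mul_log_le_tangent h₃.le hc₆
  have hlt : (2 * k / (3 * y + 2 * k)) ^ 2 < 1 := by
    rw [sq_lt_one_iff₀ (by positivity), div_lt_one (by positivity)]
    linarith
  have t₇ := mul_le_mul_of_nonneg_left
    (log_le_sub_one_of_pos (x := 1 - (2 * k / (3 * y + 2 * k)) ^ 2) (by linarith)) h₂
  have e : log (9 / 2 : ℝ) = 2 * log 3 - log 2 := by
    rw [log_div (by norm_num) (by norm_num), show (9 : ℝ) = 3 ^ 2 by norm_num, log_pow]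
    norm_num
  unfold growthRate
  rw [e]
  linarith

/-- `growthRate_le_tangents` with numerical bounds for the logarithms. -/
lemma growthRate_le_polynomial {y k c₁ c₂ c₃ c₄ c₅ c₆ L₁ L₂ L₃ L₄ L₅ L₆ : ℝ}
    (hy : 0 < y) (hk : 0 ≤ k)
    (h₂ : 0 ≤ 3 - 6 * y - 8 * k) (h₃ : 0 < 5 * y + 6 * k - 2)
    (hc₁ : 0 < c₁) (hc₂ : 0 < c₂) (hc₃ : 0 < c₃) (hc₄ : 0 < c₄) (hc₅ : 0 < c₅) (hc₆ : 0 < c₆)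
    (hL₁ : log c₁ ≤ L₁) (hL₂ : log c₂ ≤ L₂) (hL₃ : log c₃ ≤ L₃) (hL₄ : log c₄ ≤ L₄)
    (hL₅ : -log c₅ ≤ L₅) (hL₆ : -log c₆ ≤ L₆) :
    growthRate y k ≤ (y * L₁ + (3 * y + 2 * k) / c₁ - y)
      + 2 * (y + k) * (L₂ + (3 * y + 2 * k) / c₂ - 1)
      + ((3 - 6 * y - 8 * k) * L₃ + (3 - 6 * y - 6 * k) / c₃ - (3 - 6 * y - 8 * k)) / 2
      + (k * L₄ + (3 - 6 * y - 6 * k) / c₄ - k)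
      + ((3 - 6 * y - 8 * k) * L₅ - (3 - 6 * y - 8 * k) + c₅) / 2
      + ((5 * y + 6 * k - 2) * L₆ - (5 * y + 6 * k - 2) + c₆)
      + k * 1.5040774 + (3 - 6 * y - 8 * k) * 1.0986122888 - 3 / 2 * 1.0986122885
      - (3 - 6 * y - 8 * k) * (2 * k / (3 * y + 2 * k)) ^ 2 := by
  have T := growthRate_le_tangents hy hk h₂ h₃ hc₁ hc₂ hc₃ hc₄ hc₅ hc₆
  have a2 := log_two_gt_d9
  have a3 := log_three_gt_d9
  have b3 := log_three_lt_d9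
  have m₁ := mul_le_mul_of_nonneg_left hL₁ hy.le
  have m₂ := mul_le_mul_of_nonneg_left hL₂ (show 0 ≤ 2 * (y + k) by linarith)
  have m₃ := mul_le_mul_of_nonneg_left hL₃ h₂
  have m₄ := mul_le_mul_of_nonneg_left hL₄ hk
  have m₅ := mul_le_mul_of_nonneg_left hL₅ h₂
  have m₆ := mul_le_mul_of_nonneg_left hL₆ h₃.le
  have m₇ := mul_le_mul_of_nonneg_left
    (show 2 * log 3 - log 2 ≤ (1.5040774 : ℝ) by linarith) hk
  have m₈ := mul_le_mul_of_nonneg_left b3.le h₂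
  linarith

lemma log_four_div_three_le : log (4 / 3 : ℝ) ≤ 0.287682074 := by
  have := log_two_lt_d9
  have := log_three_gt_d9
  rw [log_div (by norm_num) (by norm_num), log_four_eq]
  linarith

lemma growthRate_le_of_le {y k : ℝ} (hy : 0 < y) (hk : 0 ≤ k) (h₂ : 0 ≤ 3 - 6 * y - 8 * k)
    (hα : 0.454 ≤ y + k) (hk' : k ≤ 0.045) : growthRate y k ≤ -(1 / 20000) := by
  have u : log (25 / 8 : ℝ) ≤ 1.139434285 ∧ log (5 / 4 : ℝ) ≤ 0.223143553 ∧
      log (32 / 3 : ℝ) ≤ 2.367123616 ∧ -log (2 / 9 : ℝ) ≤ 1.5040774 ∧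
      -log (8 / 27 : ℝ) ≤ 1.2163954 := by
    have := log_two_gt_d9
    have := log_two_lt_d9
    have := log_three_gt_d9
    have := log_three_lt_d9
    have := log_five_lt_d9
    refine ⟨?_, ?_, ?_, ?_, ?_⟩
    · rw [log_div (by norm_num) (by norm_num), show (25 : ℝ) = 5 ^ 2 by norm_num,
        show (8 : ℝ) = 2 ^ 3 by norm_num, log_pow, log_pow]
      push_cast; linarith
    · rw [log_div (by norm_num) (by norm_num), log_four_eq]; linarith
    · rw [log_div (by norm_num) (by norm_num), show (32 : ℝ) = 2 ^ 5 by norm_num, log_pow]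
      push_cast; linarith
    · rw [log_div (by norm_num) (by norm_num), show (9 : ℝ) = 3 ^ 2 by norm_num, log_pow]
      push_cast; linarith
    · rw [log_div (by norm_num) (by norm_num), show (27 : ℝ) = 3 ^ 3 by norm_num,
        show (8 : ℝ) = 2 ^ 3 by norm_num, log_pow, log_pow]
      push_cast; linarith
  have T := growthRate_le_polynomial (c₁ := 25 / 8) (c₂ := 4 / 3) (c₃ := 5 / 4) (c₄ := 32 / 3)
    (c₅ := 2 / 9) (c₆ := 8 / 27) hy hk h₂ (by linarith) (by norm_num) (by norm_num) (by norm_num)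
    (by norm_num) (by norm_num) (by norm_num) u.1 log_four_div_three_le u.2.1 u.2.2.1 u.2.2.2.1
    u.2.2.2.2
  obtain ⟨s, rfl⟩ : ∃ s, y = s - k := ⟨y + k, by ring⟩
  have hs : 0.454 ≤ s := by linarith
  have hs₂ : s ≤ 0.5 := by linarith
  have q₄ := mul_nonneg (show 0 ≤ s - 0.454 by linarith) hk
  rcases le_total s 0.455 with hs' | hs'
  · have hS : (2 * k / 1.365) ^ 2 ≤ (2 * k / (3 * (s - k) + 2 * k)) ^ 2 := by
      gcongr
      linarith
    have m₉ : (0.27 - 2 * k) * (2 * k / 1.365) ^ 2 ≤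
        (3 - 6 * (s - k) - 8 * k) * (2 * k / (3 * (s - k) + 2 * k)) ^ 2 :=
      mul_le_mul (by linarith) hS (by positivity) h₂
    have q₁ := mul_nonneg (sq_nonneg (k - 0.0263)) (show 0 ≤ 0.1648 - 2 * k by linarith)
    have q₃ := mul_nonneg (show 0 ≤ s - 0.454 by linarith) (show 0 ≤ 0.455 - s by linarith)
    ring_nf at T m₉ q₁ q₃ q₄ ⊢
    linarith
  · have m₉ : 0 ≤ (3 - 6 * (s - k) - 8 * k) * (2 * k / (3 * (s - k) + 2 * k)) ^ 2 := by positivity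
    have q₃ := mul_nonneg (show 0 ≤ s - 0.455 by linarith) (show 0 ≤ 0.5 - s by linarith)
    ring_nf at T m₉ q₃ q₄ ⊢
    linarith

lemma growthRate_le_of_ge {y k : ℝ} (hy : 0 < y) (hk : 0.045 ≤ k) (h₂ : 0 ≤ 3 - 6 * y - 8 * k)
    (hα : 0.454 ≤ y + k) : growthRate y k ≤ -(1 / 20000) := by
  have u : log (16 / 5 : ℝ) ≤ 1.1632 ∧ log (3 / 2 : ℝ) ≤ 0.4055 ∧ log (6 : ℝ) ≤ 1.7918 ∧
      -log (3 / 16 : ℝ) ≤ 1.674 ∧ -log (5 / 16 : ℝ) ≤ 1.1632 := by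
    have := log_two_gt_d9
    have := log_two_lt_d9
    have := log_three_gt_d9
    have := log_three_lt_d9
    have := log_five_gt_d9
    have l16 : log (16 : ℝ) = 4 * log 2 := by
      rw [show (16 : ℝ) = 2 ^ 4 by norm_num, log_pow]; push_cast; ring
    refine ⟨?_, ?_, ?_, ?_, ?_⟩
    · rw [log_div (by norm_num) (by norm_num), l16]; linarith
    · rw [log_div (by norm_num) (by norm_num)]; linarith
    · rw [show (6 : ℝ) = 2 * 3 by norm_num, log_mul (by norm_num) (by norm_num)]; linarith
    · rw [log_div (by norm_num) (by norm_num), l16]; linarith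
    · rw [log_div (by norm_num) (by norm_num), l16]; linarith
  have hk₀ : 0 ≤ k := by linarith
  have T := growthRate_le_polynomial (c₁ := 16 / 5) (c₂ := 4 / 3) (c₃ := 3 / 2) (c₄ := 6)
    (c₅ := 3 / 16) (c₆ := 5 / 16) hy hk₀ h₂ (by linarith) (by norm_num) (by norm_num)
    (by norm_num) (by norm_num) (by norm_num) (by norm_num) u.1 log_four_div_three_le u.2.1
    u.2.2.1 u.2.2.2.1 u.2.2.2.2
  obtain ⟨s, rfl⟩ : ∃ s, y = s - k := ⟨y + k, by ring⟩
  have hs : 0.454 ≤ s := by linarith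
  have hs₂ : s ≤ 0.5 := by linarith
  have q₄ := mul_nonneg (show 0 ≤ s - 0.454 by linarith) hk₀
  have m₉ : 0 ≤ (3 - 6 * (s - k) - 8 * k) * (2 * k / (3 * (s - k) + 2 * k)) ^ 2 := by positivity
  have q₃ := mul_nonneg (show 0 ≤ s - 0.454 by linarith) (show 0 ≤ 0.5 - s by linarith)
  ring_nf at T m₉ q₃ q₄ ⊢
  linarith

lemma growthRate_le {y k : ℝ} (hy : 0 < y) (hk : 0 ≤ k) (h₂ : 0 ≤ 3 - 6 * y - 8 * k)
    (hα : 0.454 ≤ y + k) : growthRate y k ≤ -(1 / 20000) :=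
  (le_total k 0.045).elim (growthRate_le_of_le hy hk h₂ hα)
    (growthRate_le_of_ge hy · h₂ hα)

end GrowthRate

section Estimates

open Real

lemma log_card_labellings_le {n a m : ℕ} {y k : ℝ} (hne : (labellings n a m).Nonempty)
    (ha : (a : ℝ) = 3 * y * n) (hm : (m : ℝ) = 2 * k * n) (hn : 0 < n) (hy : 0 < y) (hk : 0 ≤ k)
    (h₂ : 0 ≤ 3 - 6 * y - 8 * k) (h₃ : 0 < 5 * y + 6 * k - 2) :
    log #(labellings n a m) ≤ n * (-(y * log y) - 4 * k * log k - 4 * k * (log 2 - log 3)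
      + 2 * k * log y - (3 - 6 * y - 8 * k) * log (3 - 6 * y - 8 * k)
      + (3 - 6 * y - 8 * k) * log 3
      + (3 - 6 * y - 8 * k) * log (1 - (2 * k / (3 * y + 2 * k)) ^ 2)
      - (5 * y + 6 * k - 2) * log (5 * y + 6 * k - 2)
      + (3 * y + 2 * k) * (log (3 * y + 2 * k) - log 3 - log y)) := by
  classical
  have hn' : (0 : ℝ) < n := by exact_mod_cast hn
  obtain ⟨x, hx⟩ : ∃ x, x = 2 * k / (3 * y) := ⟨_, rfl⟩
  have hx₀ : 0 ≤ x := hx ▸ by positivity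
  obtain ⟨γ, hγ⟩ : ∃ γ, γ = exp (log (5 * y + 6 * k - 2) / 3) / (1 + x) := ⟨_, rfl⟩
  have hγ₀ : 0 < γ := hγ ▸ by positivity
  have hγ₃ : γ ^ 3 * (1 + x) ^ 3 = 5 * y + 6 * k - 2 := by
    rw [hγ, div_pow, div_mul_cancel₀ _ (by positivity), ← exp_nat_mul]
    push_cast
    rw [mul_div_cancel₀ _ (by norm_num), exp_log h₃]
  have hlogγ : log γ = log (5 * y + 6 * k - 2) / 3 - log (1 + x) := by
    rw [hγ, log_div (exp_pos _).ne' (by positivity), log_exp]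
  have hlog₁ : log (1 + x) = log (3 * y + 2 * k) - log 3 - log y := by
    rw [show 1 + x = (3 * y + 2 * k) / (3 * y) by rw [hx]; field_simp,
      log_div (by positivity) (by positivity), log_mul (by norm_num) hy.ne']
    ring
  have hlog₂ : log (1 + 2 * x) =
      log (1 - (2 * k / (3 * y + 2 * k)) ^ 2) + 2 * log (1 + x) := by
    have e : (1 + 2 * x) / (1 + x) ^ 2 = 1 - (2 * k / (3 * y + 2 * k)) ^ 2 := by
      rw [hx]
      have : 3 * y + 2 * k ≠ 0 := by positivity
      field_simp
      ring
    rw [← e, log_div (by positivity) (by positivity), log_pow]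
    push_cast
    ring
  let g : Label → ℝ
    | .solo => exp (log y / 3)
    | .link => 2 * k / 3
    | .wing => 1
    | .toSolo => γ
    | .toPaired => x * γ
    | .idle => (3 - 6 * y - 8 * k) / (3 * γ ^ 2 * (1 + 2 * x))
  have hg : ∀ l, 0 ≤ g l := by
    rintro (_ | _ | _ | _ | _ | _) <;> simp only [g] <;> positivity
  have hsum : ∑ a : Fin 3 → Label with IsAdmissible a, ∏ j, g (a j) = 1 := by
    rw [sum_isAdmissible]
    simp only [g]
    have e₁ : exp (log y / 3) ^ 3 = y := by
      rw [← exp_nat_mul]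
      push_cast
      rw [mul_div_cancel₀ _ (by norm_num), exp_log hy]
    have e₂ : 3 * ((3 - 6 * y - 8 * k) / (3 * γ ^ 2 * (1 + 2 * x)) *
        (γ ^ 2 + 2 * (γ * (x * γ)))) = 3 - 6 * y - 8 * k := by
      field_simp
    have e₃ : (γ + x * γ) ^ 3 = 5 * y + 6 * k - 2 := by
      rw [← hγ₃]
      ring
    rw [e₁, e₂, e₃]
    ring
  have hbound := card_labellings_mul_le n a m hg
  rw [hsum, one_pow] at hbound
  obtain ⟨c, hc⟩ := hne
  have hi := labelCount_idle hc
  obtain ⟨N, hN⟩ : ∃ N, N = 3 * n - 2 * a - 4 * m := ⟨_, rfl⟩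
  have hN' : (N : ℝ) = (3 - 6 * y - 8 * k) * n := by
    have : 2 * a + 4 * m + N = 3 * n := by omega
    have : 2 * (a : ℝ) + 4 * m + N = 3 * n := by exact_mod_cast this
    rw [ha, hm] at this
    linarith
  rw [← hN] at hbound
  simp only [g, one_pow, mul_one] at hbound
  have hC : (0 : ℝ) < #(labellings n a m) := by exact_mod_cast card_pos.2 ⟨c, hc⟩
  have hkm : k = 0 → m = 0 := fun h => by
    rw [h, mul_zero, zero_mul] at hm
    exact_mod_cast hm
  have n₁ : exp (log y / 3) ^ a ≠ 0 := by positivity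
  have n₂ : γ ^ a ≠ 0 := by positivity
  have n₃ : (2 * k / 3) ^ m ≠ 0 := by
    rcases hk.eq_or_lt with h | h
    · simp [hkm h.symm]
    · positivity
  have n₄ : (x * γ) ^ m ≠ 0 := by
    rcases hk.eq_or_lt with h | h
    · simp [hkm h.symm]
    · have : 0 < x := hx ▸ by positivity
      positivity
  have hN₀ : 3 - 6 * y - 8 * k = 0 → N = 0 := fun h => by
    rw [h, zero_mul] at hN'
    exact_mod_cast hN'
  have n₅ : ((3 - 6 * y - 8 * k) / (3 * γ ^ 2 * (1 + 2 * x))) ^ N ≠ 0 := by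
    rcases h₂.eq_or_lt with h | h
    · simp [hN₀ h.symm]
    · positivity
  have hlog := log_le_log (mul_pos hC (lt_of_le_of_ne (by positivity) (by
    exact (mul_ne_zero (mul_ne_zero (mul_ne_zero (mul_ne_zero n₁ n₂) n₃) n₄) n₅).symm))) hbound
  rw [log_mul hC.ne' (mul_ne_zero (mul_ne_zero (mul_ne_zero (mul_ne_zero n₁ n₂) n₃) n₄) n₅),
    log_mul (mul_ne_zero (mul_ne_zero (mul_ne_zero n₁ n₂) n₃) n₄) n₅,
    log_mul (mul_ne_zero (mul_ne_zero n₁ n₂) n₃) n₄, log_mul (mul_ne_zero n₁ n₂) n₃,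
    log_mul n₁ n₂, log_pow, log_pow, log_pow, log_pow, log_pow, log_exp, log_one] at hlog
  have t₃ : (m : ℝ) * log (2 * k / 3) = m * (log 2 + log k - log 3) := by
    rcases hk.eq_or_lt with h | h
    · simp [hkm h.symm]
    · rw [log_div (by positivity) (by norm_num), log_mul (by norm_num) h.ne']
  have t₄ : (m : ℝ) * log (x * γ) = m * (log 2 + log k - log 3 - log y + log γ) := by
    rcases hk.eq_or_lt with h | h
    · simp [hkm h.symm]
    · rw [hx, log_mul (by positivity) hγ₀.ne', log_div (by positivity) (by positivity),
        log_mul (by norm_num) h.ne', log_mul (by norm_num) hy.ne']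
      ring
  have t₅ : (N : ℝ) * log ((3 - 6 * y - 8 * k) / (3 * γ ^ 2 * (1 + 2 * x))) =
      N * (log (3 - 6 * y - 8 * k) - log 3 - 2 * log γ - log (1 + 2 * x)) := by
    rcases h₂.eq_or_lt with h | h
    · simp [hN₀ h.symm]
    · rw [log_div h.ne' (by positivity), log_mul (by positivity) (by positivity),
        log_mul (by norm_num) (by positivity), log_pow]
      push_cast
      ring
  rw [t₃, t₄, t₅, hlog₂, hlogγ, hlog₁, ha, hm, hN'] at hlog
  linarith

/-- The expected number of pairs of a labelling and a compatible pairing, on a logarithmic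
scale. -/
lemma log_card_mul_le {n a m : ℕ} {y k : ℝ} (hne : (labellings n a m).Nonempty)
    (ha : (a : ℝ) = 3 * y * n) (hm : (m : ℝ) = 2 * k * n) (hn : 0 < n) (hy : 0 < y) (hk : 0 ≤ k)
    (h₂ : 0 ≤ 3 - 6 * y - 8 * k) (h₃ : 0 < 5 * y + 6 * k - 2) :
    log (#(labellings n a m) * ((m - 1)‼ * (a ! * m ! * (3 * n - 2 * a - 3 * m - 1)‼)) : ℕ) ≤
      log (3 * n - 1)‼ + n * growthRate y k + 4 * log (3 * n + 1) + 3 := by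
  have hn' : (0 : ℝ) < n := by exact_mod_cast hn
  have hcard := log_card_labellings_le hne ha hm hn hy hk h₂ h₃
  obtain ⟨c, hc⟩ := hne
  have hi := labelCount_idle hc
  have hC : (0 : ℝ) < #(labellings n a m) := by exact_mod_cast card_pos.2 ⟨c, hc⟩
  obtain ⟨r, hr⟩ : ∃ r, r = 3 * n - 2 * a - 3 * m := ⟨_, rfl⟩
  have hr' : (r : ℝ) = (3 - 6 * y - 6 * k) * n := by
    have : 2 * a + 3 * m + r = 3 * n := by omega
    have : 2 * (a : ℝ) + 3 * m + r = 3 * n := by exact_mod_cast this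
    rw [ha, hm] at this
    linarith
  rw [← hr]
  have hdf : ∀ l : ℕ, ((l ‼ : ℕ) : ℝ) ≠ 0 := fun l =>
    Nat.cast_ne_zero.2 (Nat.doubleFactorial_pos l).ne'
  have hf : ∀ l : ℕ, ((l ! : ℕ) : ℝ) ≠ 0 := fun l => Nat.cast_ne_zero.2 l.factorial_ne_zero
  push_cast
  rw [log_mul hC.ne' (mul_ne_zero (hdf _) (mul_ne_zero (mul_ne_zero (hf _) (hf _)) (hdf _))),
    log_mul (hdf _) (mul_ne_zero (mul_ne_zero (hf _) (hf _)) (hdf _)),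
    log_mul (mul_ne_zero (hf _) (hf _)) (hdf _), log_mul (hf _) (hf _)]
  have f₁ := log_doubleFactorial_le m
  have f₂ := log_doubleFactorial_le r
  have f₃ := le_log_doubleFactorial (m := 3 * n) (by omega)
  have f₄ := log_factorial_le m
  have f₅ := log_factorial_le a
  have f₆ := log_factorial_le r
  have f₇ := le_log_factorial (m := 3 * n) (by omega)
  have mono : ∀ l : ℕ, l ≤ 3 * n → log ((l : ℝ) + 1) ≤ log (3 * n + 1) := fun l hl => by
    have : (l : ℝ) ≤ 3 * n := by exact_mod_cast hl
    exact log_le_log (by positivity) (by linarith)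
  have l₁ := mono m (by omega)
  have l₂ := mono a (by omega)
  have l₃ := mono r (by omega)
  have l₄ : log (3 * n : ℝ) ≤ log (3 * n + 1) := log_le_log (by positivity) (by linarith)
  have l₅ : 0 ≤ log (3 * n + 1 : ℝ) := log_nonneg (by linarith)
  have e₁ : (m : ℝ) * log m = 2 * k * n * (log 2 + log k + log n) := by
    rw [hm]
    rcases hk.eq_or_lt with rfl | h
    · simp
    · rw [log_mul (by positivity) hn'.ne', log_mul (by norm_num) h.ne']
  have e₂ : (a : ℝ) * log a = 3 * y * n * (log 3 + log y + log n) := by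
    rw [ha, log_mul (by positivity) hn'.ne', log_mul (by norm_num) hy.ne']
  have e₃ : (r : ℝ) * log r =
      (3 - 6 * y - 6 * k) * n * (log (3 - 6 * y - 6 * k) + log n) := by
    rw [hr']
    rcases (show 0 ≤ 3 - 6 * y - 6 * k by linarith).eq_or_lt with h | h
    · simp [← h]
    · rw [log_mul h.ne' hn'.ne']
  have e₄ : (3 * n : ℝ) * log (3 * n) = 3 * n * (log 3 + log n) := by
    rw [log_mul (by norm_num) hn'.ne']
  push_cast at f₃ f₇
  rw [e₁, hm] at f₄
  rw [e₂, ha] at f₅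
  rw [e₃, hr'] at f₆
  rw [e₄] at f₇
  rw [hm] at l₁
  rw [ha] at l₂
  rw [hr'] at l₃
  have e₅ : log (9 / 2 : ℝ) = 2 * log 3 - log 2 := by
    rw [log_div (by norm_num) (by norm_num), show (9 : ℝ) = 3 ^ 2 by norm_num, log_pow]
    norm_num
  unfold growthRate
  rw [e₅]
  linarith

lemma card_mul_le {n a m : ℕ} (hne : (labellings n a m).Nonempty) (hn : 0 < n)
    (hα : 6 * 0.454 * (n : ℝ) < 2 * a + 3 * m) :
    ((#(labellings n a m) * ((m - 1)‼ * (a ! * m ! * (3 * n - 2 * a - 3 * m - 1)‼)) : ℕ) : ℝ) ≤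
      (3 * n - 1)‼ * (exp 3 * (3 * n + 1) ^ 4 * exp (-(n / 20000))) := by
  have hn' : (0 : ℝ) < n := by exact_mod_cast hn
  obtain ⟨y, hy⟩ : ∃ y : ℝ, y = a / (3 * n) := ⟨_, rfl⟩
  obtain ⟨k, hk⟩ : ∃ k : ℝ, k = m / (2 * n) := ⟨_, rfl⟩
  have ha : (a : ℝ) = 3 * y * n := by rw [hy]; field_simp
  have hm : (m : ℝ) = 2 * k * n := by rw [hk]; field_simp
  have hk₀ : 0 ≤ k := hk ▸ by positivity
  have hα' : 0.454 ≤ y + k := by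
    rw [ha, hm] at hα
    by_contra! h
    nlinarith
  have h₂ : 0 ≤ 3 - 6 * y - 8 * k := by
    obtain ⟨c, hc⟩ := id hne
    have hi := labelCount_idle hc
    have : 2 * a + 4 * m ≤ 3 * n := by omega
    have : 2 * (a : ℝ) + 4 * m ≤ 3 * n := by exact_mod_cast this
    rw [ha, hm] at this
    by_contra! h
    nlinarith
  have hy₀ : 0 < y := by linarith
  have h := log_card_mul_le hne ha hm hn hy₀ hk₀ h₂ (by linarith)
  have hrate := mul_le_mul_of_nonneg_left (growthRate_le hy₀ hk₀ h₂ hα') hn'.le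
  have hpos : (0 : ℝ) < (#(labellings n a m) *
      ((m - 1)‼ * (a ! * m ! * (3 * n - 2 * a - 3 * m - 1)‼)) : ℕ) := by
    rw [Nat.cast_pos]
    exact Nat.mul_pos (card_pos.2 hne) (Nat.mul_pos (Nat.doubleFactorial_pos _)
      (Nat.mul_pos (Nat.mul_pos a.factorial_pos m.factorial_pos) (Nat.doubleFactorial_pos _)))
  have hdf : (0 : ℝ) < (3 * n - 1)‼ := by exact_mod_cast Nat.doubleFactorial_pos _
  rw [← log_le_log_iff hpos (by positivity), log_mul hdf.ne' (by positivity),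
    log_mul (by positivity) (by positivity), log_mul (by positivity) (by positivity), log_exp,
    log_exp, log_pow]
  push_cast at h ⊢
  linarith

end Estimates

/-- The first moment bound for the number of pairings with large independence number. -/
lemma card_large_indepNum_le {n : ℕ} (hn : 0 < n) :
    (Nat.card {σ : Fin n × Fin 3 → Fin n × Fin 3 //
      MemGSixteen σ ∧ 0.454 * (n : ℝ) < (indepNum (projGraph σ) : ℝ)} : ℝ) ≤
      (3 * n - 1)‼ * (Real.exp 3 * (3 * n + 1) ^ 6 * Real.exp (-(n / 20000))) := by
  classical
  let T : Finset (ℕ × ℕ) := {p ∈ range (3 * n + 1) ×ˢ range (3 * n + 1) |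
    (labellings n p.1 p.2).Nonempty ∧ 6 * 0.454 * (n : ℝ) < 2 * p.1 + 3 * p.2}
  have hsub : ({σ | MemGSixteen σ ∧ 0.454 * (n : ℝ) < (indepNum (projGraph σ) : ℝ)} :
      Finset (Fin n × Fin 3 → Fin n × Fin 3)) ⊆
      T.biUnion fun p => (labellings n p.1 p.2).biUnion fun c => {σ | IsCompatible c σ} := by
    intro σ hσ
    obtain ⟨-, hσ, hα⟩ := mem_filter.1 hσ
    obtain ⟨a, m, c, hc, hcσ, h⟩ := exists_labelling hσ
    have hi := labelCount_idle hc
    refine mem_biUnion.2 ⟨(a, m), mem_filter.2 ⟨mem_product.2 ⟨mem_range.2 ?_, mem_range.2 ?_⟩,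
      ⟨c, hc⟩, ?_⟩, mem_biUnion.2 ⟨c, hc, mem_filter.2 ⟨mem_univ _, hcσ⟩⟩⟩
    · dsimp only; omega
    · dsimp only; omega
    · have : 6 * (indepNum (projGraph σ) : ℝ) = 2 * a + 3 * m := by exact_mod_cast h
      dsimp only
      linarith
  have hT : (#T : ℝ) ≤ (3 * n + 1) ^ 2 := by
    have : #T ≤ (3 * n + 1) ^ 2 := (card_filter_le _ _).trans (by simp [sq])
    exact_mod_cast this
  have hterm : ∀ p ∈ T, (#((labellings n p.1 p.2).biUnion fun c =>
      ({σ | IsCompatible c σ} : Finset (Fin n × Fin 3 → Fin n × Fin 3))) : ℝ) ≤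
        (3 * n - 1)‼ * (Real.exp 3 * (3 * n + 1) ^ 4 * Real.exp (-(n / 20000))) := by
    intro p hp
    obtain ⟨-, hne, hα⟩ := mem_filter.1 hp
    refine le_trans ?_ (card_mul_le hne hn hα)
    exact_mod_cast card_biUnion_le_card_mul _ _ _ fun c hc => card_isCompatible_le hc
  rw [Nat.card_eq_fintype_card, Fintype.card_subtype]
  calc (#({σ | MemGSixteen σ ∧ 0.454 * (n : ℝ) < (indepNum (projGraph σ) : ℝ)} :
        Finset (Fin n × Fin 3 → Fin n × Fin 3)) : ℝ)
      ≤ ∑ p ∈ T, (#((labellings n p.1 p.2).biUnion fun c =>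
        ({σ | IsCompatible c σ} : Finset (Fin n × Fin 3 → Fin n × Fin 3))) : ℝ) := by
        exact_mod_cast (card_le_card hsub).trans card_biUnion_le
    _ ≤ #T * ((3 * n - 1)‼ * (Real.exp 3 * (3 * n + 1) ^ 4 * Real.exp (-(n / 20000)))) := by
        rw [← nsmul_eq_mul]
        exact sum_le_card_nsmul _ _ _ hterm
    _ ≤ (3 * n + 1) ^ 2 *
        ((3 * n - 1)‼ * (Real.exp 3 * (3 * n + 1) ^ 4 * Real.exp (-(n / 20000)))) := by
        gcongr
    _ = _ := by ring

lemma tendsto_pow_mul_exp_neg : Filter.Tendsto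
    (fun n : ℕ => Real.exp 3 * (3 * (n : ℝ) + 1) ^ 6 * Real.exp (-(n / 20000)))
    Filter.atTop (nhds 0) := by
  have hx : Filter.Tendsto (fun n : ℕ => (3 * (n : ℝ) + 1) / 60000) Filter.atTop Filter.atTop :=
    ((tendsto_natCast_atTop_atTop.const_mul_atTop (by norm_num)).atTop_add
      tendsto_const_nhds).atTop_div_const (by norm_num)
  have h := ((Real.tendsto_pow_mul_exp_neg_atTop_nhds_zero 6).comp hx).const_mul
    (Real.exp 3 * 60000 ^ 6 * Real.exp (1 / 60000))
  rw [mul_zero] at h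
  refine h.congr fun n => ?_
  have e : Real.exp (-(n / 20000 : ℝ)) =
      Real.exp (1 / 60000) * Real.exp (-((3 * (n : ℝ) + 1) / 60000)) := by
    rw [← Real.exp_add]
    ring_nf
  simp only [Function.comp_apply]
  have hB : (60000 : ℝ) ^ 6 ≠ 0 := pow_ne_zero 6 (by norm_num)
  rw [e, div_pow]
  generalize (60000 : ℝ) ^ 6 = B at hB ⊢
  generalize Real.exp (1 / 60000) = b
  generalize Real.exp (-((3 * (n : ℝ) + 1) / 60000)) = c
  field_simp

/-- for every `ε > 0` there is `N > 0` such that for every even `n > N`, the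
number of pairings `F ∈ G'_16(n)` with `α(π(F)) > 0.454·n` is less than `ε·(3n−1)!!`. -/
theorem few_pairings_with_large_independence_number (ε : ℝ) (hε : 0 < ε) :
    ∃ N : ℕ, 0 < N ∧ ∀ n : ℕ, Even n → N < n →
      (Nat.card {σ : Fin n × Fin 3 → Fin n × Fin 3 //
          MemGSixteen σ ∧ 0.454 * (n : ℝ) < (indepNum (projGraph σ) : ℝ)} : ℝ)
        < ε * (Nat.doubleFactorial (3 * n - 1) : ℝ) := by
  obtain ⟨N, hN⟩ := Filter.eventually_atTop.1 (tendsto_pow_mul_exp_neg.eventually_lt_const hε)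
  refine ⟨N + 1, N.succ_pos, fun n _ hn => ?_⟩
  refine (card_large_indepNum_le (by omega)).trans_lt ?_
  rw [mul_comm]
  have : (0 : ℝ) < (3 * n - 1)‼ := by exact_mod_cast Nat.doubleFactorial_pos _
  gcongr
  exact hN n (by omega)
end
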